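/- arXiv:2004.14926 — 4 statements merged into one kernel-verified Lean document; each statement's English description precedes it below -/
import Mathlib

section
/- Let α = [0;1,a_2,a_3,…] ∈ (g,1] \ 𝓔, and let n ≥ 2 be minimal such that either (1−α < T_1^n(α) < α/(α+1) and P_n(α) is odd) or (1/(α+1) < T_1^n(α) < α). Set R_n = #{1 ≤ k < n : T_1^k(α) ≥ α} and L = min{k ≥ 1 : a_{k+1} ≠ 1}. Then the matching interval containing α has: endpoints [0;1,overline(a_2,…,a_n,2)] and [0;1,a_2,overline(a_3,…,a_n,a_2+1)] if 1−α < T_1^n(α) < α/(α+1), respectively [0;overline(1,a_2,…,a_n)] and [0;overline(1,a_2,…,a_n,1)] if 1/(α+1) < T_1^n(α) < α (overline denotes a periodically repeated block of partial quotients); matching exponents M = N − 2 = n − R_n if (−1)^{R_n}(T_1^n(α) − 1/2) > 0, and M = N = n − R_n + 1 if (−1)^{R_n}(T_1^n(α) − 1/2) < 0; and pseudocenter [0;1,a_2,…,a_n,2,a_2,…,a_L,1] if 1−α < T_1^n(α) < α/(α+1), respectively [0;1,a_2,…,a_n,1,a_2,…,a_L,2] if 1/(α+1) < T_1^n(α)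 < α. -/
open Set Filter MeasureTheory

/-- The Tanaka–Ito `α`-continued fraction map; `T 1` is the Gauss map. -/
noncomputable def T (α x : ℝ) : ℝ := if x = 0 then 0 else 1 / x - (⌊1 / x + 1 - α⌋ : ℝ)

/-- The small golden mean `g = (√5 - 1)/2`. -/
noncomputable def g : ℝ := (Real.sqrt 5 - 1) / 2

/-- `J` is a matching interval with matching exponents `(M, N)`. -/
def IsMatchingInterval (J : Set ℝ) (M N : ℕ) : Prop :=
  (∃ a b : ℝ, a < b ∧ J = Set.Ioo a b) ∧ J ⊆ Set.Icc 0 1 ∧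
  (∀ α ∈ J, (T α)^[M] (α - 1) = (T α)^[N] α) ∧
  (∀ᵐ α ∂(volume.restrict J), (T α)^[M - 1] (α - 1) ≠ (T α)^[N - 1] α) ∧
  (∀ J' : Set ℝ, (∃ a b : ℝ, a < b ∧ J' = Set.Ioo a b) → J' ⊆ Set.Icc 0 1 →
    (∀ α ∈ J', (T α)^[M] (α - 1) = (T α)^[N] α) →
    (∀ᵐ α ∂(volume.restrict J'), (T α)^[M - 1] (α - 1) ≠ (T α)^[N - 1] α) →
    J ⊆ J' → J' = J)

/-- The matching set: the union of all matching intervals. -/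
def MatchingSet : Set ℝ := {x | ∃ (J : Set ℝ) (M N : ℕ), IsMatchingInterval J M N ∧ x ∈ J}

/-- The bifurcation set `𝓔`: the complement in `[0,1]` of the matching set. -/
def E : Set ℝ := Set.Icc 0 1 \ MatchingSet

/-- The `(k+1)`-st regular continued fraction digit of `x`, i.e. `a_{k+1} = ⌊1/T₁^k(x)⌋`. -/
noncomputable def rcfDigit (x : ℝ) (k : ℕ) : ℤ := ⌊1 / (T 1)^[k] x⌋

/-- `P n α = min {k ≥ 0 : T₁^{n-k}(α) ≤ 1 - α or T₁^{n-k-1}(α) ≥ α}`. -/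
noncomputable def P (n : ℕ) (α : ℝ) : ℕ :=
  sInf {k : ℕ | (T 1)^[n - k] α ≤ 1 - α ∨ α ≤ (T 1)^[n - k - 1] α}

/-- The value `[0; b₁, b₂, …, b_m]` of a finite regular continued fraction. -/
noncomputable def cfVal (l : List ℕ) : ℝ := l.foldr (fun b r => 1 / (b + r)) 0

namespace TanakaIto

/-- The representative of `u` modulo `1` in `[β - 1, β)`. -/
noncomputable def rep (β u : ℝ) : ℝ := u - (⌊u + 1 - β⌋ : ℝ)

lemma T_eq_rep (β : ℝ) {x : ℝ} (hx : x ≠ 0) : T β x = rep β (1 / x) := by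
  simp [T, rep, hx]

lemma T_zero (β : ℝ) : T β 0 = 0 := by simp [T]

lemma T_one (x : ℝ) : T 1 x = Int.fract (1 / x) := by
  by_cases hx : x = 0
  · simp [hx, T_zero]
  · rw [T, if_neg hx, add_sub_cancel_right, Int.self_sub_floor]

lemma rep_eq_self {β u : ℝ} (h1 : β - 1 ≤ u) (h2 : u < β) : rep β u = u := by
  have : ⌊u + 1 - β⌋ = 0 := by
    rw [Int.floor_eq_zero_iff]
    constructor <;> linarith
  simp [rep, this]

lemma rep_congr (β : ℝ) {u v : ℝ} (k : ℤ) (h : u = v + k) : rep β u = rep β v := by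
  have : v + k + 1 - β = v + 1 - β + k := by ring
  simp only [rep, h, this, Int.floor_add_intCast]
  push_cast
  ring

lemma rep_mem (β u : ℝ) : β - 1 ≤ rep β u ∧ rep β u < β := by
  have h1 := Int.floor_le (u + 1 - β)
  have h2 := Int.lt_floor_add_one (u + 1 - β)
  unfold rep
  constructor <;> linarith

lemma rep_fract (β u : ℝ) : rep β (Int.fract u) = rep β u :=
  (rep_congr β ⌊u⌋ (Int.fract_add_floor u).symm).symm

lemma rep_neg_fract (β u : ℝ) : rep β (-Int.fract u) = rep β (-u) := by
  refine rep_congr β ⌊u⌋ ?_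
  have := Int.fract_add_floor u
  linarith

lemma T_one_eq {x : ℝ} (k : ℤ) (h1 : (k : ℝ) ≤ 1 / x) (h2 : 1 / x < k + 1) :
    T 1 x = 1 / x - k := by
  rw [T_one, Int.fract, Int.floor_eq_iff.2 ⟨h1, h2⟩]

lemma T_one_half : T 1 (1 / 2) = 0 := by
  rw [T_one]; norm_num

lemma T_one_of_half_lt {x : ℝ} (h1 : 1 / 2 < x) (h2 : x ≤ 1) : T 1 x = 1 / x - 1 := by
  have hx : 0 < x := by linarith
  have := T_one_eq (x := x) 1 (by rw [le_div_iff₀ hx]; simpa using h2)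
    (by rw [div_lt_iff₀ hx]; push_cast; linarith)
  simpa using this

lemma T_one_nonneg (x : ℝ) : 0 ≤ T 1 x := by rw [T_one]; exact Int.fract_nonneg _

lemma T_one_lt_one (x : ℝ) : T 1 x < 1 := by rw [T_one]; exact Int.fract_lt_one _

lemma iterate_zero_eq (β : ℝ) (k : ℕ) : (T β)^[k] 0 = 0 :=
  Function.iterate_fixed (T_zero β) k

lemma iterate_ne_zero_of_le {β x : ℝ} {j k : ℕ} (hjk : j ≤ k) (h : (T β)^[k] x ≠ 0) :
    (T β)^[j] x ≠ 0 := by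
  intro h0
  apply h
  obtain ⟨i, rfl⟩ := Nat.exists_eq_add_of_le' hjk
  rw [Function.iterate_add_apply, h0, iterate_zero_eq]

lemma g_sq : g ^ 2 + g = 1 := by
  have h : (Real.sqrt 5) ^ 2 = 5 := Real.sq_sqrt (by norm_num)
  unfold g; nlinarith

lemma half_lt_g : 1 / 2 < g := by
  have h : (2 : ℝ) < Real.sqrt 5 := by
    rw [Real.lt_sqrt (by norm_num)]; norm_num
  unfold g; linarith

lemma one_lt_sq_add {β : ℝ} (h : g < β) : 1 < β ^ 2 + β := by
  have := g_sq
  have := half_lt_g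
  nlinarith

section Step

variable {β t : ℝ}

lemma one_sub_lt_div (hg : g < β) : 1 - β < β / (β + 1) := by
  have h0 := half_lt_g
  have h1 := one_lt_sq_add hg
  rw [lt_div_iff₀ (by linarith)]
  nlinarith

lemma one_div_lt_self (hg : g < β) : 1 / (β + 1) < β := by
  have h0 := half_lt_g
  have h1 := one_lt_sq_add hg
  rw [div_lt_iff₀ (by linarith)]
  nlinarith

lemma div_lt_half (hg : g < β) (h1 : β < 1) : β / (β + 1) < 1 / 2 := by
  have h0 := half_lt_g
  rw [div_lt_iff₀ (by linarith)]
  linarith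

lemma half_lt_one_div (hg : g < β) (h1 : β < 1) : 1 / 2 < 1 / (β + 1) := by
  have h0 := half_lt_g
  rw [lt_div_iff₀ (by linarith)]
  linarith

lemma one_div_sub_one_lt (hg : g < β) : 1 / β - 1 < 1 / (β + 1) := by
  have h0 := half_lt_g
  have h1 := one_lt_sq_add hg
  have hb : 0 < β := by linarith
  rw [div_sub_one hb.ne', div_lt_div_iff₀ hb (by linarith)]
  nlinarith

lemma one_sub_div (hg : g < β) : 1 - β / (β + 1) = 1 / (β + 1) := by
  have h0 := half_lt_g
  have : β + 1 ≠ 0 := by linarith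
  field_simp
  ring

lemma step_low (hg : g < β) (h0 : 0 < t) (ht : t ≤ 1 - β) :
    T β (rep β t) = rep β (T 1 t) ∧ T β (rep β (-t)) = rep β (-T 1 t) := by
  have hh := half_lt_g
  rw [rep_eq_self (by linarith) (by linarith : t < β),
    rep_eq_self (by linarith) (by linarith : -t < β), T_eq_rep β h0.ne',
    T_eq_rep β (neg_ne_zero.2 h0.ne'), T_one, rep_fract, rep_neg_fract, one_div_neg_eq_neg_one_div]
  exact ⟨rfl, rfl⟩

lemma step_high (hg : g < β) (ht : β ≤ t) (h1 : t < 1) :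
    T β (rep β t) = rep β (-(T 1 (T 1 t))) ∧ T β (rep β (-t)) = rep β (T 1 (T 1 t)) := by
  have hh := half_lt_g
  have e1 : rep β t = t - 1 := by
    rw [rep_congr β (v := t - 1) 1 (by push_cast; ring), rep_eq_self] <;> linarith
  have e2 : rep β (-t) = 1 - t := by
    rw [rep_congr β (v := 1 - t) (-1) (by push_cast; ring), rep_eq_self] <;> linarith
  have h2 : 0 < 1 - t := by linarith
  have h3 : t ≠ 0 := by linarith
  have h4 : t - 1 ≠ 0 := by linarith
  rw [e1, e2, T_eq_rep β h2.ne', T_eq_rep β h4, T_one_of_half_lt (by linarith) h1.le, T_one,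
    rep_fract, rep_neg_fract]
  constructor
  · refine rep_congr β (-1) ?_
    rw [div_sub_one h3, one_div_div, ← neg_sub 1 t]
    push_cast
    field_simp
    ring
  · refine rep_congr β 1 ?_
    rw [div_sub_one h3, one_div_div]
    push_cast
    field_simp
    ring

lemma step_midL (hg : g < β) (h1 : β < 1) (ht : β / (β + 1) ≤ t) (ht2 : t < 1 / 2) :
    T β (T β (rep β t)) = rep β (T 1 (T 1 t)) ∧
      T β (T β (rep β (-t))) = rep β (-(T 1 (T 1 t))) := by
  have hh := half_lt_g
  have hq := one_lt_sq_add hg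
  have ha := one_sub_lt_div hg
  have hb : 0 < β := by linarith
  have h0 : 0 < t := lt_of_lt_of_le (by positivity) ht
  have hs : 0 < 1 - t := by linarith
  have e1 : rep β t = t := rep_eq_self (by linarith) (by linarith)
  have e2 : rep β (-t) = 1 - t := by
    rw [rep_congr β (v := 1 - t) (-1) (by push_cast; ring), rep_eq_self] <;> linarith
  have hk : β ≤ t * (β + 1) := by rwa [div_le_iff₀ (by linarith)] at ht
  have i1 : 2 < 1 / t := by rw [lt_div_iff₀ h0]; linarith
  have i2 : 1 / t - 2 < β := by
    rw [div_sub' h0.ne', div_lt_iff₀ h0]; nlinarith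
  have i3 : 1 / (1 - t) < 2 := by rw [div_lt_iff₀ hs]; linarith
  have i4 : β + 1 ≤ 1 / (1 - t) := by rw [le_div_iff₀ hs]; nlinarith
  have e3 : T 1 t = 1 / t - 2 := by
    have := T_one_eq (x := t) 2 (by push_cast; linarith) (by push_cast; linarith)
    simpa using this
  have e4 : T β t = 1 / t - 2 := by
    rw [T_eq_rep β h0.ne', rep_congr β (v := 1 / t - 2) 2 (by push_cast; ring), rep_eq_self] <;>
      linarith
  have e5 : T β (1 - t) = 1 / (1 - t) - 2 := by
    rw [T_eq_rep β hs.ne', rep_congr β (v := 1 / (1 - t) - 2) 2 (by push_cast; ring),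
      rep_eq_self] <;> linarith
  have h5 : 1 / t - 2 ≠ 0 := by linarith
  have h6 : 1 / (1 - t) - 2 ≠ 0 := by linarith
  rw [e1, e2, e4, e5, e3, T_eq_rep β h5, T_eq_rep β h6, T_one, rep_fract, rep_neg_fract]
  refine ⟨rfl, rep_congr β (-1) ?_⟩
  have h7 : 1 - 2 * t ≠ 0 := by linarith
  have h8 : 1 / t - 2 = (1 - 2 * t) / t := by field_simp
  have h9 : 1 / (1 - t) - 2 = -((1 - 2 * t) / (1 - t)) := by
    field_simp; ring
  rw [h8, h9, one_div_neg_eq_neg_one_div, one_div_div, one_div_div]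
  have h10 : (1 - t) / (1 - 2 * t) = t / (1 - 2 * t) + 1 := by
    rw [div_add_one h7]; congr 1; ring
  push_cast
  linarith

lemma T_one_T_one (h1 : 1 / 2 < t) (h2 : t < 1) : T 1 (T 1 t) = T 1 (1 - t) := by
  have h3 : t ≠ 0 := by linarith
  have h4 : 1 - t ≠ 0 := by linarith
  rw [T_one_of_half_lt h1 h2.le, T_one, T_one, Int.fract_eq_fract]
  refine ⟨-1, ?_⟩
  rw [div_sub_one h3, one_div_div]
  push_cast
  field_simp
  ring

lemma step_midR (hg : g < β) (h1 : β < 1) (ht : 1 / 2 < t) (ht2 : t ≤ 1 / (β + 1)) :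
    T β (T β (rep β t)) = rep β (-(T 1 (T 1 (T 1 t)))) ∧
      T β (T β (rep β (-t))) = rep β (T 1 (T 1 (T 1 t))) := by
  have hh := half_lt_g
  have h2 := one_sub_div hg
  have h3 := one_div_lt_self hg
  have key := step_midL (t := 1 - t) hg h1 (by linarith) (by linarith)
  rw [T_one_T_one ht (by linarith)]
  rw [rep_congr β (u := 1 - t) (v := -t) 1 (by push_cast; ring),
    rep_congr β (u := -(1 - t)) (v := t) (-1) (by push_cast; ring)] at key
  exact ⟨key.2, key.1⟩

lemma match_left (hg : g < β) (h1 : β < 1) (ht : 1 - β < t) (ht2 : t < β / (β + 1)) :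
    T β (T β (rep β (-t))) = T β (rep β t) := by
  have hh := half_lt_g
  have hb : 0 < β := by linarith
  have h3 := div_lt_half hg h1
  have h0 : 0 < t := by linarith
  have hs : 0 < 1 - t := by linarith
  have hk : t * (β + 1) < β := by rwa [lt_div_iff₀ (by linarith)] at ht2
  have e1 : rep β t = t := rep_eq_self (by linarith) (by linarith)
  have e2 : rep β (-t) = 1 - t := by
    rw [rep_congr β (v := 1 - t) (-1) (by push_cast; ring), rep_eq_self] <;> linarith
  have i1 : 0 < t / (1 - t) := by positivity
  have e5 : T β (1 - t) = t / (1 - t) := by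
    rw [T_eq_rep β hs.ne', rep_congr β (v := t / (1 - t)) 1 (by push_cast; field_simp; ring),
      rep_eq_self (by linarith)]
    rw [div_lt_iff₀ hs]; nlinarith
  rw [e1, e2, e5, T_eq_rep β i1.ne', T_eq_rep β h0.ne']
  refine rep_congr β (-1) ?_
  rw [one_div_div]
  push_cast
  field_simp
  ring

lemma match_right (hg : g < β) (h1 : β < 1) (ht : 1 / (β + 1) < t) (ht2 : t < β) :
    T β (T β (rep β t)) = T β (rep β (-t)) := by
  have h2 := one_sub_div hg
  have key := match_left (t := 1 - t) hg h1 (by linarith) (by linarith)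
  rwa [rep_congr β (u := 1 - t) (v := -t) 1 (by push_cast; ring),
    rep_congr β (u := -(1 - t)) (v := t) (-1) (by push_cast; ring)] at key

end Step

/-- The position of `t` relative to `1 - β`, `1 / 2` and `β`, away from the matching regions. -/
inductive Reg
  | low
  | midL
  | midR
  | high

namespace Reg

/-- The number of steps of the Gauss map attached to a region. -/
def jump : Reg → ℕ
  | low => 1
  | midL => 2
  | midR => 3
  | high => 2

/-- The number of steps of `T β` attached to a region. -/
def time : Reg → ℕ
  | low => 1
  | midL => 2
  | midR => 2
  | high => 1

/-- Whether the two orbits exchange their roles. -/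
def flip : Reg → ℕ
  | low => 0
  | midL => 0
  | midR => 1
  | high => 1

/-- Lower end of a region. -/
noncomputable def lo : Reg → ℝ → ℝ
  | low, _ => -1
  | midL, β => β / (β + 1)
  | midR, _ => 1 / 2
  | high, β => β

/-- Upper end of a region. -/
noncomputable def hi : Reg → ℝ → ℝ
  | low, β => 1 - β
  | midL, _ => 1 / 2
  | midR, β => 1 / (β + 1)
  | high, _ => 2

/-- Lower end of a region extended by the adjacent matching region. -/
noncomputable def wideLo : Reg → ℝ → ℝ
  | low, _ => -1
  | midL, β => 1 - β
  | midR, _ => 1 / 2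
  | high, β => 1 / (β + 1)

/-- Upper end of a region extended by the adjacent matching region. -/
noncomputable def wideHi : Reg → ℝ → ℝ
  | low, β => β / (β + 1)
  | midL, _ => 1 / 2
  | midR, β => β
  | high, _ => 2

lemma jump_pos (r : Reg) : 1 ≤ r.jump := by cases r <;> simp [jump]

lemma jump_eq (r : Reg) : r.jump = r.time + r.flip := by cases r <;> rfl

lemma time_pos (r : Reg) : 1 ≤ r.time := by cases r <;> simp [time]

end Reg

/-- `t` lies in the closed region `r`. -/
def Weak (β : ℝ) (r : Reg) (t : ℝ) : Prop := r.lo β ≤ t ∧ t ≤ r.hi β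

/-- `t` lies in the open region `r`. -/
def Strict (β : ℝ) (r : Reg) (t : ℝ) : Prop := r.lo β < t ∧ t < r.hi β

/-- `t` lies in the region `r` extended by the adjacent matching region. -/
def Wide (β : ℝ) (r : Reg) (t : ℝ) : Prop := r.wideLo β < t ∧ t < r.wideHi β

/-- `t` lies in the left matching region. -/
def MatchL (β t : ℝ) : Prop := 1 - β < t ∧ t < β / (β + 1)

/-- `t` lies in the right matching region. -/
def MatchR (β t : ℝ) : Prop := 1 / (β + 1) < t ∧ t < β

/-- The accelerated Gauss orbit of `t` visits the regions in the list. -/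
def Path (C : Reg → ℝ → Prop) : List Reg → ℝ → Prop
  | [], _ => True
  | r :: w, t => C r t ∧ Path C w ((T 1)^[r.jump] t)

/-- The total number of Gauss steps along a list of regions. -/
def jumps (w : List Reg) : ℕ := (w.map Reg.jump).sum

/-- The total number of steps of `T β` along a list of regions. -/
def times (w : List Reg) : ℕ := (w.map Reg.time).sum

/-- The number of exchanges along a list of regions. -/
def flips (w : List Reg) : ℕ := (w.map Reg.flip).sum

@[simp] lemma jumps_nil : jumps [] = 0 := rfl

@[simp] lemma flips_nil : flips [] = 0 := rfl

@[simp] lemma times_nil : times [] = 0 := rfl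

@[simp] lemma jumps_cons (r : Reg) (w : List Reg) : jumps (r :: w) = r.jump + jumps w := by
  simp [jumps]
@[simp] lemma times_cons (r : Reg) (w : List Reg) : times (r :: w) = r.time + times w := by
  simp [times]
@[simp] lemma flips_cons (r : Reg) (w : List Reg) : flips (r :: w) = r.flip + flips w := by
  simp [flips]

lemma times_append (v w : List Reg) : times (v ++ w) = times v + times w := by
  simp [times]

lemma jumps_eq (w : List Reg) : jumps w = times w + flips w := by
  induction w with
  | nil => rfl
  | cons r w ih => simp only [jumps_cons, times_cons, flips_cons, ih, r.jump_eq]; ring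

lemma one_le_times {w : List Reg} (h : w ≠ []) : 1 ≤ times w := by
  cases w with
  | nil => exact absurd rfl h
  | cons r w => rw [times_cons]; have := r.time_pos; omega

lemma iterate_jumps_cons (r : Reg) (w : List Reg) (t : ℝ) :
    (T 1)^[jumps (r :: w)] t = (T 1)^[jumps w] ((T 1)^[r.jump] t) := by
  rw [jumps_cons, add_comm, Function.iterate_add_apply]

lemma Path.append {C : Reg → ℝ → Prop} {v w : List Reg} {t : ℝ} :
    Path C (v ++ w) t ↔ Path C v t ∧ Path C w ((T 1)^[jumps v] t) := by
  induction v generalizing t with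
  | nil => simp [Path]
  | cons r v ih => rw [iterate_jumps_cons]; simp only [List.cons_append, Path, ih, and_assoc]

lemma Path.mono {C D : Reg → ℝ → Prop} (h : ∀ r t, C r t → D r t) {w : List Reg} {t : ℝ}
    (hp : Path C w t) : Path D w t := by
  induction w generalizing t with
  | nil => trivial
  | cons r w ih => exact ⟨h _ _ hp.1, ih hp.2⟩

lemma Strict.weak {β : ℝ} {r : Reg} {t : ℝ} (h : Strict β r t) : Weak β r t :=
  ⟨h.1.le, h.2.le⟩

lemma iterate_mem {k : ℕ} (hk : 1 ≤ k) (s : ℝ) : 0 ≤ (T 1)^[k] s ∧ (T 1)^[k] s < 1 := by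
  obtain ⟨i, rfl⟩ := Nat.exists_eq_add_of_le' hk
  rw [Function.iterate_succ_apply']
  exact ⟨T_one_nonneg _, T_one_lt_one _⟩

section Regions

variable {β t : ℝ}

lemma iterate_half {r : Reg} (hg : g < β) (h : Weak β r (1 / 2)) :
    (T 1)^[r.jump] (1 / 2) = 0 := by
  have hh := half_lt_g
  cases r
  · simp only [Weak, Reg.lo, Reg.hi] at h; linarith
  · simp [Reg.jump, Function.iterate_succ_apply, T_one_half, T_zero, - one_div]
  · simp [Reg.jump, Function.iterate_succ_apply, T_one_half, T_zero, - one_div]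
  · simp only [Weak, Reg.lo, Reg.hi] at h; linarith

lemma Weak.unique {r r' : Reg} (hg : g < β) (h1 : β < 1) (h : Weak β r t) (h' : Weak β r' t)
    (ht : t ≠ 1 / 2) : r = r' := by
  have hh := half_lt_g
  have a1 := one_sub_lt_div hg
  have a2 := one_div_lt_self hg
  have a3 := div_lt_half hg h1
  have a4 := half_lt_one_div hg h1
  cases r <;> cases r' <;> simp only [Weak, Reg.lo, Reg.hi] at h h' <;>
    first
    | rfl
    | (exfalso; linarith)
    | (exfalso; apply ht; linarith)

lemma not_weak_of_matchL {r : Reg} (hg : g < β) (h1 : β < 1) (h : MatchL β t) : ¬ Weak β r t := by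
  have hh := half_lt_g
  have a3 := div_lt_half hg h1
  rintro h'
  obtain ⟨h2, h3⟩ := h
  cases r <;> simp only [Weak, Reg.lo, Reg.hi] at h' <;> linarith

lemma not_weak_of_matchR {r : Reg} (hg : g < β) (h1 : β < 1) (h : MatchR β t) : ¬ Weak β r t := by
  have hh := half_lt_g
  have a3 := half_lt_one_div hg h1
  rintro h'
  obtain ⟨h2, h3⟩ := h
  cases r <;> simp only [Weak, Reg.lo, Reg.hi] at h' <;> linarith

lemma exists_weak (h0 : 0 ≤ t) (ht : t < 1)
    (hL : ¬ MatchL β t) (hR : ¬ MatchR β t) : ∃ r, Weak β r t := by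
  simp only [MatchL, MatchR, not_and_or, not_lt] at hL hR
  by_cases c1 : t ≤ 1 - β
  · exact ⟨.low, by simp only [Reg.lo]; linarith, c1⟩
  by_cases c2 : β ≤ t
  · exact ⟨.high, c2, by simp only [Reg.hi]; linarith⟩
  rcases le_total t (1 / 2) with c3 | c3
  · exact ⟨.midL, hL.resolve_left c1, c3⟩
  · exact ⟨.midR, c3, hR.resolve_right c2⟩

lemma Weak.wide {r : Reg} (hg : g < β) (h1 : β < 1) (h : Weak β r t) (h0 : 0 ≤ t) (h1' : t < 1)
    (ht : t ≠ 1 / 2) : Wide β r t := by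
  have hh := half_lt_g
  have a1 := one_sub_lt_div hg
  have a2 := one_div_lt_self hg
  obtain ⟨h2, h3⟩ := h
  cases r <;> simp only [Reg.lo, Reg.hi] at h2 h3 <;>
    refine ⟨?_, ?_⟩ <;> simp only [Reg.wideLo, Reg.wideHi] <;>
    first
    | linarith
    | exact lt_of_le_of_ne h3 ht
    | exact lt_of_le_of_ne h2 (Ne.symm ht)

lemma Wide.weak_or_match {r : Reg} (h : Wide β r t) : Weak β r t ∨ MatchL β t ∨ MatchR β t := by
  obtain ⟨h1, h2⟩ := h
  simp only [Weak, MatchL, MatchR]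
  cases r <;> simp only [Reg.wideLo, Reg.wideHi, Reg.lo, Reg.hi] at h1 h2 ⊢
  · rcases le_or_gt t (1 - β) with h | h
    · exact .inl ⟨h1.le, h⟩
    · exact .inr (.inl ⟨h, h2⟩)
  · rcases le_or_gt (β / (β + 1)) t with h | h
    · exact .inl ⟨h, h2.le⟩
    · exact .inr (.inl ⟨h1, h⟩)
  · rcases le_or_gt t (1 / (β + 1)) with h | h
    · exact .inl ⟨h1.le, h⟩
    · exact .inr (.inr ⟨h, h2⟩)
  · rcases le_or_gt β t with h | h
    · exact .inl ⟨h, h2.le⟩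
    · exact .inr (.inr ⟨h1, h⟩)

lemma exists_match_of_wide {w : List Reg} (h : Path (Wide β) w t) :
    Path (Weak β) w t ∨ ∃ u v, w = u ++ v ∧ v ≠ [] ∧ Path (Weak β) u t ∧
      (MatchL β ((T 1)^[jumps u] t) ∨ MatchR β ((T 1)^[jumps u] t)) := by
  induction w generalizing t with
  | nil => exact .inl trivial
  | cons r w ih =>
    rcases h.1.weak_or_match with hr | hr
    · rcases ih h.2 with h' | ⟨u, v, rfl, hv, hu, hm⟩
      · exact .inl ⟨hr, h'⟩
      · refine .inr ⟨r :: u, v, rfl, hv, ⟨hr, hu⟩, ?_⟩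
        rwa [iterate_jumps_cons]
    · exact .inr ⟨[], r :: w, rfl, by simp, trivial, hr⟩

lemma Path.wide {w : List Reg} (hg : g < β) (h1 : β < 1) (h : Path (Weak β) w t)
    (ht0 : 0 ≤ t) (ht1 : t < 1) (h0 : (T 1)^[jumps w] t ≠ 0) : Path (Wide β) w t := by
  induction w generalizing t with
  | nil => trivial
  | cons r w ih =>
    rw [iterate_jumps_cons] at h0
    have hj := iterate_mem r.jump_pos t
    refine ⟨h.1.wide hg h1 ht0 ht1 ?_, ih h.2 hj.1 hj.2 h0⟩
    rintro rfl
    rw [iterate_half hg h.1, iterate_zero_eq] at h0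
    exact h0 rfl

/-- A point on the boundary of its region is followed by the second Gauss iterate of `β`. -/
lemma Weak.renewal {r : Reg} (hg : g < β) (h1 : β < 1) (h : Weak β r t) (h' : ¬ Strict β r t)
    (h0 : 0 ≤ t) (ht : t < 1) (hne : t ≠ 1 / 2) : (T 1)^[r.jump] t = (T 1)^[2] β := by
  have hh := half_lt_g
  have hb : 0 < β := by linarith
  have hb1 : T 1 β = 1 / β - 1 := T_one_of_half_lt (by linarith) h1.le
  have hb2 : (T 1)^[2] β = Int.fract (β / (1 - β)) := by
    rw [Function.iterate_succ_apply, Function.iterate_one, hb1, T_one, div_sub_one hb.ne',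
      one_div_div]
  simp only [Weak, Strict, not_and_or, not_lt] at h h'
  cases r <;> simp only [Reg.lo, Reg.hi, Reg.jump] at h h' ⊢
  · have e : t = 1 - β := by rcases h' with h' | h' <;> linarith
    have : 1 - β ≠ 0 := by linarith
    rw [hb2, Function.iterate_one, e, T_one, Int.fract_eq_fract]
    refine ⟨1, ?_⟩
    push_cast
    field_simp
  · have e : t = β / (β + 1) := by
      rcases h' with h' | h'
      · linarith
      · exact absurd (le_antisymm h.2 h') hne
    rw [Function.iterate_succ_apply, Function.iterate_succ_apply (n := 1), e, T_one (β / (β + 1)),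
      T_one β]
    congr 1
    rw [Int.fract_eq_fract]
    refine ⟨1, ?_⟩
    push_cast
    field_simp
    ring
  · have e : t = 1 / (β + 1) := by
      rcases h' with h' | h'
      · exact absurd (le_antisymm h.1 h').symm hne
      · linarith
    have : T 1 (1 / (β + 1)) = β := by
      rw [T_one_of_half_lt (half_lt_one_div hg h1) (by rw [div_le_iff₀] <;> linarith)]
      simp
    rw [Function.iterate_succ_apply, e, this]
  · have e : t = β := by rcases h' with h' | h' <;> linarith
    rw [e]

lemma exists_weak_end {v w : List Reg} (hg : g < β) (h1 : β < 1) (hv : Path (Weak β) v t)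
    (hw : Path (Weak β) w t) (hl : v.length < w.length) :
    ∃ r, Weak β r ((T 1)^[jumps v] t) := by
  have hh := half_lt_g
  induction v generalizing w t with
  | nil =>
    cases w with
    | nil => simp at hl
    | cons r w => exact ⟨r, hw.1⟩
  | cons r v ih =>
    cases w with
    | nil => simp at hl
    | cons r' w =>
      rw [iterate_jumps_cons]
      by_cases ht : t = 1 / 2
      · subst ht
        rw [iterate_half hg hv.1, iterate_zero_eq]
        exact ⟨.low, by simp only [Reg.lo]; linarith, by simp only [Reg.hi]; linarith⟩
      · obtain rfl := hv.1.unique hg h1 hw.1 ht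
        exact ih hv.2 hw.2 (by simpa using hl)

lemma not_match_zero (h1 : β < 1) (h0 : 0 < β) : ¬ (MatchL β 0 ∨ MatchR β 0) := by
  rintro (h | h)
  · have := h.1; linarith
  · have := h.1
    have : 0 < 1 / (β + 1) := by positivity
    linarith

lemma Path.strict {v w : List Reg} (hg : g < β) (h1 : β < 1) (hv : Path (Weak β) v t)
    (hl : v.length ≤ w.length) (hw : Path (Weak β) w ((T 1)^[2] β)) (h0 : 0 ≤ t) (ht : t < 1)
    (hm : MatchL β ((T 1)^[jumps v] t) ∨ MatchR β ((T 1)^[jumps v] t)) :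
    Path (Strict β) v t := by
  have hh := half_lt_g
  induction v generalizing t with
  | nil => trivial
  | cons r v ih =>
    rw [iterate_jumps_cons] at hm
    have hne : t ≠ 1 / 2 := by
      rintro rfl
      rw [iterate_half hg hv.1, iterate_zero_eq] at hm
      exact not_match_zero h1 (by linarith) hm
    have hj := iterate_mem r.jump_pos t
    refine ⟨?_, ih hv.2 (by simp at hl; omega) hj.1 hj.2 hm⟩
    by_contra hs
    have hr := hv.1.renewal hg h1 hs h0 ht hne
    have hv2 := hv.2
    rw [hr] at hm hv2
    obtain ⟨r', hr'⟩ := exists_weak_end hg h1 hv2 hw (by simp at hl; omega)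
    rcases hm with hm | hm
    · exact not_weak_of_matchL hg h1 hm hr'
    · exact not_weak_of_matchR hg h1 hm hr'

end Regions

section Tracking

variable {β t : ℝ}

lemma step_rep {r : Reg} (hg : g < β) (h1 : β < 1) (h : Weak β r t) (h0 : 0 < t) (ht : t < 1)
    (hne : t ≠ 1 / 2) :
    (T β)^[r.time] (rep β t) = rep β ((-1) ^ r.flip * (T 1)^[r.jump] t) ∧
      (T β)^[r.time] (rep β (-t)) = rep β (-((-1) ^ r.flip * (T 1)^[r.jump] t)) := by
  obtain ⟨h2, h3⟩ := h
  cases r <;> simp only [Reg.lo, Reg.hi] at h2 h3 <;>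
    simp only [Reg.time, Reg.flip, Reg.jump, Function.iterate_succ_apply, Function.iterate_zero,
      id, pow_zero, one_mul, pow_one, neg_one_mul, neg_neg]
  · exact step_low hg h0 h3
  · exact step_midL hg h1 h2 (lt_of_le_of_ne h3 hne)
  · exact step_midR hg h1 (lt_of_le_of_ne h2 (Ne.symm hne)) h3
  · exact step_high hg h2 ht

lemma path_rep {w : List Reg} (hg : g < β) (h1 : β < 1) (h : Path (Weak β) w t) (h0 : 0 ≤ t)
    (ht : t < 1) (hne : (T 1)^[jumps w] t ≠ 0) {ε : ℝ} (hε : ε = 1 ∨ ε = -1) :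
    (T β)^[times w] (rep β (ε * t)) = rep β (ε * (-1) ^ flips w * (T 1)^[jumps w] t) := by
  induction w generalizing t ε with
  | nil => simp
  | cons r w ih =>
    have hne' := hne
    rw [iterate_jumps_cons] at hne'
    have hj := iterate_mem r.jump_pos t
    have hhalf : t ≠ 1 / 2 := by
      rintro rfl
      rw [iterate_half hg h.1, iterate_zero_eq] at hne'
      exact hne' rfl
    have hpos : 0 < t := by
      refine lt_of_le_of_ne h0 ?_
      rintro rfl
      rw [iterate_zero_eq] at hne
      exact hne rfl
    have hs := step_rep hg h1 h.1 hpos ht hhalf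
    have hε' : ε * (-1) ^ r.flip = 1 ∨ ε * (-1) ^ r.flip = -1 := by
      rcases neg_one_pow_eq_or ℝ r.flip with e | e <;> rcases hε with rfl | rfl <;> simp [e]
    have hh : (T β)^[r.time] (rep β (ε * t)) =
        rep β (ε * (-1) ^ r.flip * (T 1)^[r.jump] t) := by
      rcases hε with rfl | rfl
      · simpa using hs.1
      · simpa using hs.2
    rw [times_cons, add_comm, Function.iterate_add_apply, hh, ih h.2 hj.1 hj.2 hne' hε',
      iterate_jumps_cons, flips_cons, pow_add]
    congr 1
    ring

/-- The two orbits of the endpoints along a path, up to sign and integer translation. -/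
lemma orbit_path {w : List Reg} (hg : g < β) (h1 : β < 1)
    (h : Path (Weak β) w ((T 1)^[2] β)) (hne : (T 1)^[2 + jumps w] β ≠ 0) :
    (T β)^[times w + 2] β = rep β ((-1) ^ flips w * (T 1)^[2 + jumps w] β) ∧
      (T β)^[times w + 1] (β - 1) = rep β (-((-1) ^ flips w * (T 1)^[2 + jumps w] β)) := by
  have hh := half_lt_g
  have hq := one_lt_sq_add hg
  have hb : 0 < β := by linarith
  have hb1 : T 1 β = 1 / β - 1 := T_one_of_half_lt (by linarith) h1.le
  have hpos : 0 < 1 / β - 1 := by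
    rw [div_sub_one hb.ne']; exact div_pos (by linarith) hb
  have hβ1 : T β β = 1 / β - 1 := by
    rw [T_eq_rep β hb.ne', rep_congr β (v := 1 / β - 1) 1 (by push_cast; ring),
      rep_eq_self (by linarith)]
    rw [div_sub_one hb.ne', div_lt_iff₀ hb]; nlinarith
  have e0 : (T 1)^[2] β = Int.fract (1 / (1 / β - 1)) := by
    rw [Function.iterate_succ_apply, Function.iterate_one, hb1, T_one]
  have e1 : (T β)^[2] β = rep β ((T 1)^[2] β) := by
    rw [e0, rep_fract, Function.iterate_succ_apply, Function.iterate_one, hβ1,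
      T_eq_rep β hpos.ne']
  have e2 : (T β)^[1] (β - 1) = rep β (-((T 1)^[2] β)) := by
    have hne1 : β - 1 ≠ 0 := by linarith
    rw [e0, rep_neg_fract, Function.iterate_one, T_eq_rep β hne1]
    refine rep_congr β (-1) ?_
    rw [div_sub_one hb.ne', one_div_div, ← neg_sub 1 β]
    push_cast
    have : 1 - β ≠ 0 := by linarith
    field_simp
    ring
  have hm := iterate_mem (k := 2) (by norm_num) β
  rw [add_comm 2, Function.iterate_add_apply] at hne
  rw [add_comm 2, Function.iterate_add_apply, Function.iterate_add_apply,
    Function.iterate_add_apply, e1, e2]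
  constructor
  · have := path_rep hg h1 h hm.1 hm.2 hne (ε := 1) (.inl rfl)
    simpa using this
  · have := path_rep hg h1 h hm.1 hm.2 hne (ε := -1) (.inr rfl)
    rw [neg_one_mul] at this
    rw [this]
    congr 1
    ring

/-- Matching after a path ending in a matching region; `ε` records which orbit is ahead. -/
lemma matching_of_path {w : List Reg} (hg : g < β) (h1 : β < 1)
    (h : Path (Weak β) w ((T 1)^[2] β))
    (hm : MatchL β ((T 1)^[2 + jumps w] β) ∨ MatchR β ((T 1)^[2 + jumps w] β)) :
    (0 < (-1) ^ flips w * ((T 1)^[2 + jumps w] β - 1 / 2) →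
      (T β)^[times w + 2] (β - 1) = (T β)^[times w + 4] β) ∧
    ((-1) ^ flips w * ((T 1)^[2 + jumps w] β - 1 / 2) < 0 →
      (T β)^[times w + 3] (β - 1) = (T β)^[times w + 3] β) := by
  have hh := half_lt_g
  have hne : (T 1)^[2 + jumps w] β ≠ 0 := by
    intro h0
    rw [h0] at hm
    exact not_match_zero h1 (by linarith) hm
  obtain ⟨o1, o2⟩ := orbit_path hg h1 h hne
  have a1 := div_lt_half hg h1
  have a2 := half_lt_one_div hg h1
  rw [Function.iterate_succ_apply' (T β) (times w + 1),
    Function.iterate_succ_apply' (T β) (times w + 3),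
    Function.iterate_succ_apply' (T β) (times w + 2) (β - 1),
    Function.iterate_succ_apply' (T β) (times w + 1),
    Function.iterate_succ_apply' (T β) (times w + 2),
    o1, o2]
  generalize (T 1)^[2 + jumps w] β = t at hm ⊢
  rcases neg_one_pow_eq_or ℝ (flips w) with e | e <;> rw [e] <;>
    simp only [one_mul, neg_one_mul, neg_neg] <;> rcases hm with hm | hm
  · exact ⟨fun h => by linarith [hm.2], fun _ => match_left hg h1 hm.1 hm.2⟩
  · exact ⟨fun _ => (match_right hg h1 hm.1 hm.2).symm, fun h => by linarith [hm.1]⟩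
  · exact ⟨fun _ => (match_left hg h1 hm.1 hm.2).symm, fun h => by linarith [hm.2]⟩
  · exact ⟨fun h => by linarith [hm.1], fun _ => (match_right hg h1 hm.1 hm.2)⟩

end Tracking

section Visited

variable {α : ℝ}

/-- The Gauss times whose iterate determines the pair of orbits of `α` and `α - 1`. -/
def Visited (α : ℝ) : ℕ → Prop
  | 0 => False
  | k + 1 => (T 1)^[k] α ≤ 1 - α ∨ ((T 1)^[k] α < α ∧ ¬ Visited α k)

lemma P_eq_zero {k : ℕ} (h : (T 1)^[k + 1] α ≤ 1 - α ∨ α ≤ (T 1)^[k] α) : P (k + 1) α = 0 := by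
  unfold P
  rw [Nat.sInf_eq_zero]
  exact .inl h

lemma P_succ {k : ℕ} (h : ¬ ((T 1)^[k + 1] α ≤ 1 - α ∨ α ≤ (T 1)^[k] α)) :
    P (k + 1) α = P k α + 1 := by
  unfold P
  have hne : {i : ℕ | (T 1)^[k + 1 - i] α ≤ 1 - α ∨ α ≤ (T 1)^[k + 1 - i - 1] α}.Nonempty := by
    refine ⟨k, .inr ?_⟩
    have : k + 1 - k - 1 = 0 := by omega
    rw [this, Function.iterate_zero, id]
  have hp : 0 < sInf {i : ℕ | (T 1)^[k + 1 - i] α ≤ 1 - α ∨ α ≤ (T 1)^[k + 1 - i - 1] α} := by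
    rw [Nat.pos_iff_ne_zero]
    intro h0
    rw [Nat.sInf_eq_zero] at h0
    rcases h0 with h0 | h0
    · exact h h0
    · exact hne.ne_empty h0
  rw [← Nat.sInf_add hp]
  simp only [Nat.add_sub_add_right]

lemma visited_iff_odd_P (hg : g < α) {k : ℕ} (hk : 1 ≤ k) (h1 : 1 - α < (T 1)^[k] α)
    (h2 : (T 1)^[k] α < α) : Visited α k ↔ Odd (P k α) := by
  have hh := half_lt_g
  induction k, hk using Nat.le_induction with
  | base =>
    rw [P_eq_zero (k := 0) (.inr le_rfl)]
    simp [Visited]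
    linarith
  | succ k hk ih =>
    by_cases c1 : α ≤ (T 1)^[k] α
    · rw [P_eq_zero (.inr c1)]
      simp only [Visited, Nat.not_odd_zero, iff_false, not_or, not_le, not_and]
      exact ⟨by linarith, fun h => by linarith⟩
    · rw [P_succ (by push Not; exact ⟨h1, not_le.1 c1⟩)]
      by_cases c2 : (T 1)^[k] α ≤ 1 - α
      · have : P k α = 0 := by
          obtain ⟨k, rfl⟩ := Nat.exists_eq_add_of_le' hk
          exact P_eq_zero (.inl c2)
        simp [Visited, c2, this]
      · have := ih (not_le.1 c2) (not_le.1 c1)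
        simp only [Visited, c2, not_le.1 c1, false_or, true_and, this]
        rw [Nat.odd_add_one]

lemma T_one_midL (hg : g < α) (h : α / (α + 1) ≤ t) (h2 : t < 1 / 2) :
    T 1 t ≤ 1 / α - 1 := by
  have hh := half_lt_g
  have ha : 0 < α := by linarith
  have hq := one_lt_sq_add hg
  have ht : 0 < t := lt_of_lt_of_le (by positivity) h
  have hk : α ≤ t * (α + 1) := by rwa [div_le_iff₀ (by linarith)] at h
  have i1 : 2 < 1 / t := by rw [lt_div_iff₀ ht]; linarith
  have i2 : 1 / t ≤ 1 / α + 1 := by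
    rw [div_add_one ha.ne', div_le_div_iff₀ ht ha]; nlinarith
  have i3 : 1 / α < 2 := by rw [div_lt_iff₀ ha]; linarith
  have := T_one_eq (x := t) 2 (by push_cast; linarith) (by push_cast; linarith)
  rw [this]; push_cast; linarith

lemma T_one_high (hg : g < α) (h : α ≤ t) (h2 : t ≤ 1) : T 1 t ≤ 1 / α - 1 := by
  have hh := half_lt_g
  have ha : 0 < α := by linarith
  rw [T_one_of_half_lt (by linarith) h2]
  have := one_div_le_one_div_of_le ha h
  linarith

lemma T_one_midR (hg : g < α) (h : 1 / 2 < t) (h2 : t ≤ 1 / (α + 1)) : α ≤ T 1 t := by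
  have hh := half_lt_g
  have ha : 0 < α + 1 := by linarith
  have h3 : 1 / (α + 1) ≤ 1 := by rw [div_le_iff₀ ha]; linarith
  have ht : 0 < t := by linarith
  rw [T_one_of_half_lt h (by linarith)]
  have : α + 1 ≤ 1 / t := by
    rw [le_div_iff₀ ha] at h2
    rw [le_div_iff₀ ht]; linarith
  linarith

/-- A time reached after a large iterate is neither visited nor matching. -/
lemma not_visited_succ {k : ℕ} (hg : g < α) (hv : (T 1)^[k] α ≥ α ∨
    ((1 - α < (T 1)^[k] α) ∧ Visited α k)) : ¬ Visited α (k + 1) := by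
  have hh := half_lt_g
  simp only [Visited]
  rintro (h | h) <;> rcases hv with hv | hv
  · linarith
  · linarith [hv.1]
  · linarith [h.1]
  · exact h.2 hv.2

lemma exists_path_aux (hg : g < α) {n : ℕ} (hn0 : (T 1)^[n] α ≠ 0)
    (hm : ∀ k, 2 ≤ k → k < n → Visited α k →
      ¬ MatchL α ((T 1)^[k] α) ∧ ¬ MatchR α ((T 1)^[k] α))
    (hn : Visited α n) (hnα : (T 1)^[n] α < α) (d : ℕ) :
    ∀ k, 2 ≤ k → k + d = n → Visited α k →
      ∃ w, Path (Weak α) w ((T 1)^[k] α) ∧ k + jumps w = n := by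
  have hh := half_lt_g
  have ha2 := one_div_lt_self hg
  have hsub := one_div_sub_one_lt hg
  induction d using Nat.strong_induction_on with
  | _ d ih =>
    intro k hk hkd hv
    rcases Nat.eq_zero_or_pos d with rfl | hd
    · exact ⟨[], trivial, by simpa using hkd⟩
    have hkn : k < n := by omega
    have hb := iterate_mem (by omega : 1 ≤ k) α
    obtain ⟨hL, hR⟩ := hm k hk hkn hv
    obtain ⟨r, hr⟩ := exists_weak hb.1 hb.2 hL hR
    have hne : (T 1)^[k] α ≠ 1 / 2 := by
      intro h
      have h3 := iterate_ne_zero_of_le (by omega : k + 1 ≤ n) hn0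
      rw [Function.iterate_succ_apply', h] at h3
      exact h3 T_one_half
    have small : ∀ j, (T 1)^[j] α ≤ 1 / α - 1 → ¬ Visited α j → Visited α (j + 1) := by
      intro j hj hvj
      simp only [Visited]
      exact .inr ⟨by linarith, hvj⟩
    have finish : ∀ r : Reg, Weak α r ((T 1)^[k] α) → k + r.jump ≤ n → Visited α (k + r.jump) →
        ∃ w, Path (Weak α) w ((T 1)^[k] α) ∧ k + jumps w = n := by
      intro r hr hle hv'
      have := r.jump_pos
      obtain ⟨w, hw, hw2⟩ := ih (d - r.jump) (by omega) (k + r.jump) (by omega) (by omega) hv'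
      refine ⟨r :: w, ⟨hr, ?_⟩, by rw [jumps_cons]; omega⟩
      rwa [← Function.iterate_add_apply, add_comm]
    have ne_n : ∀ j, ¬ Visited α j → j ≠ n := by rintro j hj rfl; exact hj hn
    have hr' := hr
    obtain ⟨h2, h3⟩ := hr
    cases r <;> simp only [Reg.lo, Reg.hi] at h2 h3 <;> refine finish _ hr' ?_ ?_ <;>
      simp only [Reg.jump]
    · omega
    · simp only [Visited]; exact .inl h3
    · have := ne_n _ (not_visited_succ hg (.inr ⟨by linarith [one_sub_lt_div hg], hv⟩)); omega
    · refine small (k + 1) ?_ (not_visited_succ hg (.inr ⟨by linarith [one_sub_lt_div hg], hv⟩))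
      rw [Function.iterate_succ_apply']
      exact T_one_midL hg h2 (lt_of_le_of_ne h3 hne)
    all_goals try
      have q1 := not_visited_succ (k := k) hg (.inr ⟨by linarith, hv⟩)
      have q2 := T_one_midR hg (lt_of_le_of_ne h2 (Ne.symm hne)) h3
      rw [← Function.iterate_succ_apply' (T 1)] at q2
      have q3 := not_visited_succ (k := k + 1) hg (.inl q2)
    · have := ne_n _ q1
      have := ne_n _ q3
      omega
    · refine small (k + 2) ?_ q3
      rw [Function.iterate_succ_apply']
      exact T_one_high hg q2 (iterate_mem (by omega) α).2.le
    · have := ne_n _ (not_visited_succ hg (.inl h2)); omega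
    · refine small (k + 1) ?_ (not_visited_succ hg (.inl h2))
      rw [Function.iterate_succ_apply']
      exact T_one_high hg h2 hb.2.le

lemma visited_two (hg : g < α) (h1 : α < 1) : Visited α 2 := by
  have hh := half_lt_g
  have h := T_one_high hg le_rfl h1.le
  have := one_div_sub_one_lt hg
  have := one_div_lt_self hg
  refine .inr ⟨?_, not_visited_succ (k := 0) hg (.inl le_rfl)⟩
  rw [Function.iterate_one]
  linarith

/-- The minimal time in the hypothesis is the first matching time along the visited times. -/
lemma exists_path (hg : g < α) (h1 : α < 1) {n : ℕ} (hn2 : 2 ≤ n)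
    (hQ : (MatchL α ((T 1)^[n] α) ∧ Odd (P n α)) ∨ MatchR α ((T 1)^[n] α))
    (hmin : ∀ m, 2 ≤ m → m < n →
      ¬ ((MatchL α ((T 1)^[m] α) ∧ Odd (P m α)) ∨ MatchR α ((T 1)^[m] α))) :
    ∃ w, Path (Weak α) w ((T 1)^[2] α) ∧ 2 + jumps w = n := by
  have hh := half_lt_g
  have a1 := div_lt_half hg h1
  have a2 := one_div_sub_one_lt hg
  have a3 := half_lt_one_div hg h1
  have hn0 : (T 1)^[n] α ≠ 0 := by
    intro h
    rw [h] at hQ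
    exact not_match_zero h1 (by linarith) (hQ.imp And.left id)
  have hlt : (T 1)^[n] α < α := by
    rcases hQ with h | h
    · linarith [h.1.2]
    · exact h.2
  refine exists_path_aux hg hn0 ?_ ?_ hlt (n - 2) 2 le_rfl (by omega) (visited_two hg h1)
  · intro k hk hkn hv
    have := hmin k hk hkn
    push Not at this
    refine ⟨fun h => ?_, this.2⟩
    exact this.1 h ((visited_iff_odd_P hg (by omega) h.1 (by linarith [h.2])).1 hv)
  · rcases hQ with h | h
    · exact (visited_iff_odd_P hg (by omega) h.1.1 hlt).2 h.2
    · obtain ⟨j, rfl⟩ := Nat.exists_eq_add_of_le' (by omega : 1 ≤ n)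
      by_contra hv
      simp only [Visited, not_or, not_le, not_and, not_not] at hv
      rw [Function.iterate_succ_apply'] at h
      have hb := iterate_mem (by omega : 1 ≤ j) α
      rcases le_or_gt α ((T 1)^[j] α) with c | c
      · linarith [h.1, T_one_high hg c hb.2.le]
      have hvj := hv.2 c
      have hj2 : 2 ≤ j := by
        by_contra hj
        obtain rfl : j = 1 := by omega
        exact not_visited_succ (k := 0) hg (.inl le_rfl) hvj
      have hmj := hmin j hj2 (by omega)
      push Not at hmj
      have hL : ¬ MatchL α ((T 1)^[j] α) := fun hL =>
        hmj.1 hL ((visited_iff_odd_P hg (by omega) hL.1 c).1 hvj)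
      have hR := hmj.2
      simp only [MatchL, MatchR, not_and_or, not_lt] at hL hR
      rcases lt_trichotomy ((T 1)^[j] α) (1 / 2) with c2 | c2 | c2
      · have := T_one_midL hg (hL.resolve_left (not_le.2 hv.1)) c2
        linarith [h.1]
      · rw [c2, T_one_half] at h
        linarith [h.1]
      · have := T_one_midR hg c2 (hR.resolve_right (not_le.2 c))
        linarith [h.2]

/-- The flips along a path are the Gauss iterates that are at least `α`. -/
lemma card_filter_path (hg : g < α) {w : List Reg} {m : ℕ} (hm : 1 ≤ m)
    (h : Path (Weak α) w ((T 1)^[m] α)) (hne : (T 1)^[m + jumps w] α ≠ 0) :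
    ((Finset.Ico m (m + jumps w)).filter fun k => α ≤ (T 1)^[k] α).card = flips w := by
  have hh := half_lt_g
  have a2 := one_div_sub_one_lt hg
  have a3 := one_div_lt_self hg
  induction w generalizing m with
  | nil => simp
  | cons r w ih =>
    have hr := r.jump_pos
    have hw := h.2
    rw [← Function.iterate_add_apply, add_comm] at hw
    rw [jumps_cons, ← add_assoc] at hne
    have hb := iterate_mem hm α
    have hhalf : (T 1)^[m] α ≠ 1 / 2 := by
      intro h
      have h3 := iterate_ne_zero_of_le (by omega : m + 1 ≤ m + r.jump + jumps w) hne
      rw [Function.iterate_succ_apply', h] at h3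
      exact h3 T_one_half
    have key := ih (by omega) hw hne
    rw [jumps_cons, flips_cons, ← key, ← add_assoc]
    simp only [Finset.card_filter]
    rw [← Finset.sum_Ico_consecutive _ (by omega : m ≤ m + r.jump) (by omega)]
    congr 1
    obtain ⟨h2, h3⟩ := h.1
    have s1 : (T 1)^[m + 1] α = T 1 ((T 1)^[m] α) := Function.iterate_succ_apply' _ _ _
    have s2 : (T 1)^[m + 2] α = T 1 ((T 1)^[m + 1] α) := Function.iterate_succ_apply' _ _ _
    have hb2 := iterate_mem (by omega : 1 ≤ m + 1) α
    cases r <;> simp only [Reg.lo, Reg.hi] at h2 h3 <;>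
      simp only [Reg.jump, Reg.flip]
    · have c1 : ¬ α ≤ (T 1)^[m] α := by linarith
      rw [Finset.sum_Ico_succ_top le_rfl, Finset.Ico_self, Finset.sum_empty, if_neg c1]
    · have c1 : ¬ α ≤ (T 1)^[m] α := by linarith
      have c2 : ¬ α ≤ (T 1)^[m + 1] α := by
        have := T_one_midL hg h2 (lt_of_le_of_ne h3 hhalf)
        linarith
      rw [Finset.sum_Ico_succ_top (by omega : m ≤ m + 1), Finset.sum_Ico_succ_top le_rfl,
        Finset.Ico_self, Finset.sum_empty, if_neg c1, if_neg c2]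
    · have c1 : ¬ α ≤ (T 1)^[m] α := by linarith
      have c2 : α ≤ (T 1)^[m + 1] α := by
        rw [s1]; exact T_one_midR hg (lt_of_le_of_ne h2 (Ne.symm hhalf)) h3
      have c3 : ¬ α ≤ (T 1)^[m + 2] α := by
        have := T_one_high hg c2 hb2.2.le
        linarith
      have e : m + 3 = m + 2 + 1 := rfl
      rw [e, Finset.sum_Ico_succ_top (by omega), Finset.sum_Ico_succ_top (by omega : m ≤ m + 1),
        Finset.sum_Ico_succ_top le_rfl, Finset.Ico_self, Finset.sum_empty, if_neg c1, if_pos c2,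
        if_neg c3]
    · have c2 : ¬ α ≤ (T 1)^[m + 1] α := by
        have := T_one_high hg h2 hb.2.le
        linarith
      rw [Finset.sum_Ico_succ_top (by omega : m ≤ m + 1), Finset.sum_Ico_succ_top le_rfl,
        Finset.Ico_self, Finset.sum_empty, if_pos h2, if_neg c2]

end Visited

section Continued

variable {l : List ℕ} {s t : ℝ}

/-- The inverse branch of an iterate of the Gauss map with digits `l`. -/
noncomputable def phi (l : List ℕ) (s : ℝ) : ℝ := l.foldr (fun b r => 1 / (b + r)) s

@[simp] lemma phi_nil (s : ℝ) : phi [] s = s := rfl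

@[simp] lemma phi_cons (b : ℕ) (l : List ℕ) (s : ℝ) : phi (b :: l) s = 1 / (b + phi l s) := rfl

lemma phi_append (l l' : List ℕ) (s : ℝ) : phi (l ++ l') s = phi l (phi l' s) := by
  simp [phi, List.foldr_append]

lemma phi_mem (hl : ∀ b ∈ l, 1 ≤ b) (h0 : 0 < s) (h1 : s < 1) : 0 < phi l s ∧ phi l s < 1 := by
  induction l with
  | nil => exact ⟨h0, h1⟩
  | cons b l ih =>
    have hi := ih fun c hc => hl c (List.mem_cons_of_mem _ hc)
    have hb : (1 : ℝ) ≤ b := by exact_mod_cast hl b List.mem_cons_self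
    rw [phi_cons, div_lt_one (by linarith)]
    exact ⟨by have := hi.1; positivity, by linarith⟩

lemma phi_mem_Icc (hl : ∀ b ∈ l, 1 ≤ b) (hs : s ∈ Icc (0 : ℝ) 1) : phi l s ∈ Icc (0 : ℝ) 1 := by
  induction l with
  | nil => exact hs
  | cons b l ih =>
    have hi := ih fun c hc => hl c (List.mem_cons_of_mem _ hc)
    have hb : (1 : ℝ) ≤ b := by exact_mod_cast hl b List.mem_cons_self
    rw [phi_cons, mem_Icc, div_le_one (by linarith [hi.1])]
    exact ⟨by have := hi.1; positivity, by linarith [hi.1]⟩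

lemma T_one_one_div (b : ℕ) (h0 : 0 ≤ s) (h1 : s < 1) : T 1 (1 / (b + s)) = s := by
  rw [T_one, one_div_one_div, Int.fract_natCast_add, Int.fract_eq_self.2 ⟨h0, h1⟩]

lemma iterate_phi_append {l' : List ℕ} (hl : ∀ b ∈ l ++ l', 1 ≤ b) (h0 : 0 < s) (h1 : s < 1) :
    (T 1)^[l.length] (phi (l ++ l') s) = phi l' s := by
  induction l with
  | nil => rfl
  | cons b l ih =>
    have hl' : ∀ c ∈ l ++ l', 1 ≤ c := fun c hc => hl c (List.mem_cons_of_mem _ hc)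
    have := phi_mem hl' h0 h1
    rw [List.length_cons, Function.iterate_succ_apply, List.cons_append, phi_cons,
      T_one_one_div b this.1.le this.2, ih hl']

lemma iterate_phi (hl : ∀ b ∈ l, 1 ≤ b) (h0 : 0 < s) (h1 : s < 1) :
    (T 1)^[l.length] (phi l s) = s := by
  simpa using iterate_phi_append (l' := []) (by simpa using hl) h0 h1

lemma rcfDigit_add (x : ℝ) (j k : ℕ) : rcfDigit x (j + k) = rcfDigit ((T 1)^[j] x) k := by
  rw [rcfDigit, rcfDigit, ← Function.iterate_add_apply, add_comm j]

lemma rcfDigit_phi (hl : ∀ b ∈ l, 1 ≤ b) (h0 : 0 < s) (h1 : s < 1) {i : ℕ} (hi : i < l.length) :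
    rcfDigit (phi l s) i = l[i] := by
  have e : l = l.take i ++ l[i] :: l.drop (i + 1) := by
    rw [← List.drop_eq_getElem_cons hi, List.take_append_drop]
  have hlen : (l.take i).length = i := by simp; omega
  have h := iterate_phi_append (l := l.take i) (l' := l[i] :: l.drop (i + 1))
    (by rwa [← e]) h0 h1
  rw [← e, hlen] at h
  have hm := phi_mem (l := l.drop (i + 1)) (fun b hb => hl b (List.mem_of_mem_drop hb)) h0 h1
  rw [rcfDigit, h, phi_cons, one_div_one_div, Int.floor_natCast_add,
    Int.floor_eq_zero_iff.2 ⟨hm.1.le, hm.2⟩, add_zero]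

lemma eq_phi_iterate (x : ℝ) (l : List ℕ)
    (hd : ∀ i (hi : i < l.length), rcfDigit x i = l[i])
    (hx : (T 1)^[l.length] x ≠ 0) : x = phi l ((T 1)^[l.length] x) := by
  induction l generalizing x with
  | nil => rfl
  | cons b l ih =>
    have hx0 : x ≠ 0 := iterate_ne_zero_of_le (Nat.zero_le _) hx
    rw [List.length_cons, Function.iterate_succ_apply, phi_cons, ← ih]
    · have := hd 0 (by simp)
      rw [rcfDigit, Function.iterate_zero, id, List.getElem_cons_zero] at this
      rw [T_one, Int.fract, this]
      simp
    · intro i hi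
      have := hd (1 + i) (by rw [List.length_cons]; omega)
      rw [rcfDigit_add, Function.iterate_one] at this
      rw [this]
      simp [add_comm 1]
    · simpa using hx

/-- Signed contraction of the inverse branches. -/
lemma phi_sub (hl : ∀ b ∈ l, 1 ≤ b) (h0 : 0 ≤ s) (h : s < t) (h1 : t ≤ 1) :
    0 < (-1) ^ l.length * (phi l t - phi l s) ∧
      (-1) ^ l.length * (phi l t - phi l s) ≤ t - s ∧
      (l ≠ [] → (-1) ^ l.length * (phi l t - phi l s) < t - s) := by
  induction l with
  | nil => simpa using h
  | cons b l ih =>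
    have hl' : ∀ c ∈ l, 1 ≤ c := fun c hc => hl c (List.mem_cons_of_mem _ hc)
    obtain ⟨i1, i2, -⟩ := ih hl'
    have hb : (1 : ℝ) ≤ b := by exact_mod_cast hl b List.mem_cons_self
    have ms := (phi_mem_Icc hl' ⟨h0, h.le.trans h1⟩).1
    have mt := (phi_mem_Icc hl' ⟨h0.trans h.le, h1⟩).1
    set x := phi l s
    set y := phi l t
    have hxy : x ≠ y := by rintro hxy; rw [hxy] at i1; simp at i1
    have hp : 1 < (b + x) * (b + y) := by
      rcases lt_or_gt_of_ne hxy with c | c <;> nlinarith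
    have e : (-1 : ℝ) ^ (b :: l).length * (phi (b :: l) t - phi (b :: l) s) =
        (-1) ^ l.length * (y - x) / ((b + x) * (b + y)) := by
      rw [List.length_cons, phi_cons, phi_cons, pow_succ]
      have : b + x ≠ 0 := by linarith
      have : b + y ≠ 0 := by linarith
      change (-1 : ℝ) ^ l.length * -1 * (1 / (b + y) - 1 / (b + x)) = _
      field_simp
      ring
    have hlt : (-1) ^ l.length * (y - x) / ((b + x) * (b + y)) < t - s := by
      rw [div_lt_iff₀ (by linarith)]
      nlinarith
    rw [e]
    exact ⟨by positivity, hlt.le, fun _ => hlt⟩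

lemma abs_phi_sub_le (hl : ∀ b ∈ l, 1 ≤ b) (hs : s ∈ Icc (0 : ℝ) 1) (ht : t ∈ Icc (0 : ℝ) 1) :
    |phi l s - phi l t| ≤ |s - t| := by
  wlog h : s < t generalizing s t
  · rcases (not_lt.1 h).eq_or_lt with rfl | h'
    · simp
    · rw [abs_sub_comm, abs_sub_comm s]; exact this ht hs h'
  have := phi_sub hl hs.1 h ht.2
  have e : |phi l s - phi l t| = |(-1) ^ l.length * (phi l t - phi l s)| := by
    rw [abs_mul, abs_pow, abs_neg, abs_one, one_pow, one_mul, abs_sub_comm]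
  rw [e, abs_of_pos this.1, abs_sub_comm, abs_of_pos (by linarith)]
  exact this.2.1

lemma continuousOn_phi (hl : ∀ b ∈ l, 1 ≤ b) : ContinuousOn (phi l) (Icc 0 1) := by
  refine (LipschitzOnWith.of_dist_le_mul (K := 1) fun x hx y hy => ?_).continuousOn
  simpa [Real.dist_eq] using abs_phi_sub_le hl hx hy

/-- A fixed point of `x ↦ phi l (b x)` separates the cylinder of `l` according to the position of
the tail relative to `b`. -/
lemma cmp_fixed {b : ℝ → ℝ} {e : ℝ} (hl : ∀ b ∈ l, 1 ≤ b) (hne : l ≠ [])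
    (hb : MapsTo b (Icc 0 1) (Icc 0 1))
    (hb' : ∀ x ∈ Icc (0 : ℝ) 1, ∀ y ∈ Icc (0 : ℝ) 1, |b x - b y| ≤ |x - y|)
    (he : e ∈ Icc (0 : ℝ) 1) (hfix : phi l (b e) = e) (hs : s ∈ Icc (0 : ℝ) 1) :
    (s < b (phi l s) ↔ 0 < (-1) ^ l.length * (e - phi l s)) ∧
      (b (phi l s) < s ↔ 0 < (-1) ^ l.length * (phi l s - e)) := by
  have hβ := phi_mem_Icc hl hs
  have hbe := hb he
  have habs := hb' _ hβ _ he
  have hab : |phi l s - e| = |(-1) ^ l.length * (phi l s - e)| := by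
    rw [abs_mul, abs_pow, abs_neg, abs_one, one_pow, one_mul]
  rw [hab, abs_le] at habs
  have hneg : (-1) ^ l.length * (e - phi l s) = -((-1) ^ l.length * (phi l s - e)) := by ring
  rw [hneg]
  rcases lt_trichotomy s (b e) with h | h | h
  · have := phi_sub hl hs.1 h hbe.2
    have h3 := this.2.2 hne
    rw [hfix, hneg] at h3 this
    rw [abs_of_neg (by linarith)] at habs
    constructor <;> constructor <;> intro <;> linarith
  · have : phi l s = e := by rw [h, hfix]
    rw [this, h]; simp
  · have := phi_sub hl hbe.1 h hs.2
    have h3 := this.2.2 hne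
    rw [hfix] at h3 this
    rw [abs_of_pos (by linarith)] at habs
    constructor <;> constructor <;> intro <;> linarith

lemma exists_fixed {b : ℝ → ℝ} (hl : ∀ b ∈ l, 1 ≤ b) (hb : MapsTo b (Icc 0 1) (Icc 0 1))
    (hb' : ∀ x ∈ Icc (0 : ℝ) 1, ∀ y ∈ Icc (0 : ℝ) 1, |b x - b y| ≤ |x - y|) :
    ∃ e ∈ Icc (0 : ℝ) 1, phi l (b e) = e := by
  have hc : ContinuousOn b (Icc 0 1) := by
    refine (LipschitzOnWith.of_dist_le_mul (K := 1) fun x hx y hy => ?_).continuousOn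
    simpa [Real.dist_eq] using hb' x hx y hy
  have := exists_mem_Icc_isFixedPt_of_mapsTo ((continuousOn_phi hl).comp hc hb) zero_le_one
    fun x hx => phi_mem_Icc hl (hb hx)
  exact this

/-- The digits of an eventually periodic continued fraction. -/
lemma rcfDigit_periodic {pre per : List ℕ} {e y : ℝ} (hpre : ∀ b ∈ pre, 1 ≤ b)
    (hper : ∀ b ∈ per, 1 ≤ b) (hne : per ≠ []) (h0 : 0 < y) (h1 : y < 1) (hy : phi per y = y)
    (he : phi pre y = e) (j : ℕ) :
    rcfDigit e j = ((if j < pre.length then pre.getD j 0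
      else per.getD ((j - pre.length) % per.length) 0 : ℕ) : ℤ) := by
  split_ifs with h
  · rw [← he, rcfDigit_phi hpre h0 h1 h, List.getD_eq_getElem _ _ h]
  · obtain ⟨k, rfl⟩ := Nat.exists_eq_add_of_le (not_lt.1 h)
    have hlt : k % per.length < per.length := Nat.mod_lt _ (List.length_pos_iff.2 hne)
    have hp : Function.IsPeriodicPt (T 1) per.length y := by
      have := iterate_phi hper h0 h1
      rwa [hy] at this
    have hd := rcfDigit_phi hper h0 h1 hlt
    rw [hy] at hd
    rw [rcfDigit_add, ← he, iterate_phi hpre h0 h1, Nat.add_sub_cancel_left,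
      List.getD_eq_getElem _ _ hlt, ← hd, rcfDigit, rcfDigit, hp.iterate_mod_apply]

end Continued

section Interval

/-- The lower boundary of the left (`false`) or right (`true`) matching region. -/
noncomputable def bdLo : Bool → ℝ → ℝ
  | false, β => 1 - β
  | true, β => 1 / (β + 1)

/-- The upper boundary of the left (`false`) or right (`true`) matching region. -/
noncomputable def bdHi : Bool → ℝ → ℝ
  | false, β => β / (β + 1)
  | true, β => β

/-- The left (`false`) or right (`true`) matching region. -/
def MatchAt (c : Bool) (β t : ℝ) : Prop := bdLo c β < t ∧ t < bdHi c β

lemma MatchAt.or {c : Bool} {β t : ℝ} (h : MatchAt c β t) : MatchL β t ∨ MatchR β t := by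
  cases c
  · exact .inl h
  · exact .inr h

lemma abs_inv_add_one_sub_le {x y : ℝ} (hx : 0 ≤ x) (hy : 0 ≤ y) :
    |1 / (x + 1) - 1 / (y + 1)| ≤ |x - y| := by
  have e : 1 / (x + 1) - 1 / (y + 1) = (y - x) / ((x + 1) * (y + 1)) := by
    have : x + 1 ≠ 0 := by linarith
    have : y + 1 ≠ 0 := by linarith
    field_simp
    ring
  have hp : 1 ≤ (x + 1) * (y + 1) := by nlinarith [mul_nonneg hx hy]
  rw [e, abs_div, abs_of_pos (by linarith : 0 < (x + 1) * (y + 1)), abs_sub_comm]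
  exact div_le_self (abs_nonneg _) hp

lemma div_add_one_eq {x : ℝ} (hx : 0 ≤ x) : x / (x + 1) = 1 - 1 / (x + 1) := by
  have : x + 1 ≠ 0 := by linarith
  field_simp
  ring

lemma inv_add_one_mem {x : ℝ} (hx : 0 ≤ x) : 1 / (x + 1) ∈ Ioc (0 : ℝ) 1 := by
  refine ⟨by positivity, ?_⟩
  rw [div_le_one (by linarith)]; linarith

lemma bdLo_mapsTo (c : Bool) : MapsTo (bdLo c) (Icc 0 1) (Icc 0 1) := by
  intro x hx
  cases c
  · exact ⟨by simp only [bdLo]; linarith [hx.2], by simp only [bdLo]; linarith [hx.1]⟩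
  · exact Ioc_subset_Icc_self (inv_add_one_mem hx.1)

lemma bdHi_mapsTo (c : Bool) : MapsTo (bdHi c) (Icc 0 1) (Icc 0 1) := by
  intro x hx
  cases c
  · have := inv_add_one_mem hx.1
    rw [bdHi, div_add_one_eq hx.1]
    exact ⟨by linarith [this.2], by linarith [this.1]⟩
  · exact hx

lemma abs_bdLo_sub_le (c : Bool) : ∀ x ∈ Icc (0 : ℝ) 1, ∀ y ∈ Icc (0 : ℝ) 1,
    |bdLo c x - bdLo c y| ≤ |x - y| := by
  intro x hx y hy
  cases c
  · rw [bdLo, bdLo, sub_sub_sub_cancel_left, abs_sub_comm]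
  · exact abs_inv_add_one_sub_le hx.1 hy.1

lemma abs_bdHi_sub_le (c : Bool) : ∀ x ∈ Icc (0 : ℝ) 1, ∀ y ∈ Icc (0 : ℝ) 1,
    |bdHi c x - bdHi c y| ≤ |x - y| := by
  intro x hx y hy
  cases c
  · rw [bdHi, bdHi, div_add_one_eq hx.1, div_add_one_eq hy.1, sub_sub_sub_cancel_left,
      abs_sub_comm]
    exact abs_inv_add_one_sub_le hx.1 hy.1
  · exact le_rfl

lemma MatchAt.mem_Ioo {c : Bool} {β t : ℝ} (h : MatchAt c β t) (hβ : β ∈ Icc (0 : ℝ) 1) :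
    t ∈ Ioo (0 : ℝ) 1 :=
  ⟨(bdLo_mapsTo c hβ).1.trans_lt h.1, h.2.trans_le (bdHi_mapsTo c hβ).2⟩

lemma exists_interval {l : List ℕ} {c : Bool} {s : ℝ} (hl : ∀ b ∈ l, 1 ≤ b) (hne : l ≠ [])
    (hs : s ∈ Ioo (0 : ℝ) 1) (hm : MatchAt c (phi l s) s) :
    ∃ e₁ ∈ Icc (0 : ℝ) 1, ∃ e₂ ∈ Icc (0 : ℝ) 1, phi l (bdHi c e₁) = e₁ ∧ phi l (bdLo c e₂) = e₂ ∧
      e₁ ≠ e₂ ∧ ∀ β, β ∈ Ioo (min e₁ e₂) (max e₁ e₂) ↔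
        ∃ s ∈ Ioo (0 : ℝ) 1, β = phi l s ∧ MatchAt c β s := by
  obtain ⟨e₁, m₁, f₁⟩ := exists_fixed hl (bdHi_mapsTo c) (abs_bdHi_sub_le c)
  obtain ⟨e₂, m₂, f₂⟩ := exists_fixed hl (bdLo_mapsTo c) (abs_bdLo_sub_le c)
  have cmp : ∀ s ∈ Icc (0 : ℝ) 1, MatchAt c (phi l s) s ↔
      0 < (-1) ^ l.length * (phi l s - e₂) ∧ 0 < (-1) ^ l.length * (e₁ - phi l s) := by
    intro s hs
    rw [← (cmp_fixed hl hne (bdLo_mapsTo c) (abs_bdLo_sub_le c) m₂ f₂ hs).2,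
      ← (cmp_fixed hl hne (bdHi_mapsTo c) (abs_bdHi_sub_le c) m₁ f₁ hs).1]
    rfl
  have hα := (cmp s (Ioo_subset_Icc_self hs)).1 hm
  have hpos : 0 < (-1) ^ l.length * (e₁ - e₂) := by linarith [hα.1, hα.2]
  have hJ : ∀ β, β ∈ Ioo (min e₁ e₂) (max e₁ e₂) ↔
      0 < (-1) ^ l.length * (β - e₂) ∧ 0 < (-1) ^ l.length * (e₁ - β) := by
    intro β
    rcases neg_one_pow_eq_or ℝ l.length with h | h <;> rw [h] at hpos ⊢
    · rw [min_eq_right (by linarith), max_eq_left (by linarith), mem_Ioo]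
      constructor <;> rintro ⟨h1, h2⟩ <;> constructor <;> linarith
    · rw [min_eq_left (by linarith), max_eq_right (by linarith), mem_Ioo]
      constructor <;> rintro ⟨h1, h2⟩ <;> constructor <;> linarith
  refine ⟨e₁, m₁, e₂, m₂, f₁, f₂, ?_, fun β => ⟨fun h => ?_, ?_⟩⟩
  · rintro rfl; simp at hpos
  · have hsub : uIcc (bdHi c e₁) (bdLo c e₂) ⊆ Icc 0 1 :=
      ordConnected_Icc.uIcc_subset (bdHi_mapsTo c m₁) (bdLo_mapsTo c m₂)
    have hmem : β ∈ uIcc (phi l (bdHi c e₁)) (phi l (bdLo c e₂)) := by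
      rw [f₁, f₂]; exact Ioo_subset_Icc_self h
    obtain ⟨s', hs', rfl⟩ := intermediate_value_uIcc ((continuousOn_phi hl).mono hsub) hmem
    have := (cmp s' (hsub hs')).2 ((hJ _).1 h)
    exact ⟨s', this.mem_Ioo (phi_mem_Icc hl (hsub hs')), rfl, this⟩
  · rintro ⟨s', hs', rfl, hm'⟩
    exact (hJ _).2 ((cmp s' (Ioo_subset_Icc_self hs')).1 hm')

/-- The block of digits `a k, …, a (k + m - 1)`. -/
def block (a : ℕ → ℕ) (k m : ℕ) : List ℕ := List.ofFn fun i : Fin m => a (i.1 + k)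

@[simp] lemma length_block (a : ℕ → ℕ) (k m : ℕ) : (block a k m).length = m := by simp [block]

@[simp] lemma getElem_block (a : ℕ → ℕ) (k m : ℕ) {i : ℕ} (hi : i < (block a k m).length) :
    (block a k m)[i] = a (i + k) := by simp [block]

lemma getD_block (a : ℕ → ℕ) (k m x : ℕ) {i : ℕ} (hi : i < m + 1) :
    (block a k m ++ [x]).getD i 0 = if i < m then a (i + k) else x := by
  rw [List.getD_eq_getElem _ _ (by simpa using hi)]
  split_ifs with h
  · rw [List.getElem_append_left (by simpa using h), getElem_block]
  · rw [List.getElem_append_right (by simpa using h)]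
    simp

lemma block_succ (a : ℕ → ℕ) (k m : ℕ) : block a k (m + 1) = a k :: block a (k + 1) m := by
  simp [block, List.ofFn_succ, add_comm, add_left_comm]

lemma one_le_block {a : ℕ → ℕ} {k m : ℕ} (h : ∀ i, k ≤ i → i < k + m → 1 ≤ a i) :
    ∀ b ∈ block a k m, 1 ≤ b := by
  intro b hb
  obtain ⟨i, rfl⟩ := (List.mem_ofFn' _ _).1 hb
  exact h _ (by omega) (by omega)

section Endpoints

variable {a : ℕ → ℕ} {n : ℕ} {e : ℝ}

/-- A fixed point lies in the open cylinder. -/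
lemma fixed_mem {b : ℝ → ℝ} (hn : 2 ≤ n) (ha : ∀ i, 2 ≤ i → i < 2 + (n - 1) → 1 ≤ a i)
    (hb : MapsTo b (Icc 0 1) (Icc 0 1)) (hb' : ∀ x, 1 / 2 ≤ x → x < 1 → b x ∈ Ioo (0 : ℝ) 1)
    (he : e ∈ Icc (0 : ℝ) 1) (hfix : phi (1 :: block a 2 (n - 1)) (b e) = e) :
    b e ∈ Ioo (0 : ℝ) 1 ∧ e ∈ Ioo (1 / 2 : ℝ) 1 ∧
      phi (block a 2 (n - 1)) (b e) ∈ Ioo (0 : ℝ) 1 ∧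
      e = 1 / (1 + phi (block a 2 (n - 1)) (b e)) := by
  obtain ⟨m, rfl⟩ := Nat.exists_eq_add_of_le' hn
  have e1 : m + 2 - 1 = m + 1 := rfl
  rw [e1] at ha hfix ⊢
  have hbe := hb he
  have hd := one_le_block ha
  have hmem := phi_mem_Icc hd hbe
  have hpos : 0 < phi (block a 2 (m + 1)) (b e) := by
    have ha2 : (1 : ℝ) ≤ a 2 := by exact_mod_cast ha 2 le_rfl (by omega)
    rw [block_succ, phi_cons]
    have := (phi_mem_Icc (l := block a 3 m) (fun c hc => hd c (by
      rw [block_succ]; exact List.mem_cons_of_mem _ hc)) hbe).1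
    positivity
  rw [phi_cons, Nat.cast_one] at hfix
  have h1 : e < 1 := by
    rw [← hfix, div_lt_one (by linarith)]; linarith
  have h2 : 1 / 2 ≤ e := by
    rw [← hfix]
    exact one_div_le_one_div_of_le (by linarith) (by linarith [hmem.2])
  have h3 := hb' e h2 h1
  have h4 := phi_mem hd h3.1 h3.2
  refine ⟨h3, ⟨?_, h1⟩, h4, hfix.symm⟩
  rw [← hfix]
  exact one_div_lt_one_div_of_lt (by linarith) (by linarith [h4.2])

lemma bdLo_mem (c : Bool) : ∀ x, 1 / 2 ≤ x → x < 1 → bdLo c x ∈ Ioo (0 : ℝ) 1 := by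
  intro x h1 h2
  cases c <;> simp only [bdLo]
  · constructor <;> linarith
  · exact ⟨by positivity, by rw [div_lt_one (by linarith)]; linarith⟩

lemma bdHi_mem (c : Bool) : ∀ x, 1 / 2 ≤ x → x < 1 → bdHi c x ∈ Ioo (0 : ℝ) 1 := by
  intro x h1 h2
  cases c <;> simp only [bdHi]
  · exact ⟨by positivity, by rw [div_lt_one (by linarith)]; linarith⟩
  · constructor <;> linarith

lemma one_le_append {l : List ℕ} (hl : ∀ b ∈ l, 1 ≤ b) {x : ℕ} (hx : 1 ≤ x) :
    ∀ b ∈ l ++ [x], 1 ≤ b := by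
  intro b hb
  rcases List.mem_append.1 hb with h | h
  · exact hl b h
  · rw [List.mem_singleton.1 h]; exact hx

lemma one_le_cons {l : List ℕ} (hl : ∀ b ∈ l, 1 ≤ b) {x : ℕ} (hx : 1 ≤ x) :
    ∀ b ∈ x :: l, 1 ≤ b := by
  intro b hb
  rcases List.mem_cons.1 hb with h | h
  · rw [h]; exact hx
  · exact hl b h

lemma digits_right_hi (hn : 2 ≤ n) (ha : ∀ i, 2 ≤ i → i < 2 + (n - 1) → 1 ≤ a i)
    (he : e ∈ Icc (0 : ℝ) 1) (hfix : phi (1 :: block a 2 (n - 1)) (bdHi true e) = e) (j : ℕ) :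
    rcfDigit e j = if j % n = 0 then 1 else (a (j % n + 1) : ℤ) := by
  obtain ⟨h1, h2, h3, h4⟩ := fixed_mem hn ha (bdHi_mapsTo true) (bdHi_mem true) he hfix
  have hlen : (1 :: block a 2 (n - 1)).length = n := by simp; omega
  rw [rcfDigit_periodic (e := e) (pre := []) (by simp)
    (one_le_cons (one_le_block ha) le_rfl) (by simp) h1.1 h1.2 hfix rfl j]
  rw [if_neg (by simp), List.length_nil, Nat.sub_zero, hlen]
  have hlt : j % n < n := Nat.mod_lt _ (by omega)
  rcases hj : j % n with _ | i
  · simp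
  · rw [List.getD_eq_getElem _ _ (by omega)]
    simp

lemma digits_right_lo (hn : 2 ≤ n) (ha : ∀ i, 2 ≤ i → i < 2 + (n - 1) → 1 ≤ a i)
    (he : e ∈ Icc (0 : ℝ) 1) (hfix : phi (1 :: block a 2 (n - 1)) (bdLo true e) = e) (j : ℕ) :
    rcfDigit e j = if j % (n + 1) = 0 then 1 else if j % (n + 1) = n then 1
      else (a (j % (n + 1) + 1) : ℤ) := by
  obtain ⟨h1, h2, h3, h4⟩ := fixed_mem hn ha (bdLo_mapsTo true) (bdLo_mem true) he hfix
  have hlen : (1 :: (block a 2 (n - 1) ++ [1])).length = n + 1 := by simp; omega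
  have hper : phi (1 :: (block a 2 (n - 1) ++ [1])) e = e := by
    rw [← List.cons_append, phi_append, phi_cons (l := []), phi_nil, Nat.cast_one, add_comm]
    exact hfix
  rw [rcfDigit_periodic (e := e) (pre := []) (y := e) (by simp)
    (one_le_cons (one_le_append (one_le_block ha) le_rfl) le_rfl) (by simp)
    (by linarith [h2.1]) h2.2 hper rfl j]
  rw [if_neg (by simp), List.length_nil, Nat.sub_zero, hlen]
  have hlt : j % (n + 1) < n + 1 := Nat.mod_lt _ (by omega)
  rcases hj : j % (n + 1) with _ | i
  · simp
  · rw [List.getD_cons_succ, getD_block _ _ _ _ (by omega)]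
    split_ifs <;> first | contradiction | omega | rfl

lemma digits_left_hi (hn : 2 ≤ n) (ha : ∀ i, 2 ≤ i → i < 2 + (n - 1) → 1 ≤ a i)
    (he : e ∈ Icc (0 : ℝ) 1) (hfix : phi (1 :: block a 2 (n - 1)) (bdHi false e) = e) (j : ℕ) :
    rcfDigit e j = if j = 0 then 1
      else if (j - 1) % n < n - 1 then (a ((j - 1) % n + 2) : ℤ) else 2 := by
  obtain ⟨h1, h2, h3, h4⟩ := fixed_mem hn ha (bdHi_mapsTo false) (bdHi_mem false) he hfix
  have hlen : (block a 2 (n - 1) ++ [2]).length = n := by simp; omega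
  set x := phi (block a 2 (n - 1)) (bdHi false e) with hx
  have hper : phi (block a 2 (n - 1) ++ [2]) x = x := by
    rw [phi_append, hx]
    congr 1
    rw [phi_cons (l := []), phi_nil, ← hx, bdHi]
    have : 0 < x := h3.1
    rw [h4]
    push_cast
    field_simp
    ring
  rw [rcfDigit_periodic (pre := [1]) (y := x) (by simp)
    (one_le_append (one_le_block ha) one_le_two) (by simp) h3.1 h3.2 hper
    (by simp [← h4]) j]
  rw [hlen, List.length_singleton]
  have hlt : (j - 1) % n < n := Nat.mod_lt _ (by omega)
  rcases Nat.eq_zero_or_pos j with rfl | hj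
  · simp
  · rw [if_neg (by omega), if_neg (by omega), getD_block _ _ _ _ (by omega)]
    split_ifs <;> rfl

lemma digits_left_lo (hn : 2 ≤ n) (ha : ∀ i, 2 ≤ i → i < 2 + (n - 1) → 1 ≤ a i)
    (he : e ∈ Icc (0 : ℝ) 1) (hfix : phi (1 :: block a 2 (n - 1)) (bdLo false e) = e) (j : ℕ) :
    rcfDigit e j = if j = 0 then 1 else if j = 1 then (a 2 : ℤ)
      else if (j - 2) % (n - 1) < n - 2 then (a ((j - 2) % (n - 1) + 3) : ℤ)
      else (a 2 : ℤ) + 1 := by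
  obtain ⟨h1, h2, h3, h4⟩ := fixed_mem hn ha (bdLo_mapsTo false) (bdLo_mem false) he hfix
  obtain ⟨m, rfl⟩ := Nat.exists_eq_add_of_le' hn
  have e1 : m + 2 - 1 = m + 1 := rfl
  have e2 : m + 2 - 2 = m := rfl
  rw [e1] at ha hfix h3 h4 ⊢
  rw [e2]
  have hd := one_le_block ha
  have ha2 : 1 ≤ a 2 := ha 2 le_rfl (by omega)
  have hd' : ∀ b ∈ block a 3 m, 1 ≤ b := one_le_block fun i hi hi' => ha i (by omega) (by omega)
  rw [block_succ, phi_cons] at h3 h4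
  set y := phi (block a 3 m) (bdLo false e) with hy
  have hym := phi_mem hd' h1.1 h1.2
  rw [← hy] at hym
  have hlen : (block a 3 m ++ [a 2 + 1]).length = m + 1 := by simp
  have hper : phi (block a 3 m ++ [a 2 + 1]) y = y := by
    rw [phi_append, hy]
    congr 1
    rw [phi_cons (l := []), phi_nil, ← hy, bdLo]
    have : 0 < y := hym.1
    have : 0 < (a 2 : ℝ) := by exact_mod_cast ha2
    rw [h4]
    push_cast
    field_simp
    ring
  rw [rcfDigit_periodic (pre := [1, a 2]) (y := y) (by simpa using ha2)
    (one_le_append hd' (by omega)) (by simp) hym.1 hym.2 hper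
    (by rw [phi_cons, phi_cons, phi_nil, Nat.cast_one, ← h4]) j]
  rw [hlen]
  have hlt : (j - 2) % (m + 1) < m + 1 := Nat.mod_lt _ (by omega)
  rcases j with _ | _ | j
  · simp
  · simp
  · simp only [List.length_cons, List.length_nil]
    rw [if_neg (by omega), if_neg (by omega), if_neg (by omega), getD_block _ _ _ _ hlt]
    split_ifs
    · rfl
    · push_cast; rfl

end Endpoints

end Interval

open Topology

section Continuity

lemma continuousAt_T_one {x : ℝ} (h : T 1 x ≠ 0) : ContinuousAt (T 1) x := by
  have hx : x ≠ 0 := by rintro rfl; exact h (T_zero 1)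
  have e : T 1 = fun x => Int.fract (1 / x) := funext T_one
  rw [T_one] at h
  rw [e]
  refine ContinuousAt.comp (f := fun x : ℝ => 1 / x) (continuousAt_fract fun h' => h ?_)
    (continuousAt_const.div continuousAt_id hx)
  rw [Int.fract, ← h', sub_self]

lemma continuousAt_iterate {x : ℝ} {k : ℕ} (h : (T 1)^[k] x ≠ 0) : ContinuousAt ((T 1)^[k]) x := by
  induction k with
  | zero => exact continuousAt_id
  | succ k ih =>
    rw [Function.iterate_succ']
    refine ContinuousAt.comp (continuousAt_T_one ?_) (ih (iterate_ne_zero_of_le k.le_succ h))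
    rwa [← Function.iterate_succ_apply' (T 1)]

variable {β₀ : ℝ} {w : List Reg} {f : ℝ → ℝ}

/-- Visiting open regions with continuously moving boundaries is an open condition. -/
lemma eventually_path {u v : Reg → ℝ → ℝ} (hu : ∀ r, ContinuousAt (u r) β₀)
    (hv : ∀ r, ContinuousAt (v r) β₀) (hf : ContinuousAt f β₀)
    (hne : (T 1)^[jumps w] (f β₀) ≠ 0)
    (h : Path (fun r t => u r β₀ < t ∧ t < v r β₀) w (f β₀)) :
    ∀ᶠ β in 𝓝 β₀, Path (fun r t => u r β < t ∧ t < v r β) w (f β) := by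
  induction w generalizing f with
  | nil => exact .of_forall fun _ => trivial
  | cons r w ih =>
    rw [iterate_jumps_cons] at hne
    have hc : ContinuousAt (fun β => (T 1)^[r.jump] (f β)) β₀ :=
      ContinuousAt.comp (continuousAt_iterate fun h0 => hne (by rw [h0, iterate_zero_eq])) hf
    filter_upwards [(hu r).eventually_lt hf h.1.1, hf.eventually_lt (hv r) h.1.2, ih hc hne h.2]
      with β h1 h2 h3 using ⟨⟨h1, h2⟩, h3⟩

lemma Reg.continuousAt_lo (r : Reg) (h : 0 < β₀) : ContinuousAt r.lo β₀ := by
  have : β₀ + 1 ≠ 0 := by linarith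
  cases r <;> unfold Reg.lo <;> fun_prop (disch := assumption)

lemma Reg.continuousAt_hi (r : Reg) (h : 0 < β₀) : ContinuousAt r.hi β₀ := by
  have : β₀ + 1 ≠ 0 := by linarith
  cases r <;> unfold Reg.hi <;> fun_prop (disch := assumption)

lemma Reg.continuousAt_wideLo (r : Reg) (h : 0 < β₀) : ContinuousAt r.wideLo β₀ := by
  have : β₀ + 1 ≠ 0 := by linarith
  cases r <;> unfold Reg.wideLo <;> fun_prop (disch := assumption)

lemma Reg.continuousAt_wideHi (r : Reg) (h : 0 < β₀) : ContinuousAt r.wideHi β₀ := by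
  have : β₀ + 1 ≠ 0 := by linarith
  cases r <;> unfold Reg.wideHi <;> fun_prop (disch := assumption)

lemma eventually_strict (h0 : 0 < β₀) (hf : ContinuousAt f β₀)
    (hne : (T 1)^[jumps w] (f β₀) ≠ 0) (h : Path (Strict β₀) w (f β₀)) :
    ∀ᶠ β in 𝓝 β₀, Path (Strict β) w (f β) :=
  eventually_path (fun r => r.continuousAt_lo h0) (fun r => r.continuousAt_hi h0) hf hne h

lemma eventually_wide (h0 : 0 < β₀) (hf : ContinuousAt f β₀)
    (hne : (T 1)^[jumps w] (f β₀) ≠ 0) (h : Path (Wide β₀) w (f β₀)) :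
    ∀ᶠ β in 𝓝 β₀, Path (Wide β) w (f β) :=
  eventually_path (fun r => r.continuousAt_wideLo h0) (fun r => r.continuousAt_wideHi h0) hf hne h

/-- Visiting closed regions is a closed condition. -/
lemma weak_of_mem_closure {S : Set ℝ} (h0 : 0 < β₀) (hS : β₀ ∈ closure S) (hf : ContinuousAt f β₀)
    (hne : (T 1)^[jumps w] (f β₀) ≠ 0) (h : ∀ β ∈ S, Path (Weak β) w (f β)) :
    Path (Weak β₀) w (f β₀) := by
  have : (𝓝[S] β₀).NeBot := mem_closure_iff_nhdsWithin_neBot.1 hS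
  induction w generalizing f with
  | nil => trivial
  | cons r w ih =>
    rw [iterate_jumps_cons] at hne
    have hc : ContinuousAt (fun β => (T 1)^[r.jump] (f β)) β₀ :=
      ContinuousAt.comp (continuousAt_iterate fun h0 => hne (by rw [h0, iterate_zero_eq])) hf
    refine ⟨⟨?_, ?_⟩, ih hc hne fun β hβ => (h β hβ).2⟩
    · exact le_of_tendsto_of_tendsto (tendsto_nhdsWithin_of_tendsto_nhds (r.continuousAt_lo h0))
        (tendsto_nhdsWithin_of_tendsto_nhds hf)
        (eventually_nhdsWithin_of_forall fun β hβ => (h β hβ).1.1)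
    · exact le_of_tendsto_of_tendsto (tendsto_nhdsWithin_of_tendsto_nhds hf)
        (tendsto_nhdsWithin_of_tendsto_nhds (r.continuousAt_hi h0))
        (eventually_nhdsWithin_of_forall fun β hβ => (h β hβ).1.2)

lemma bdLo_g (c : Bool) : bdLo c g = bdHi c g := by
  have h := g_sq
  have h0 : g + 1 ≠ 0 := by linarith [half_lt_g]
  cases c
  · simp only [bdLo, bdHi]
    rw [eq_div_iff h0]
    linarith
  · simp only [bdLo, bdHi]
    rw [div_eq_iff h0]
    linarith

/-- The itinerary of the orbit of `β` up to the matching time is constant on an interval on which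
the Gauss iterate stays in the matching region. -/
lemma strict_of_preconnected {J : Set ℝ} {c : Bool} {α : ℝ} (hJ : IsPreconnected J)
    (hJ1 : ∀ β ∈ J, β < 1) (hm : ∀ β ∈ J, MatchAt c β ((T 1)^[2 + jumps w] β)) (hα : α ∈ J)
    (hg : g < α) (hw : Path (Weak α) w ((T 1)^[2] α)) :
    ∀ β ∈ J, g < β ∧ Path (Strict β) w ((T 1)^[2] β) := by
  have hhalf := half_lt_g
  have split : ∀ β, (T 1)^[2 + jumps w] β = (T 1)^[jumps w] ((T 1)^[2] β) := fun β => by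
    rw [add_comm, Function.iterate_add_apply]
  have hne : ∀ β ∈ J, g ≤ β → (T 1)^[2 + jumps w] β ≠ 0 := by
    intro β hβ hgβ h0
    have := (hm β hβ).or
    rw [h0] at this
    exact not_match_zero (hJ1 β hβ) (by linarith) this
  have strict : ∀ β ∈ J, g < β → Path (Weak β) w ((T 1)^[2] β) →
      Path (Strict β) w ((T 1)^[2] β) := by
    intro β hβ hgβ h
    have hb := iterate_mem (by norm_num : 1 ≤ 2) β
    refine Path.strict hgβ (hJ1 β hβ) h le_rfl h hb.1 hb.2 ?_
    rw [← split]
    exact (hm β hβ).or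
  let U : Set ℝ := {β | g < β ∧ Path (Strict β) w ((T 1)^[2] β) ∧ (T 1)^[2 + jumps w] β ≠ 0}
  have hU : IsOpen U := by
    rw [isOpen_iff_mem_nhds]
    rintro β ⟨h1, h2, h3⟩
    have hc := continuousAt_iterate (iterate_ne_zero_of_le (by omega : 2 ≤ 2 + jumps w) h3)
    filter_upwards [lt_mem_nhds h1, eventually_strict (by linarith) hc (by rwa [← split]) h2,
      (continuousAt_iterate h3).eventually_ne h3] with x hx1 hx2 hx3 using ⟨hx1, hx2, hx3⟩
  have hsub : J ⊆ U := by
    refine hJ.subset_of_closure_inter_subset hU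
      ⟨α, hα, hg, strict α hα hg hw, hne α hα hg.le⟩ ?_
    rintro β ⟨hβU, hβ⟩
    have hge : g ≤ β := closure_minimal (fun x hx => hx.1.le) isClosed_Ici hβU
    have hgt : g < β := by
      refine lt_of_le_of_ne hge ?_
      rintro rfl
      have := hm _ hβ
      rw [MatchAt, bdLo_g] at this
      exact lt_asymm this.1 this.2
    have h0 := hne β hβ hge
    have hc := continuousAt_iterate (iterate_ne_zero_of_le (by omega : 2 ≤ 2 + jumps w) h0)
    exact ⟨hgt, strict β hβ hgt (weak_of_mem_closure (by linarith) hβU hc (by rwa [← split])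
      fun x hx => hx.2.1.mono fun _ _ => Strict.weak), h0⟩
  exact fun β hβ => ⟨(hsub hβ).1, (hsub hβ).2.1⟩

end Continuity

section Transcendence

variable {β t z : ℝ}

lemma transcendental_quadratic (hz : Transcendental ℤ z) (A B C : ℤ)
    (h : (A : ℝ) * z ^ 2 + B * z + C = 0) : A = 0 ∧ B = 0 ∧ C = 0 := by
  have := transcendental_iff.1 hz
    (Polynomial.C A * Polynomial.X ^ 2 + Polynomial.C B * Polynomial.X + Polynomial.C C)
    (by simpa using h)
  refine ⟨?_, ?_, ?_⟩
  · simpa [Polynomial.coeff_X, Polynomial.coeff_C, -eq_intCast]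
      using congrArg (Polynomial.coeff · 2) this
  · simpa [Polynomial.coeff_X, Polynomial.coeff_C, -eq_intCast]
      using congrArg (Polynomial.coeff · 1) this
  · simpa [Polynomial.coeff_X, Polynomial.coeff_C, -eq_intCast]
      using congrArg (Polynomial.coeff · 0) this

lemma Transcendental.ne_zero' (hz : Transcendental ℤ z) : z ≠ 0 := by
  rintro rfl
  exact hz isAlgebraic_zero

lemma transcendental_T (hz : Transcendental ℤ z) : Transcendental ℤ (T β z) := by
  intro h
  rw [T, if_neg (Transcendental.ne_zero' hz)] at h
  refine hz (IsAlgebraic.inv_iff.1 ?_)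
  simpa using h.add (isAlgebraic_intCast ⌊1 / z + 1 - β⌋)

lemma transcendental_iterate (hz : Transcendental ℤ z) (k : ℕ) :
    Transcendental ℤ ((T β)^[k] z) := by
  induction k with
  | zero => exact hz
  | succ k ih =>
    rw [Function.iterate_succ_apply']
    exact transcendental_T ih

lemma transcendental_rep (hz : Transcendental ℤ t) : Transcendental ℤ (rep β t) := by
  intro h
  refine hz ?_
  simpa [rep] using h.add (isAlgebraic_intCast ⌊t + 1 - β⌋)

lemma T_rep_ne (ht : Transcendental ℤ t) : T β (rep β t) ≠ rep β (-t) := by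
  intro h
  have hz := transcendental_rep (β := β) ht
  have hne := Transcendental.ne_zero' hz
  have e1 : rep β (-t) = -rep β t - ((⌊t + 1 - β⌋ + ⌊-t + 1 - β⌋ : ℤ) : ℝ) := by
    rw [rep, rep]; push_cast; ring
  rw [e1, T, if_neg hne] at h
  generalize rep β t = u at *
  generalize ⌊t + 1 - β⌋ + ⌊-t + 1 - β⌋ = K at *
  generalize ⌊1 / u + 1 - β⌋ = p at *
  have h2 : 1 - p * u = -u ^ 2 - K * u := by
    field_simp at h
    linarith
  have := transcendental_quadratic hz 1 (K - p) 1 (by push_cast; linarith)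
  exact one_ne_zero this.1

lemma T_T_ne (hβ : 0 < β) (hβ1 : β < 1) (hz : Transcendental ℤ z) (h1 : |z| < 1) :
    T β (T β z) ≠ z := by
  intro h
  have hne := Transcendental.ne_zero' hz
  have hy := transcendental_T (β := β) hz
  have hyne := Transcendental.ne_zero' hy
  have hb := rep_mem β (1 / z)
  rw [← T_eq_rep β hne] at hb
  rw [T, if_neg hyne] at h
  have hz' : T β z = 1 / z - ⌊1 / z + 1 - β⌋ := by rw [T, if_neg hne]
  generalize T β z = y at *
  generalize ⌊1 / z + 1 - β⌋ = k at *
  generalize ⌊1 / y + 1 - β⌋ = l at *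
  have e1 : y * z = 1 - k * z := by rw [hz']; field_simp
  have e2 : 1 - l * y = z * y := by
    field_simp at h
    linarith
  have e3 : (-k : ℝ) * z ^ 2 + (-(k * l)) * z + l = 0 := by
    have : (1 - l * y) * z = z * (y * z) := by rw [e2]; ring
    rw [e1] at this
    have e4 : l * (y * z) = l * (1 - k * z) := by rw [e1]
    linarith
  obtain ⟨hk, -, -⟩ := transcendental_quadratic hz (-k) (-(k * l)) l (by push_cast; exact e3)
  obtain rfl : k = 0 := by simpa using hk
  have hy1 : |y| < 1 := by rw [abs_lt]; constructor <;> linarith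
  have : |y * z| < 1 := by rw [abs_mul]; nlinarith [abs_nonneg y, abs_nonneg z]
  rw [e1] at this
  simp at this

/-- No matching occurs while a transcendental parameter has not reached a matching region. -/
lemma not_matching_of_path {w : List Reg} (hg : g < β) (h1 : β < 1) (hβ : Transcendental ℤ β)
    (h : Path (Weak β) w ((T 1)^[2] β)) :
    (T β)^[times w + 1] (β - 1) ≠ (T β)^[times w + 3] β ∧
      (T β)^[times w + 2] (β - 1) ≠ (T β)^[times w + 2] β := by
  have ht := transcendental_iterate (β := 1) hβ (2 + jumps w)
  obtain ⟨o1, o2⟩ := orbit_path hg h1 h (Transcendental.ne_zero' ht)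
  have hs : ∃ t : ℝ, Transcendental ℤ t ∧ (T β)^[times w + 2] β = rep β t ∧
      (T β)^[times w + 1] (β - 1) = rep β (-t) := by
    refine ⟨_, ?_, o1, o2⟩
    rcases neg_one_pow_eq_or ℝ (flips w) with e | e <;> rw [e]
    · rwa [one_mul]
    · rw [neg_one_mul]; exact fun h => ht (by simpa using h.neg)
  obtain ⟨t, htt, e1, e2⟩ := hs
  rw [Function.iterate_succ_apply' (T β) (times w + 2), Function.iterate_succ_apply' (T β)
    (times w + 1) (β - 1), e1, e2]
  refine ⟨(T_rep_ne htt).symm, ?_⟩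
  have := T_rep_ne (β := β) (t := -t) fun h => htt (by simpa using h.neg)
  rwa [neg_neg] at this

lemma iterate_abs_lt (hβ : 0 < β) (hβ1 : β < 1) (hz : Transcendental ℤ β) (k : ℕ) :
    |(T β)^[k] β| < 1 := by
  rcases k with _ | k
  · simpa [abs_of_pos hβ] using hβ1
  · rw [Function.iterate_succ_apply',
      T_eq_rep β (Transcendental.ne_zero' (transcendental_iterate hz k))]
    have := rep_mem β (1 / (T β)^[k] β)
    rw [abs_lt]
    constructor <;> linarith

lemma iterate_eq_of_le {x y : ℝ} {i j d : ℕ} (h : (T β)^[i] x = (T β)^[j] y) :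
    (T β)^[d + i] x = (T β)^[d + j] y := by
  rw [Function.iterate_add_apply, Function.iterate_add_apply, h]

/-- The exponents `(M, N)` of a matching after a path with `k` steps of `T β`. -/
def Exponents (k M N : ℕ) : Prop := (M = k + 2 ∧ N = k + 4) ∨ (M = k + 3 ∧ N = k + 3)

/-- A transcendental parameter near the end of a matching interval but outside of it does not match
with the same exponents. -/
lemma not_matching_of_wide {w : List Reg} {M N : ℕ} (hg : g < β) (h1 : β < 1)
    (hβ : Transcendental ℤ β) (h : Path (Wide β) w ((T 1)^[2] β))
    (hL : ¬ MatchL β ((T 1)^[2 + jumps w] β)) (hR : ¬ MatchR β ((T 1)^[2 + jumps w] β))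
    (hMN : Exponents (times w) M N) (hpre : (T β)^[M - 1] (β - 1) ≠ (T β)^[N - 1] β) :
    (T β)^[M] (β - 1) ≠ (T β)^[N] β := by
  have hhalf := half_lt_g
  have hb : 0 < β := by linarith
  have hcyc : ∀ k, (T β)^[k + 2] β ≠ (T β)^[k] β := by
    intro k
    rw [Function.iterate_succ_apply', Function.iterate_succ_apply']
    exact T_T_ne hb h1 (transcendental_iterate hβ k) (iterate_abs_lt hb h1 hβ k)
  intro heq
  rcases exists_match_of_wide h with hw | ⟨u, v, rfl, hv, hu, hm⟩
  · have hbd := iterate_mem (by omega : 1 ≤ 2 + jumps w) β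
    obtain ⟨r, hr⟩ := exists_weak hbd.1 hbd.2 hL hR
    have hp : Path (Weak β) (w ++ [r]) ((T 1)^[2] β) := by
      refine Path.append.2 ⟨hw, ?_, trivial⟩
      rwa [← Function.iterate_add_apply, add_comm]
    obtain ⟨n1, n2⟩ := not_matching_of_path hg h1 hβ hp
    have ht : times (w ++ [r]) = (r.time - 1) + (times w + 1) := by
      have := r.time_pos
      rw [times_append, times_cons, times_nil]; omega
    have heq' := iterate_eq_of_le (d := r.time - 1) heq
    rw [ht] at n1 n2
    rcases hMN with ⟨rfl, rfl⟩ | ⟨rfl, rfl⟩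
    · exact n1 heq'
    · exact n2 heq'
  · rw [← Function.iterate_add_apply, add_comm] at hm
    have hv1 := one_le_times hv
    obtain ⟨m1, m2⟩ := matching_of_path hg h1 hu hm
    rw [times_append] at hMN
    obtain ⟨d, hd⟩ := Nat.exists_eq_add_of_le' hv1
    rw [hd] at hMN
    have hne : (T 1)^[2 + jumps u] β ≠ 1 / 2 := by
      intro e
      have := transcendental_iterate (β := 1) hβ (2 + jumps u + 1)
      rw [Function.iterate_succ_apply', e, T_one_half] at this
      exact Transcendental.ne_zero' this rfl
    have hsign : (-1) ^ flips u * ((T 1)^[2 + jumps u] β - 1 / 2) ≠ 0 :=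
      mul_ne_zero (pow_ne_zero _ (by norm_num)) (sub_ne_zero.2 hne)
    rcases lt_or_gt_of_ne hsign with hs | hs
    · have e := iterate_eq_of_le (d := d) (m2 hs)
      rcases hMN with ⟨rfl, rfl⟩ | ⟨rfl, rfl⟩
      · refine hcyc (d + (times u + 3)) ?_
        rw [← e, show d + (times u + 3) = times u + (d + 1) + 2 by ring, heq]
      · exact hpre (by convert e using 2 <;> omega)
    · have e := iterate_eq_of_le (d := d) (m1 hs)
      rcases hMN with ⟨rfl, rfl⟩ | ⟨rfl, rfl⟩
      · exact hpre (by convert e using 2 <;> omega)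
      · have e' := iterate_eq_of_le (d := 2) e
        refine hcyc (d + (times u + 4)) ?_
        rw [add_comm _ 2, ← e', show 2 + (d + (times u + 2)) = times u + (d + 1) + 3 by ring, heq,
          show times u + (d + 1) + 3 = d + (times u + 4) by ring]

end Transcendence

section Maximality

variable {l : List ℕ} {c : Bool} {w : List Reg} {J : Set ℝ}

/-- `t` is on the same side of `1/2` as the matching region. -/
def SideHalf : Bool → ℝ → Prop
  | false, t => t < 1 / 2
  | true, t => 1 / 2 < t

lemma MatchAt.sideHalf {β t : ℝ} (h : MatchAt c β t) (hg : g < β) (h1 : β < 1) :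
    SideHalf c t := by
  cases c
  · exact h.2.trans (div_lt_half hg h1)
  · exact (half_lt_one_div hg h1).trans h.1

lemma SideHalf.not_match {β t : ℝ} (h : SideHalf c t) (hg : g < β) (h1 : β < 1)
    (hm : ¬ MatchAt c β t) : ¬ MatchL β t ∧ ¬ MatchR β t := by
  cases c
  · exact ⟨hm, fun h' => lt_asymm ((half_lt_one_div hg h1).trans h'.1) h⟩
  · exact ⟨fun h' => lt_asymm (h'.2.trans (div_lt_half hg h1)) h, hm⟩

lemma SideHalf.eventually {e : ℝ} {f : ℝ → ℝ} (h : SideHalf c (f e)) (hf : ContinuousAt f e) :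
    ∀ᶠ β in 𝓝 e, SideHalf c (f β) := by
  cases c
  · exact hf.eventually_lt continuousAt_const h
  · exact continuousAt_const.eventually_lt hf h

lemma phi_image_mem_nhds {s : ℝ} (hl : ∀ b ∈ l, 1 ≤ b) (hs : s ∈ Ioo (0 : ℝ) 1) :
    phi l '' Ioo 0 1 ∈ 𝓝 (phi l s) := by
  have h1 := (phi_sub hl (by linarith [hs.1]) (by linarith [hs.1] : s / 2 < s) hs.2.le).1
  have h2 := (phi_sub hl hs.1.le (by linarith [hs.2] : s < (s + 1) / 2) (by linarith [hs.2])).1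
  have hsub : uIcc (s / 2) ((s + 1) / 2) ⊆ Ioo 0 1 := by
    rw [uIcc_of_le (by linarith)]
    exact fun x hx => ⟨by linarith [hs.1, hx.1], by linarith [hs.2, hx.2]⟩
  have hiv := intermediate_value_uIcc
    ((continuousOn_phi hl).mono (hsub.trans Ioo_subset_Icc_self))
  refine mem_of_superset ?_ (hiv.trans (image_mono hsub))
  rcases neg_one_pow_eq_or ℝ l.length with e | e <;> rw [e] at h1 h2
  · exact Icc_mem_nhds (min_lt_of_left_lt (by linarith)) (lt_max_of_lt_right (by linarith))
  · exact Icc_mem_nhds (min_lt_of_right_lt (by linarith)) (lt_max_of_lt_left (by linarith))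

/-- Near an endpoint of the interval `J`, matching with the exponents of `J` only occurs in `J`. -/
lemma eventually_not_matching {e : ℝ} {M N : ℕ} (hl : ∀ b ∈ l, 1 ≤ b)
    (hlen : l.length = 2 + jumps w)
    (hJ : ∀ β, β ∈ J ↔ ∃ s ∈ Ioo (0 : ℝ) 1, β = phi l s ∧ MatchAt c β s)
    (hg : g < e) (h1 : e < 1) {s : ℝ} (hs : s ∈ Ioo (0 : ℝ) 1) (hes : phi l s = e)
    (hside : SideHalf c s) (hw : Path (Weak e) w ((T 1)^[2] e)) (hMN : Exponents (times w) M N) :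
    ∀ᶠ β in 𝓝 e, Transcendental ℤ β → β ∉ J →
      (T β)^[M - 1] (β - 1) ≠ (T β)^[N - 1] β → (T β)^[M] (β - 1) ≠ (T β)^[N] β := by
  have hn : ∀ s ∈ Ioo (0 : ℝ) 1, (T 1)^[2 + jumps w] (phi l s) = s := by
    intro s hs
    rw [← hlen]
    exact iterate_phi hl hs.1 hs.2
  have hne : (T 1)^[2 + jumps w] e ≠ 0 := by rw [← hes, hn s hs]; exact hs.1.ne'
  have hne2 := iterate_ne_zero_of_le (by omega : 2 ≤ 2 + jumps w) hne
  have hsplit : (T 1)^[2 + jumps w] e = (T 1)^[jumps w] ((T 1)^[2] e) := by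
    rw [add_comm, Function.iterate_add_apply]
  have hb := iterate_mem (by norm_num : 1 ≤ 2) e
  have hwide := hw.wide hg h1 hb.1 hb.2 (by rwa [← hsplit])
  have hside' : SideHalf c ((T 1)^[2 + jumps w] e) := by rwa [← hes, hn s hs]
  filter_upwards [lt_mem_nhds hg, gt_mem_nhds h1, hside'.eventually (continuousAt_iterate hne),
    eventually_wide (by linarith [half_lt_g]) (continuousAt_iterate hne2) (by rwa [← hsplit]) hwide,
    hes ▸ phi_image_mem_nhds hl hs] with β hβg hβ1 hβs hβw hβm ht hβJ hpre
  obtain ⟨s', hs', hβ⟩ := hβm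
  have hm : ¬ MatchAt c β ((T 1)^[2 + jumps w] β) := by
    rw [← hβ, hn s' hs', hβ]
    exact fun hm => hβJ ((hJ β).2 ⟨s', hs', hβ.symm, hm⟩)
  obtain ⟨nL, nR⟩ := hβs.not_match hβg hβ1 hm
  exact not_matching_of_wide hβg hβ1 ht hβw nL nR hMN hpre

lemma ae_transcendental : ∀ᵐ β : ℝ, Transcendental ℤ β := by
  have := (Algebraic.countable ℤ ℝ).ae_notMem volume
  exact this

lemma fixed_unique {b : ℝ → ℝ} {e e' : ℝ} (hl : ∀ b ∈ l, 1 ≤ b) (hne : l ≠ [])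
    (hb : MapsTo b (Icc 0 1) (Icc 0 1))
    (hb' : ∀ x ∈ Icc (0 : ℝ) 1, ∀ y ∈ Icc (0 : ℝ) 1, |b x - b y| ≤ |x - y|)
    (he : e ∈ Icc (0 : ℝ) 1) (hfix : phi l (b e) = e) (he' : e' ∈ Icc (0 : ℝ) 1)
    (hfix' : phi l (b e') = e') : e = e' := by
  have := cmp_fixed hl hne hb hb' he hfix (hb he')
  rw [hfix'] at this
  simp only [lt_irrefl, false_iff, not_lt] at this
  rcases neg_one_pow_eq_or ℝ l.length with h | h <;> rw [h] at this <;> linarith [this.1, this.2]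

theorem isMatchingInterval_of_fixed {e₁ e₂ α : ℝ} {M N : ℕ} (hl : ∀ b ∈ l, 1 ≤ b)
    (hlen : l.length = 2 + jumps w)
    (m₁ : bdHi c e₁ ∈ Ioo (0 : ℝ) 1) (m₂ : bdLo c e₂ ∈ Ioo (0 : ℝ) 1)
    (he₁ : e₁ ∈ Ioo (0 : ℝ) 1) (he₂ : e₂ ∈ Ioo (0 : ℝ) 1)
    (hfix₁ : phi l (bdHi c e₁) = e₁) (hfix₂ : phi l (bdLo c e₂) = e₂) (hne : e₁ ≠ e₂)
    (hJ : ∀ β, β ∈ Ioo (min e₁ e₂) (max e₁ e₂) ↔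
      ∃ s ∈ Ioo (0 : ℝ) 1, β = phi l s ∧ MatchAt c β s)
    (hα : α ∈ Ioo (min e₁ e₂) (max e₁ e₂)) (hg : g < α)
    (hw : Path (Weak α) w ((T 1)^[2] α))
    (hMN : (0 < (-1) ^ flips w * ((T 1)^[2 + jumps w] α - 1 / 2) ∧
        M = times w + 2 ∧ N = times w + 4) ∨
      ((-1) ^ flips w * ((T 1)^[2 + jumps w] α - 1 / 2) < 0 ∧
        M = times w + 3 ∧ N = times w + 3)) :
    IsMatchingInterval (Ioo (min e₁ e₂) (max e₁ e₂)) M N := by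
  have hhalf := half_lt_g
  have hlne : l ≠ [] := by rintro rfl; simp at hlen; omega
  have hlt : min e₁ e₂ < max e₁ e₂ := hα.1.trans hα.2
  set J := Ioo (min e₁ e₂) (max e₁ e₂) with hJdef
  have hexp : Exponents (times w) M N := hMN.imp And.right And.right
  have hn : ∀ s ∈ Ioo (0 : ℝ) 1, (T 1)^[2 + jumps w] (phi l s) = s := by
    intro s hs
    rw [← hlen]
    exact iterate_phi hl hs.1 hs.2
  have hmatch : ∀ β ∈ J, MatchAt c β ((T 1)^[2 + jumps w] β) := by
    intro β hβ
    obtain ⟨s, hs, h1, h2⟩ := (hJ β).1 hβ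
    rwa [h1, hn s hs, ← h1]
  have hJmem : ∀ β ∈ J, β ∈ Ioo (0 : ℝ) 1 := fun β hβ =>
    ⟨(lt_min he₁.1 he₂.1).trans hβ.1, hβ.2.trans (max_lt he₁.2 he₂.2)⟩
  have hJ1 : ∀ β ∈ J, β < 1 := fun β hβ => (hJmem β hβ).2
  have hstrict := strict_of_preconnected isPreconnected_Ioo hJ1 hmatch hα hg hw
  have hweak : ∀ β ∈ J, Path (Weak β) w ((T 1)^[2] β) := fun β hβ =>
    (hstrict β hβ).2.mono fun _ _ => Strict.weak
  have hsign : ∀ β ∈ J, 0 < ((T 1)^[2 + jumps w] α - 1 / 2) * ((T 1)^[2 + jumps w] β - 1 / 2) := by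
    intro β hβ
    have hsα := (hmatch α hα).sideHalf hg (hJ1 α hα)
    have hsβ := (hmatch β hβ).sideHalf (hstrict β hβ).1 (hJ1 β hβ)
    cases c
    · exact mul_pos_of_neg_of_neg (sub_neg.2 hsα) (sub_neg.2 hsβ)
    · exact mul_pos (sub_pos.2 hsα) (sub_pos.2 hsβ)
  have hwhole : ∀ β ∈ J, (T β)^[M] (β - 1) = (T β)^[N] β := by
    intro β hβ
    obtain ⟨p1, p2⟩ := matching_of_path (hstrict β hβ).1 (hJ1 β hβ) (hweak β hβ) (hmatch β hβ).or
    have hs := hsign β hβ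
    rcases hMN with ⟨hpos, rfl, rfl⟩ | ⟨hneg, rfl, rfl⟩
    · refine p1 ?_
      rcases neg_one_pow_eq_or ℝ (flips w) with e | e <;> rw [e] at hpos ⊢ <;> nlinarith
    · refine p2 ?_
      rcases neg_one_pow_eq_or ℝ (flips w) with e | e <;> rw [e] at hneg ⊢ <;> nlinarith
  have hae : ∀ᵐ β ∂(volume.restrict J), (T β)^[M - 1] (β - 1) ≠ (T β)^[N - 1] β := by
    rw [ae_restrict_iff' measurableSet_Ioo]
    filter_upwards [ae_transcendental] with β ht hβ
    obtain ⟨n1, n2⟩ := not_matching_of_path (hstrict β hβ).1 (hJ1 β hβ) ht (hweak β hβ)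
    rcases hMN with ⟨-, rfl, rfl⟩ | ⟨-, rfl, rfl⟩
    · exact n1
    · exact n2
  refine ⟨⟨_, _, hlt, rfl⟩, fun β hβ => Ioo_subset_Icc_self (hJmem β hβ), hwhole, hae, ?_⟩
  rintro J' ⟨p, q, hpq, rfl⟩ - hJ'm hJ'ae hsub
  have hclos : closure J = Icc (min e₁ e₂) (max e₁ e₂) := closure_Ioo hlt.ne
  have hcont : ∀ e, (T 1)^[2 + jumps w] e ≠ 0 → e ∈ closure J → g ≤ e ∧
      Path (Weak e) w ((T 1)^[2] e) := by
    intro e h0 he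
    have hge : g ≤ e := closure_minimal (fun x hx => (hstrict x hx).1.le) isClosed_Ici he
    refine ⟨hge, weak_of_mem_closure (by linarith) he
      (continuousAt_iterate (iterate_ne_zero_of_le (by omega : 2 ≤ 2 + jumps w) h0)) ?_ hweak⟩
    rwa [← Function.iterate_add_apply, add_comm]
  have hend : ∀ e, e = e₁ ∨ e = e₂ → ∀ᶠ β in 𝓝 e, Transcendental ℤ β → β ∉ J →
      (T β)^[M - 1] (β - 1) ≠ (T β)^[N - 1] β → (T β)^[M] (β - 1) ≠ (T β)^[N] β := by
    rintro e (rfl | rfl)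
    · have h0 : (T 1)^[2 + jumps w] e ≠ 0 := by
        rw [← hfix₁, hn _ m₁]; exact m₁.1.ne'
      obtain ⟨hge, hwe⟩ := hcont e h0 (by rw [hclos]; exact ⟨min_le_left _ _, le_max_left _ _⟩)
      have hgt : g < e := by
        refine lt_of_le_of_ne hge fun hge => hne ?_
        refine fixed_unique hl hlne (bdLo_mapsTo c) (abs_bdLo_sub_le c)
          (Ioo_subset_Icc_self he₁) ?_ (Ioo_subset_Icc_self he₂) hfix₂
        rw [← hge, bdLo_g, hge, hfix₁]
      refine eventually_not_matching hl hlen hJ hgt he₁.2 m₁ hfix₁ ?_ hwe hexp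
      cases c
      · exact div_lt_half hgt he₁.2
      · exact hhalf.trans hgt
    · have h0 : (T 1)^[2 + jumps w] e ≠ 0 := by
        rw [← hfix₂, hn _ m₂]; exact m₂.1.ne'
      obtain ⟨hge, hwe⟩ := hcont e h0 (by rw [hclos]; exact ⟨min_le_right _ _, le_max_right _ _⟩)
      have hgt : g < e := by
        refine lt_of_le_of_ne hge fun hge => hne ?_
        refine fixed_unique hl hlne (bdHi_mapsTo c) (abs_bdHi_sub_le c)
          (Ioo_subset_Icc_self he₁) hfix₁ (Ioo_subset_Icc_self he₂) ?_
        rw [← hge, ← bdLo_g, hge, hfix₂]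
      refine eventually_not_matching hl hlen hJ hgt he₂.2 m₂ hfix₂ ?_ hwe hexp
      cases c
      · change 1 - e < 1 / 2
        linarith
      · exact half_lt_one_div hgt he₂.2
  have hdense : Dense {β : ℝ | Transcendental ℤ β ∧
      (β ∈ Ioo p q → (T β)^[M - 1] (β - 1) ≠ (T β)^[N - 1] β)} := by
    refine Measure.dense_of_ae (μ := volume) ?_
    rw [ae_restrict_iff' measurableSet_Ioo] at hJ'ae
    filter_upwards [ae_transcendental, hJ'ae] with β h1 h2 using ⟨h1, h2⟩
  rw [hJdef, Ioo_subset_Ioo_iff hlt] at hsub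
  have hp : p = min e₁ e₂ := by
    refine hsub.1.antisymm (not_lt.1 fun hlt' => ?_)
    have hev := hend (min e₁ e₂) (min_choice e₁ e₂)
    obtain ⟨x, hx, hxs⟩ := (mem_nhdsLT_iff_exists_Ioo_subset' hlt').1
      (mem_nhdsWithin_of_mem_nhds hev)
    have hx' : max x p < min e₁ e₂ := max_lt hx hlt'
    obtain ⟨β, ⟨ht, hq⟩, hβ1, hβ2⟩ := hdense.exists_between hx'
    have hβJ' : β ∈ Ioo p q :=
      ⟨(le_max_right _ _).trans_lt hβ1, hβ2.trans (hlt.trans_le hsub.2)⟩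
    exact hxs ⟨(le_max_left _ _).trans_lt hβ1, hβ2⟩ ht (fun h => lt_asymm h.1 hβ2) (hq hβJ')
      (hJ'm β hβJ')
  have hq : q = max e₁ e₂ := by
    refine (not_lt.1 fun hlt' => ?_ : q ≤ max e₁ e₂).antisymm hsub.2
    have hev := hend (max e₁ e₂) (max_choice e₁ e₂)
    obtain ⟨x, hx, hxs⟩ := (mem_nhdsGT_iff_exists_Ioo_subset' hlt').1
      (mem_nhdsWithin_of_mem_nhds hev)
    have hx' : max e₁ e₂ < min x q := lt_min hx hlt'
    obtain ⟨β, ⟨ht, hq⟩, hβ1, hβ2⟩ := hdense.exists_between hx'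
    have hβJ' : β ∈ Ioo p q :=
      ⟨(hsub.1.trans_lt hlt).trans hβ1, hβ2.trans_le (min_le_right _ _)⟩
    exact hxs ⟨hβ1, hβ2.trans_le (min_le_left _ _)⟩ ht (fun h => lt_asymm h.2 hβ1) (hq hβJ')
      (hJ'm β hβJ')
  rw [hp, hq]

end Maximality

section Pseudocenter

variable {l : List ℕ} {c : Bool} {K : ℕ} {t β α : ℝ}

lemma phi_strictMono_of_even (hl : ∀ b ∈ l, 1 ≤ b) (he : Even l.length) :
    StrictMonoOn (phi l) (Icc 0 1) := by
  intro x hx y hy h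
  have := (phi_sub hl hx.1 h hy.2).1
  rw [he.neg_one_pow] at this
  linarith

lemma phi_strictAnti_of_odd (hl : ∀ b ∈ l, 1 ≤ b) (ho : Odd l.length) :
    StrictAntiOn (phi l) (Icc 0 1) := by
  intro x hx y hy h
  have := (phi_sub hl hx.1 h hy.2).1
  rw [ho.neg_one_pow] at this
  linarith

lemma one_le_replicate (k : ℕ) : ∀ b ∈ List.replicate k 1, 1 ≤ b := by
  intro b hb
  rw [List.eq_of_mem_replicate hb]

lemma g_mem : g ∈ Icc (0 : ℝ) 1 := by
  have := half_lt_g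
  have := g_sq
  constructor <;> nlinarith

lemma phi_replicate_g (k : ℕ) : phi (List.replicate k 1) g = g := by
  have := half_lt_g
  have := g_sq
  induction k with
  | zero => rfl
  | succ k ih =>
    rw [List.replicate_succ, phi_cons, ih, Nat.cast_one, div_eq_iff (by linarith)]
    linarith

lemma phi_replicate_zero (k : ℕ) :
    phi (List.replicate k 1) 0 = (Nat.fib k : ℝ) / Nat.fib (k + 1) := by
  induction k with
  | zero => simp
  | succ k ih =>
    have h : (0 : ℝ) < Nat.fib (k + 1) := by exact_mod_cast Nat.fib_pos.2 k.succ_pos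
    rw [List.replicate_succ, phi_cons, ih, Nat.fib_add_two]
    push_cast
    field_simp
    ring

lemma phi_replicate_half (k : ℕ) :
    phi (List.replicate k 1) (1 / 2) = phi (List.replicate (k + 2) 1) 0 := by
  rw [List.replicate_add, phi_append]
  congr 1
  simp only [List.replicate, phi_cons, phi_nil]
  norm_num

/-- The integer version of `phi`, acting on pairs of a numerator and a denominator. -/
def phiPair (l : List ℕ) (z : ℕ × ℕ) : ℕ × ℕ := l.foldr (fun b r => (r.2, b * r.2 + r.1)) z

lemma phiPair_cons (b : ℕ) (l : List ℕ) (z : ℕ × ℕ) :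
    phiPair (b :: l) z = ((phiPair l z).2, b * (phiPair l z).2 + (phiPair l z).1) := rfl

lemma phiPair_mono (l : List ℕ) {z z' : ℕ × ℕ} (h : z ≤ z') : phiPair l z ≤ phiPair l z' := by
  induction l with
  | nil => exact h
  | cons b l ih =>
    rw [phiPair_cons, phiPair_cons]
    exact ⟨ih.2, add_le_add (Nat.mul_le_mul_left b ih.2) ih.1⟩

lemma phi_eq_phiPair (hl : ∀ b ∈ l, 1 ≤ b) {z : ℕ × ℕ} (hz : 0 < z.2) :
    0 < (phiPair l z).2 ∧
      phi l ((z.1 : ℝ) / z.2) = ((phiPair l z).1 : ℝ) / (phiPair l z).2 := by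
  induction l with
  | nil => exact ⟨hz, rfl⟩
  | cons b l ih =>
    obtain ⟨h1, h2⟩ := ih fun c hc => hl c (List.mem_cons_of_mem _ hc)
    have hb := hl b List.mem_cons_self
    rw [phiPair_cons, phi_cons, h2]
    have h3 : (0 : ℝ) < (phiPair l z).2 := by exact_mod_cast h1
    refine ⟨Nat.add_pos_left (Nat.mul_pos hb h1) _, ?_⟩
    push_cast
    field_simp

lemma exists_phiPair_eq (hl : ∀ b ∈ l, 1 ≤ b) (h0 : 0 < t) (h1 : t < 1) {x y : ℕ} (hy : 0 < y)
    (h : phi l t = (x : ℝ) / y) :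
    ∃ u v : ℕ, 0 < v ∧ t = (u : ℝ) / v ∧ phiPair l (u, v) = (x, y) := by
  induction l generalizing x y with
  | nil => exact ⟨x, y, hy, h, rfl⟩
  | cons b l ih =>
    have hl' : ∀ c ∈ l, 1 ≤ c := fun c hc => hl c (List.mem_cons_of_mem _ hc)
    have hb : (1 : ℝ) ≤ b := by exact_mod_cast hl b List.mem_cons_self
    have hm := phi_mem hl' h0 h1
    have hy' : (0 : ℝ) < y := by exact_mod_cast hy
    rw [phi_cons, div_eq_div_iff (by linarith [hm.1]) hy'.ne'] at h
    have hx' : (0 : ℝ) < x := by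
      refine pos_of_mul_pos_left (b := (b : ℝ) + phi l t) ?_ (by linarith [hm.1])
      rw [← h]; linarith
    have hle : b * x ≤ y := by
      have : (b * x : ℝ) ≤ y := by nlinarith [mul_pos hx' hm.1]
      exact_mod_cast this
    obtain ⟨u, v, hv, ht, hp⟩ := ih hl' (x := y - b * x) (y := x) (by exact_mod_cast hx') (by
      rw [eq_div_iff hx'.ne', Nat.cast_sub hle]
      push_cast
      linarith)
    refine ⟨u, v, hv, ht, ?_⟩
    rw [phiPair_cons, hp]
    simp only [Prod.mk.injEq, true_and]
    omega

lemma fib_cassini (k : ℕ) :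
    (Nat.fib (k + 2) * Nat.fib k : ℤ) - Nat.fib (k + 1) ^ 2 = (-1) ^ (k + 1) := by
  induction k with
  | zero => simp
  | succ k ih =>
    have e1 : (Nat.fib (k + 2) : ℤ) = Nat.fib k + Nat.fib (k + 1) := by
      rw [Nat.fib_add_two]; push_cast; ring
    have e2 : (Nat.fib (k + 1 + 2) : ℤ) = Nat.fib (k + 1) + Nat.fib (k + 2) := by
      rw [Nat.fib_add_two]; push_cast; ring
    have e3 : k + 1 + 1 = k + 2 := rfl
    rw [pow_succ (-1 : ℤ), ← ih, e2, e3, e1]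
    ring

/-- A fraction strictly between consecutive convergents of `g` is at least their mediant. -/
lemma fib_le_of_between (hK : Odd K) {u v : ℕ} (hv : 0 < v)
    (h1 : phi (List.replicate (K + 1) 1) 0 < (u : ℝ) / v)
    (h2 : (u : ℝ) / v < phi (List.replicate K 1) 0) :
    Nat.fib (K + 2) ≤ u ∧ Nat.fib (K + 3) ≤ v ∧ Nat.fib (K + 1) + u ≤ v := by
  have p1 : (0 : ℝ) < Nat.fib (K + 1) := by exact_mod_cast Nat.fib_pos.2 K.succ_pos
  have p2 : (0 : ℝ) < Nat.fib (K + 1 + 1) := by exact_mod_cast Nat.fib_pos.2 (Nat.succ_pos _)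
  have pv : (0 : ℝ) < v := by exact_mod_cast hv
  rw [phi_replicate_zero, div_lt_div_iff₀ p2 pv] at h1
  rw [phi_replicate_zero, div_lt_div_iff₀ pv p1] at h2
  obtain ⟨k, rfl⟩ := hK
  have hc := fib_cassini (2 * k + 1)
  rw [(by ring : 2 * k + 1 + 1 = 2 * (k + 1)), pow_mul, neg_one_sq, one_pow,
    (by ring : 2 * (k + 1) = 2 * k + 2)] at hc
  have f1 : Nat.fib (2 * k + 1 + 3) = Nat.fib (2 * k + 2) + Nat.fib (2 * k + 1 + 2) :=
    Nat.fib_add_two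
  have f2 : Nat.fib (2 * k + 1 + 2) = Nat.fib (2 * k + 1) + Nat.fib (2 * k + 2) := Nat.fib_add_two
  have f3 : Nat.fib (2 * k + 2) = Nat.fib (2 * k) + Nat.fib (2 * k + 1) := Nat.fib_add_two
  have i1 : (Nat.fib (2 * k + 2) * v : ℤ) + 1 ≤ u * Nat.fib (2 * k + 1 + 2) := by exact_mod_cast h1
  have i2 : (u * Nat.fib (2 * k + 2) : ℤ) + 1 ≤ Nat.fib (2 * k + 1) * v := by exact_mod_cast h2
  zify
  have z1 : (0 : ℤ) ≤ Nat.fib (2 * k) := by positivity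
  have z2 : (0 : ℤ) ≤ Nat.fib (2 * k + 1) := by positivity
  rw [(by ring : 2 * k + 1 + 1 = 2 * k + 2), f1]
  push_cast [f2] at *
  push_cast [f3] at *
  generalize (Nat.fib (2 * k) : ℤ) = x at *
  generalize (Nat.fib (2 * k + 1) : ℤ) = y at *
  obtain ⟨A, hA⟩ : ∃ A, A = (u : ℤ) * (y + (x + y)) - (x + y) * v - 1 := ⟨_, rfl⟩
  obtain ⟨B, hB⟩ : ∃ B, B = y * (v : ℤ) - u * (x + y) - 1 := ⟨_, rfl⟩
  have hA0 : 0 ≤ A := by linarith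
  have hB0 : 0 ≤ B := by linarith
  have hu : (u : ℤ) = y * (A + 1) + (x + y) * (B + 1) := by
    rw [hA, hB]; linear_combination -(u : ℤ) * hc
  have hv' : (v : ℤ) = (x + y) * (A + 1) + (y + (x + y)) * (B + 1) := by
    rw [hA, hB]; linear_combination -(v : ℤ) * hc
  have := mul_nonneg z1 hA0
  have := mul_nonneg z2 hA0
  have := mul_nonneg z1 hB0
  have := mul_nonneg z2 hB0
  refine ⟨?_, ?_, ?_⟩ <;> nlinarith

lemma matchAt_false_iff (hβ : 0 ≤ β) : MatchAt false β t ↔ MatchAt true β (1 - t) := by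
  simp only [MatchAt, bdLo, bdHi, div_add_one_eq hβ]
  constructor <;> rintro ⟨h1, h2⟩ <;> constructor <;> linarith

/-- Numerator and denominator of the innermost part of the pseudocenter. -/
def centerPair (K : ℕ) : Bool → ℕ × ℕ
  | false => (Nat.fib (K + 1), Nat.fib (K + 3))
  | true => (Nat.fib (K + 2), Nat.fib (K + 3))

lemma centerPair_snd_pos (K : ℕ) (c : Bool) : 0 < (centerPair K c).2 := by
  cases c <;> exact Nat.fib_pos.2 (Nat.succ_pos _)

lemma centerPair_true (K : ℕ) :
    ((centerPair K true).1 : ℝ) / (centerPair K true).2 = phi (List.replicate (K + 2) 1) 0 :=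
  (phi_replicate_zero (K + 2)).symm

lemma centerPair_false (K : ℕ) : ((centerPair K false).1 : ℝ) / (centerPair K false).2 =
    1 - phi (List.replicate (K + 2) 1) 0 := by
  have h : (0 : ℝ) < Nat.fib (K + 3) := by exact_mod_cast Nat.fib_pos.2 (Nat.succ_pos _)
  have f : (Nat.fib (K + 3) : ℝ) = Nat.fib (K + 1) + Nat.fib (K + 2) := by
    rw [Nat.fib_add_two (n := K + 1)]; push_cast; ring
  rw [phi_replicate_zero, eq_sub_iff_add_eq]
  change (Nat.fib (K + 1) : ℝ) / Nat.fib (K + 3) + Nat.fib (K + 2) / Nat.fib (K + 3) = 1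
  rw [← add_div, ← f, div_self h.ne']

section Cylinder

variable {d : ℕ} {l' : List ℕ}

/-- Bounds for points of a cylinder whose digits start with exactly `K` ones. -/
lemma cylinder_bounds (hK : Odd K) (hd : 2 ≤ d) (hl' : ∀ b ∈ l', 1 ≤ b) (h0 : 0 < t) (h1 : t < 1) :
    phi (List.replicate (K + 2) 1) 0 < phi (List.replicate K 1 ++ d :: l') t ∧
      phi (List.replicate K 1 ++ d :: l') t < phi (List.replicate K 1) 0 := by
  have hm := phi_mem hl' h0 h1
  have hd' : (2 : ℝ) ≤ d := by exact_mod_cast hd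
  have hanti := phi_strictAnti_of_odd (one_le_replicate K) (by simpa using hK)
  have a0 : 0 < 1 / ((d : ℝ) + phi l' t) := by have := hm.1; positivity
  have a1 : 1 / ((d : ℝ) + phi l' t) < 1 / 2 :=
    one_div_lt_one_div_of_lt two_pos (by linarith [hm.1])
  have hmem : 1 / ((d : ℝ) + phi l' t) ∈ Icc (0 : ℝ) 1 := ⟨a0.le, by linarith⟩
  rw [phi_append, phi_cons, ← phi_replicate_half]
  exact ⟨hanti hmem (by norm_num) a1, hanti (by norm_num) hmem a0⟩

lemma matchAt_center (hK : Odd K) (h : phi (List.replicate (K + 2) 1) 0 < β) :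
    MatchAt c β (((centerPair K c).1 : ℝ) / (centerPair K c).2) := by
  have hσ : g < phi (List.replicate (K + 2) 1) 0 := by
    have := phi_strictAnti_of_odd (one_le_replicate (K + 2))
      (by simpa [parity_simps] using hK) (by norm_num : (0 : ℝ) ∈ Icc (0 : ℝ) 1) g_mem
      (by linarith [half_lt_g])
    rwa [phi_replicate_g] at this
  have hh := half_lt_g
  have key : MatchAt true β (phi (List.replicate (K + 2) 1) 0) := by
    refine ⟨?_, h⟩
    exact (one_div_lt_one_div_of_lt (by linarith) (by linarith)).trans (one_div_lt_self hσ)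
  cases c
  · rw [centerPair_false, matchAt_false_iff (by linarith), sub_sub_cancel]
    exact key
  · rw [centerPair_true]
    exact key

lemma center_le (hK : Odd K) (hβ : 0 < β) (h : β < phi (List.replicate K 1) 0) {u v : ℕ}
    (hv : 0 < v) (hm : MatchAt c β ((u : ℝ) / v)) : centerPair K c ≤ (u, v) := by
  have aux : ∀ {u : ℕ}, MatchAt true β ((u : ℝ) / v) →
      Nat.fib (K + 2) ≤ u ∧ Nat.fib (K + 3) ≤ v ∧ Nat.fib (K + 1) + u ≤ v := by
    intro u hm
    refine fib_le_of_between hK hv ?_ (hm.2.trans h)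
    refine lt_trans ?_ hm.1
    rw [List.replicate_succ, phi_cons, Nat.cast_one]
    exact one_div_lt_one_div_of_lt (by linarith) (by linarith)
  cases c
  · have hv' : (0 : ℝ) < v := by exact_mod_cast hv
    have hlt : u ≤ v := by
      have h1 : (u : ℝ) / v < 1 := hm.2.trans ((div_lt_one (by linarith)).2 (by linarith))
      rw [div_lt_one hv'] at h1
      exact_mod_cast h1.le
    rw [matchAt_false_iff hβ.le] at hm
    have e : 1 - (u : ℝ) / v = ((v - u : ℕ) : ℝ) / v := by
      rw [Nat.cast_sub hlt]
      field_simp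
    rw [e] at hm
    obtain ⟨h1, h2, h3⟩ := aux hm
    exact ⟨show Nat.fib (K + 1) ≤ u by omega, h2⟩
  · obtain ⟨h1, h2, -⟩ := aux hm
    exact ⟨h1, h2⟩

theorem exists_pseudocenter {J : Set ℝ} (hl : ∀ b ∈ l, 1 ≤ b)
    (hJ : ∀ β, β ∈ J ↔ ∃ s ∈ Ioo (0 : ℝ) 1, β = phi l s ∧ MatchAt c β s) (hK : Odd K) (hd : 2 ≤ d)
    (hll : l = List.replicate K 1 ++ d :: l') :
    ∃ p : ℚ, (p : ℝ) = phi l (((centerPair K c).1 : ℝ) / (centerPair K c).2) ∧ (p : ℝ) ∈ J ∧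
      ∀ q : ℚ, (q : ℝ) ∈ J → p.den ≤ q.den := by
  have hl' : ∀ b ∈ l', 1 ≤ b := fun b hb => hl b (by rw [hll]; simp [hb])
  have hbd : ∀ {t : ℝ}, 0 < t → t < 1 → phi (List.replicate (K + 2) 1) 0 < phi l t ∧
      phi l t < phi (List.replicate K 1) 0 := by
    rw [hll]
    exact fun h0 h1 => cylinder_bounds hK hd hl' h0 h1
  obtain ⟨hy, hp⟩ := phi_eq_phiPair hl (centerPair_snd_pos K c)
  have hσ : ((centerPair K c).1 : ℝ) / (centerPair K c).2 ∈ Ioo (0 : ℝ) 1 := by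
    have h1 : (centerPair K c).1 < (centerPair K c).2 := by
      have f : Nat.fib (K + 3) = Nat.fib (K + 1) + Nat.fib (K + 2) := Nat.fib_add_two
      have h1 : 0 < Nat.fib (K + 1) := Nat.fib_pos.2 K.succ_pos
      have h2 : 0 < Nat.fib (K + 2) := Nat.fib_pos.2 (K + 1).succ_pos
      cases c <;> simp only [centerPair] <;> omega
    have h0 : 0 < (centerPair K c).1 := by cases c <;> exact Nat.fib_pos.2 (Nat.succ_pos _)
    have h2 : (0 : ℝ) < (centerPair K c).2 := by exact_mod_cast h0.trans h1
    exact ⟨div_pos (by exact_mod_cast h0) h2, (div_lt_one h2).2 (by exact_mod_cast h1)⟩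
  refine ⟨(phiPair l (centerPair K c)).1 / (phiPair l (centerPair K c)).2, ?_, ?_, ?_⟩
  · push_cast
    exact hp.symm
  · push_cast
    rw [← hp]
    exact (hJ _).2 ⟨_, hσ, rfl, matchAt_center hK (hbd hσ.1 hσ.2).1⟩
  · intro q hq
    obtain ⟨s, hs, hqs, hm⟩ := (hJ _).1 hq
    have hs' := phi_mem hl hs.1 hs.2
    have hnum : 0 ≤ q.num := by
      rw [Rat.num_nonneg]
      have : (0 : ℝ) ≤ q := by rw [hqs]; exact hs'.1.le
      exact_mod_cast this
    obtain ⟨x, hx⟩ := Int.eq_ofNat_of_zero_le hnum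
    have hqx : phi l s = (x : ℝ) / q.den := by
      rw [← hqs, Rat.cast_def, hx]
      simp
    obtain ⟨u, v, hv, hsv, huv⟩ := exists_phiPair_eq hl hs.1 hs.2 q.den_pos hqx
    rw [hqs, hsv] at hm
    have hle := phiPair_mono l (center_le hK (by rw [← hsv]; exact hs'.1)
      (by rw [← hsv]; exact (hbd hs.1 hs.2).2) hv hm)
    rw [huv] at hle
    refine le_trans (Nat.le_of_dvd hy ?_) hle.2
    have := Rat.den_dvd (phiPair l (centerPair K c)).1 (phiPair l (centerPair K c)).2
    rw [Rat.divInt_eq_div, Int.cast_natCast, Int.cast_natCast] at this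
    exact Int.natCast_dvd_natCast.1 this

end Cylinder

lemma exists_replicate_append (l : List ℕ) :
    ∃ K l', l = List.replicate K 1 ++ l' ∧ ∀ b ∈ l'.head?, b ≠ 1 := by
  induction l with
  | nil => exact ⟨0, [], by simp⟩
  | cons b l ih =>
    by_cases hb : b = 1
    · obtain ⟨K, l', h1, h2⟩ := ih
      exact ⟨K + 1, l', by rw [h1, hb, List.replicate_succ, List.cons_append], h2⟩
    · exact ⟨0, b :: l, by simp, by simpa using hb⟩

/-- A point of a matching interval above `g` starts with an odd number of digits `1`, followed by a
larger digit. -/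
lemma exists_leading_ones {n : ℕ} (hl : ∀ b ∈ l, 1 ≤ b) (hn : 2 ≤ n) (hlen : l.length = n)
    (hg : g < α) (h1 : α < 1) (ht : t ∈ Ioo (0 : ℝ) 1) (hα : α = phi l t) (hm : MatchAt c α t)
    (hP : c = false → Odd (P n α)) :
    ∃ K d l', Odd K ∧ 2 ≤ d ∧ l = List.replicate K 1 ++ d :: l' := by
  have hh := half_lt_g
  have htα : t < α := by
    cases c
    · exact hm.2.trans ((div_lt_half hg h1).trans (hh.trans hg))
    · exact hm.2
  have key : ∀ {k : ℕ} {s : ℝ}, Even k → k ≠ 0 → s ∈ Ioo (0 : ℝ) 1 →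
      α = phi (List.replicate k 1) s → α < s := by
    intro k s hk hk0 hs hαs
    have hr := one_le_replicate k
    have he : Even (List.replicate k 1).length := by simpa using hk
    have hgs : g < s := by
      rw [← (phi_strictMono_of_even hr he).lt_iff_lt g_mem (Ioo_subset_Icc_self hs),
        phi_replicate_g, ← hαs]
      exact hg
    have := (phi_sub hr g_mem.1 hgs hs.2.le).2.2 (by simpa [List.replicate_eq_nil_iff] using hk0)
    rw [he.neg_one_pow, phi_replicate_g, ← hαs] at this
    linarith
  obtain ⟨K, l', rfl, hl'⟩ := exists_replicate_append l
  rcases l' with _ | ⟨d, l'⟩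
  · exfalso
    rw [List.append_nil] at hα hl hlen
    rw [List.length_replicate] at hlen
    subst hlen
    rcases Nat.even_or_odd K with hK | hK
    · exact lt_asymm htα (key hK (by omega) ht hα)
    · obtain ⟨k, rfl⟩ := Nat.exists_eq_add_of_le' (by omega : 1 ≤ K)
      have h1t := ht.1
      have hs : 1 / (1 + t) ∈ Ioo (0 : ℝ) 1 :=
        ⟨by positivity, (div_lt_one (by linarith)).2 (by linarith)⟩
      have hα' : α = phi (List.replicate k 1) (1 / (1 + t)) := by
        rw [hα, List.replicate_add, phi_append]
        simp
      have hlt := key (by simpa [parity_simps] using hK) (by omega) hs hα'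
      have hit : (T 1)^[k] α = 1 / (1 + t) := by
        have := iterate_phi (one_le_replicate k) hs.1 hs.2
        rwa [List.length_replicate, ← hα'] at this
      cases c
      · have := hP rfl
        rw [P_eq_zero (.inr (by rw [hit]; exact hlt.le))] at this
        simp at this
      · refine lt_asymm hm.1 (lt_trans ?_ (one_div_sub_one_lt hg))
        have := one_div_lt_one_div_of_lt (by linarith) hlt
        rw [one_div_one_div] at this
        linarith
  · have hd1 : d ≠ 1 := hl' d (by simp)
    have hd : 2 ≤ d := by
      have := hl d (by simp)
      omega
    refine ⟨K, d, l', ?_, hd, rfl⟩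
    rw [← Nat.not_even_iff_odd]
    intro hK
    have hm' := phi_mem (l := l') (fun b hb => hl b (by simp [hb])) ht.1 ht.2
    have hd' : (2 : ℝ) ≤ d := by exact_mod_cast hd
    have a0 : 0 < 1 / ((d : ℝ) + phi l' t) := by have := hm'.1; positivity
    have a1 : 1 / ((d : ℝ) + phi l' t) < 1 / 2 :=
      one_div_lt_one_div_of_lt two_pos (by linarith [hm'.1])
    have := phi_strictMono_of_even (one_le_replicate K) (by simpa using hK)
      (⟨a0.le, by linarith⟩ : 1 / ((d : ℝ) + phi l' t) ∈ Icc (0 : ℝ) 1) g_mem (by linarith)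
    rw [phi_replicate_g] at this
    rw [hα, phi_append, phi_cons] at hg
    exact lt_asymm hg this

end Pseudocenter

section Main

variable {α : ℝ} {a : ℕ → ℕ} {n : ℕ}

lemma one_le_digit (hdig : ∀ i, 2 ≤ i → rcfDigit α (i - 1) = (a i : ℤ)) (hn0 : (T 1)^[n] α ≠ 0) :
    ∀ i, 2 ≤ i → i < 2 + (n - 1) → 1 ≤ a i := by
  intro i hi hin
  have h0 : (T 1)^[i - 1] α ≠ 0 := iterate_ne_zero_of_le (by omega : i - 1 ≤ n) hn0
  have hm := iterate_mem (by omega : 1 ≤ i - 1) α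
  have h1 : (1 : ℤ) ≤ a i := by
    rw [← hdig i hi, rcfDigit, Int.le_floor, Int.cast_one,
      le_div_iff₀ (lt_of_le_of_ne hm.1 (Ne.symm h0))]
    linarith [hm.2]
  exact_mod_cast h1

lemma eq_phi_block (hd0 : rcfDigit α 0 = 1)
    (hdig : ∀ i, 2 ≤ i → rcfDigit α (i - 1) = (a i : ℤ)) (hn : 1 ≤ n) (hn0 : (T 1)^[n] α ≠ 0) :
    α = phi (1 :: block a 2 (n - 1)) ((T 1)^[n] α) := by
  have hlen : (1 :: block a 2 (n - 1)).length = n := by simp; omega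
  have := eq_phi_iterate α (1 :: block a 2 (n - 1)) (fun i hi => ?_) (by rwa [hlen])
  · rwa [hlen] at this
  · rcases i with _ | i
    · simpa using hd0
    · have := hdig (i + 2) (by omega)
      simpa using this

/-- The index of the first digit different from `1` is the number of leading ones. -/
lemma block_leading_ones {K d L : ℕ} {l' : List ℕ} (hK : 1 ≤ K) (hd : 2 ≤ d)
    (h : 1 :: block a 2 (n - 1) = List.replicate K 1 ++ d :: l')
    (hL : L = sInf {k : ℕ | 1 ≤ k ∧ a (k + 1) ≠ 1}) :
    L = K ∧ block a 2 (L - 1) = List.replicate (K - 1) 1 := by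
  have hlen : n - 1 + 1 = K + (l'.length + 1) := by simpa using congrArg List.length h
  have hget : ∀ i, 1 ≤ i → i < n → (List.replicate K 1 ++ d :: l')[i]? = some (a (i + 1)) := by
    intro i hi hin
    obtain ⟨i, rfl⟩ := Nat.exists_eq_add_of_le' hi
    rw [← h, List.getElem?_cons_succ, List.getElem?_eq_getElem (by simp; omega), getElem_block]
  have hones : ∀ i, 1 ≤ i → i < K → a (i + 1) = 1 := by
    intro i hi hiK
    have := hget i hi (by omega)
    rw [List.getElem?_append_left (by simpa using hiK), List.getElem?_replicate_of_lt hiK] at this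
    exact (Option.some.inj this).symm
  have hK' : a (K + 1) = d := by
    have := hget K hK (by omega)
    rw [List.getElem?_append_right (by simp)] at this
    simpa using this.symm
  have hLK : L = K := by
    rw [hL]
    refine le_antisymm (Nat.sInf_le ⟨hK, by omega⟩) (le_csInf ⟨K, hK, by omega⟩ ?_)
    rintro k ⟨hk1, hk⟩
    by_contra! hlt
    exact hk (hones k hk1 hlt)
  refine ⟨hLK, ?_⟩
  rw [List.eq_replicate_iff, length_block, hLK]
  refine ⟨rfl, fun b hb => ?_⟩
  obtain ⟨i, rfl⟩ := (List.mem_ofFn' _ _).1 hb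
  exact hones (i.1 + 1) (by omega) (by omega)

lemma phi_center_true {K : ℕ} (hK : 1 ≤ K) :
    phi ([1] ++ List.replicate (K - 1) 1 ++ [2]) 0 =
      ((centerPair K true).1 : ℝ) / (centerPair K true).2 := by
  obtain ⟨k, rfl⟩ := Nat.exists_eq_add_of_le' hK
  rw [centerPair_true, ← phi_replicate_half, phi_append]
  simp [List.replicate_succ]

lemma phi_center_false {K : ℕ} (hK : 1 ≤ K) :
    phi ([2] ++ List.replicate (K - 1) 1 ++ [1]) 0 =
      ((centerPair K false).1 : ℝ) / (centerPair K false).2 := by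
  obtain ⟨k, rfl⟩ := Nat.exists_eq_add_of_le' hK
  have e : List.replicate k 1 ++ [1] = List.replicate (k + 1) 1 := List.replicate_succ'.symm
  have e' : List.replicate (k + 1 + 2) 1 = 1 :: 1 :: List.replicate (k + 1) 1 := rfl
  rw [centerPair_false, List.append_assoc, Nat.add_sub_cancel, e, List.singleton_append, e',
    phi_cons, phi_cons, phi_cons]
  have := (phi_mem_Icc (one_le_replicate (k + 1)) (left_mem_Icc.2 zero_le_one)).1
  push_cast
  field_simp
  ring

/-- The counted visits to `[α, 1)` are the exchanges along the path. -/
lemma card_filter_Ico_one (hg : g < α) (h1 : α < 1) {w : List Reg}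
    (hw : Path (Weak α) w ((T 1)^[2] α)) (hne : (T 1)^[2 + jumps w] α ≠ 0) :
    ((Finset.Ico 1 (2 + jumps w)).filter fun k => α ≤ (T 1)^[k] α).card = flips w := by
  rw [← card_filter_path hg one_le_two hw hne]
  congr 1
  ext k
  simp only [Finset.mem_filter, Finset.mem_Ico]
  constructor
  · rintro ⟨⟨hk1, hk2⟩, hk⟩
    refine ⟨⟨?_, hk2⟩, hk⟩
    by_contra! hlt
    obtain rfl : k = 1 := by omega
    have := T_one_high hg le_rfl h1.le
    have := one_div_sub_one_lt hg
    have := one_div_lt_self hg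
    rw [Function.iterate_one] at hk
    linarith
  · rintro ⟨⟨hk1, hk2⟩, hk⟩
    exact ⟨⟨by omega, hk2⟩, hk⟩

/-- The matching interval of `α` in terms of fixed points of boundary branches. -/
theorem exists_matching_interval {c : Bool} (hg : g < α) (h1 : α < 1) (hd0 : rcfDigit α 0 = 1)
    (hdig : ∀ i, 2 ≤ i → rcfDigit α (i - 1) = (a i : ℤ)) (hn2 : 2 ≤ n)
    (hm : MatchAt c α ((T 1)^[n] α)) (hP : c = false → Odd (P n α))
    (hmin : ∀ m, 2 ≤ m → m < n →
      ¬ ((MatchL α ((T 1)^[m] α) ∧ Odd (P m α)) ∨ MatchR α ((T 1)^[m] α)))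
    {R L : ℕ} (hR : R = ((Finset.Ico 1 n).filter fun k => α ≤ (T 1)^[k] α).card)
    (hL : L = sInf {k : ℕ | 1 ≤ k ∧ a (k + 1) ≠ 1}) :
    ∃ e₁ e₂ : ℝ, ∃ M N : ℕ, IsMatchingInterval (Ioo (min e₁ e₂) (max e₁ e₂)) M N ∧
      α ∈ Ioo (min e₁ e₂) (max e₁ e₂) ∧ (∀ i, 2 ≤ i → i < 2 + (n - 1) → 1 ≤ a i) ∧
      (e₁ ∈ Icc (0 : ℝ) 1 ∧ phi (1 :: block a 2 (n - 1)) (bdHi c e₁) = e₁) ∧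
      (e₂ ∈ Icc (0 : ℝ) 1 ∧ phi (1 :: block a 2 (n - 1)) (bdLo c e₂) = e₂) ∧
      (((-1 : ℝ) ^ R * ((T 1)^[n] α - 1 / 2) > 0 →
        (M : ℤ) = (n : ℤ) - R ∧ (N : ℤ) = (n : ℤ) - R + 2) ∧
       ((-1 : ℝ) ^ R * ((T 1)^[n] α - 1 / 2) < 0 →
        (M : ℤ) = (n : ℤ) - R + 1 ∧ (N : ℤ) = (n : ℤ) - R + 1)) ∧
      ∃ K, 1 ≤ K ∧ block a 2 (L - 1) = List.replicate (K - 1) 1 ∧ ∃ p : ℚ,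
        (p : ℝ) = phi (1 :: block a 2 (n - 1)) (((centerPair K c).1 : ℝ) / (centerPair K c).2) ∧
        (p : ℝ) ∈ Ioo (min e₁ e₂) (max e₁ e₂) ∧
        ∀ q : ℚ, (q : ℝ) ∈ Ioo (min e₁ e₂) (max e₁ e₂) → p.den ≤ q.den := by
  have hh := half_lt_g
  have ht : (T 1)^[n] α ∈ Ioo (0 : ℝ) 1 := hm.mem_Ioo ⟨by linarith, h1.le⟩
  have ha := one_le_digit hdig ht.1.ne'
  have hα := eq_phi_block hd0 hdig (by omega) ht.1.ne'
  have hl := one_le_cons (one_le_block ha) le_rfl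
  have hlen : (1 :: block a 2 (n - 1)).length = n := by simp; omega
  obtain ⟨e₁, he₁, e₂, he₂, f₁, f₂, hne, hJ⟩ :=
    exists_interval (c := c) hl (by simp) ht (by rwa [← hα])
  have hαJ := (hJ α).2 ⟨_, ht, hα, hm⟩
  obtain ⟨w, hw, hwn⟩ := exists_path hg h1 hn2 (by
    cases c
    · exact .inl ⟨hm, hP rfl⟩
    · exact .inr hm) hmin
  obtain ⟨K, d, l', hK, hd, hll⟩ := exists_leading_ones hl hn2 hlen hg h1 ht hα hm hP
  obtain ⟨-, hblock⟩ := block_leading_ones hK.pos hd hll hL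
  obtain ⟨m₁, i₁, -⟩ := fixed_mem hn2 ha (bdHi_mapsTo c) (bdHi_mem c) he₁ f₁
  obtain ⟨m₂, i₂, -⟩ := fixed_mem hn2 ha (bdLo_mapsTo c) (bdLo_mem c) he₂ f₂
  have hflip : R = flips w := by
    rw [hR, ← hwn]
    exact card_filter_Ico_one hg h1 hw (by rw [hwn]; exact ht.1.ne')
  have hjump := jumps_eq w
  have hside : (T 1)^[n] α - 1 / 2 ≠ 0 := by
    rw [sub_ne_zero]
    have := hm.sideHalf hg h1
    cases c
    · exact ne_of_lt this
    · exact ne_of_gt this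
  have main : ∀ M N : ℕ, _ → IsMatchingInterval (Ioo (min e₁ e₂) (max e₁ e₂)) M N := fun M N =>
    isMatchingInterval_of_fixed hl (hlen.trans hwn.symm) m₁ m₂ ⟨by linarith [i₁.1], i₁.2⟩
      ⟨by linarith [i₂.1], i₂.2⟩ f₁ f₂ hne hJ hαJ hg hw
  rw [hwn, ← hflip] at main
  have hpc := exists_pseudocenter hl hJ hK hd hll
  rcases lt_or_gt_of_ne (mul_ne_zero (pow_ne_zero R (by norm_num : (-1 : ℝ) ≠ 0)) hside)
    with hs | hs
  · exact ⟨e₁, e₂, _, _, main _ _ (.inr ⟨hs, rfl, rfl⟩), hαJ, ha, ⟨he₁, f₁⟩, ⟨he₂, f₂⟩,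
      ⟨fun h => absurd hs h.not_gt, fun _ => by omega⟩, K, hK.pos, hblock, hpc⟩
  · exact ⟨e₁, e₂, _, _, main _ _ (.inl ⟨hs, rfl, rfl⟩), hαJ, ha, ⟨he₁, f₁⟩, ⟨he₂, f₂⟩,
      ⟨fun _ => by omega, fun h => absurd hs h.not_gt⟩, K, hK.pos, hblock, hpc⟩

end Main

end TanakaIto

theorem stmt16 (α : ℝ) (hα : α ∈ Set.Ioc g 1) (hαE : α ∉ E) (a : ℕ → ℕ)
    -- `α = [0; 1, a_2, a_3, …]`:
    (hd0 : rcfDigit α 0 = 1)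
    (hdig : ∀ i, 2 ≤ i → rcfDigit α (i - 1) = (a i : ℤ))
    (n : ℕ) (hn2 : 2 ≤ n)
    -- `n ≥ 2` is minimal such that `1-α < T₁ⁿ(α) < α/(α+1)` and `P_n(α)` odd,
    -- or `1/(α+1) < T₁ⁿ(α) < α`:
    (hQn : ((1 - α < (T 1)^[n] α ∧ (T 1)^[n] α < α / (α + 1)) ∧ Odd (P n α)) ∨
      (1 / (α + 1) < (T 1)^[n] α ∧ (T 1)^[n] α < α))
    (hmin : ∀ m, 2 ≤ m → m < n →
      ¬ (((1 - α < (T 1)^[m] α ∧ (T 1)^[m] α < α / (α + 1)) ∧ Odd (P m α)) ∨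
        (1 / (α + 1) < (T 1)^[m] α ∧ (T 1)^[m] α < α)))
    (R : ℕ) (hR : R = ((Finset.Ico 1 n).filter fun k => α ≤ (T 1)^[k] α).card)
    (L : ℕ) (hL : L = sInf {k : ℕ | 1 ≤ k ∧ a (k + 1) ≠ 1}) :
    ∃ (J : Set ℝ) (M N : ℕ), IsMatchingInterval J M N ∧ α ∈ J ∧
      -- the endpoints of the matching interval:
      (∃ α₁ α₂ : ℝ, J = Set.Ioo (min α₁ α₂) (max α₁ α₂) ∧
        ((1 - α < (T 1)^[n] α ∧ (T 1)^[n] α < α / (α + 1)) →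
          -- `α₁ = [0; 1, overline{a_2, …, a_n, 2}]` and
          -- `α₂ = [0; 1, a_2, overline{a_3, …, a_n, a_2+1}]`:
          (∀ j : ℕ, rcfDigit α₁ j =
            if j = 0 then 1
            else if (j - 1) % n < n - 1 then (a ((j - 1) % n + 2) : ℤ) else 2) ∧
          (∀ j : ℕ, rcfDigit α₂ j =
            if j = 0 then 1 else if j = 1 then (a 2 : ℤ)
            else if (j - 2) % (n - 1) < n - 2 then (a ((j - 2) % (n - 1) + 3) : ℤ)
            else (a 2 : ℤ) + 1)) ∧
        ((1 / (α + 1) < (T 1)^[n] α ∧ (T 1)^[n] α < α) →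
          -- `α₁ = [0; overline{1, a_2, …, a_n}]` and
          -- `α₂ = [0; overline{1, a_2, …, a_n, 1}]`:
          (∀ j : ℕ, rcfDigit α₁ j =
            if j % n = 0 then 1 else (a (j % n + 1) : ℤ)) ∧
          (∀ j : ℕ, rcfDigit α₂ j =
            if j % (n + 1) = 0 then 1
            else if j % (n + 1) = n then 1 else (a (j % (n + 1) + 1) : ℤ)))) ∧
      -- the matching exponents:
      (((-1 : ℝ) ^ R * ((T 1)^[n] α - 1 / 2) > 0 →
        (M : ℤ) = (n : ℤ) - R ∧ (N : ℤ) = (n : ℤ) - R + 2) ∧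
       ((-1 : ℝ) ^ R * ((T 1)^[n] α - 1 / 2) < 0 →
        (M : ℤ) = (n : ℤ) - R + 1 ∧ (N : ℤ) = (n : ℤ) - R + 1)) ∧
      -- the pseudocenter:
      ((1 - α < (T 1)^[n] α ∧ (T 1)^[n] α < α / (α + 1)) →
        ∃ p : ℚ, (p : ℝ) = cfVal (1 :: ((List.ofFn fun i : Fin (n - 1) => a (i.1 + 2))
            ++ [2] ++ (List.ofFn fun i : Fin (L - 1) => a (i.1 + 2)) ++ [1])) ∧
          (p : ℝ) ∈ J ∧ ∀ q : ℚ, (q : ℝ) ∈ J → p.den ≤ q.den) ∧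
      ((1 / (α + 1) < (T 1)^[n] α ∧ (T 1)^[n] α < α) →
        ∃ p : ℚ, (p : ℝ) = cfVal (1 :: ((List.ofFn fun i : Fin (n - 1) => a (i.1 + 2))
            ++ [1] ++ (List.ofFn fun i : Fin (L - 1) => a (i.1 + 2)) ++ [2])) ∧
          (p : ℝ) ∈ J ∧ ∀ q : ℚ, (q : ℝ) ∈ J → p.den ≤ q.den) := by
  have hg : g < α := hα.1
  have hh := TanakaIto.half_lt_g
  have h1 : α < 1 := by
    refine lt_of_le_of_ne hα.2 ?_
    rintro rfl
    have h0 : (T 1)^[n] 1 = 0 := by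
      obtain ⟨k, rfl⟩ := Nat.exists_eq_add_of_le' (by omega : 1 ≤ n)
      rw [Function.iterate_succ_apply, TanakaIto.T_one_of_half_lt (by norm_num) le_rfl]
      norm_num [TanakaIto.iterate_zero_eq]
    rw [h0] at hQn
    norm_num at hQn
  rcases hQn with ⟨hm, hP⟩ | hm
  · have hR' : ¬ (1 / (α + 1) < (T 1)^[n] α ∧ (T 1)^[n] α < α) := fun h =>
      lt_asymm (hm.2.trans (TanakaIto.div_lt_half hg h1))
        ((TanakaIto.half_lt_one_div hg h1).trans h.1)
    obtain ⟨e₁, e₂, M, N, hJ, hαJ, ha, ⟨m₁, f₁⟩, ⟨m₂, f₂⟩, hMN, K, hK, hb, p, hp, hpJ, hpq⟩ :=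
      TanakaIto.exists_matching_interval (c := false) hg h1 hd0 hdig hn2 hm (fun _ => hP) hmin hR hL
    refine ⟨_, M, N, hJ, hαJ, ⟨e₁, e₂, rfl, fun _ => ⟨TanakaIto.digits_left_hi hn2 ha m₁ f₁,
      TanakaIto.digits_left_lo hn2 ha m₂ f₂⟩, fun h => absurd h hR'⟩, hMN,
      fun _ => ⟨p, ?_, hpJ, hpq⟩, fun h => absurd h hR'⟩
    rw [hp, ← TanakaIto.phi_center_false hK, ← TanakaIto.phi_append, ← hb, List.cons_append,
      ← List.append_assoc, ← List.append_assoc]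
    rfl
  · have hL' : ¬ (1 - α < (T 1)^[n] α ∧ (T 1)^[n] α < α / (α + 1)) := fun h =>
      lt_asymm (h.2.trans (TanakaIto.div_lt_half hg h1))
        ((TanakaIto.half_lt_one_div hg h1).trans hm.1)
    obtain ⟨e₁, e₂, M, N, hJ, hαJ, ha, ⟨m₁, f₁⟩, ⟨m₂, f₂⟩, hMN, K, hK, hb, p, hp, hpJ, hpq⟩ :=
      TanakaIto.exists_matching_interval (c := true) hg h1 hd0 hdig hn2 hm
        (fun h => absurd h (by decide)) hmin hR hL
    refine ⟨_, M, N, hJ, hαJ, ⟨e₁, e₂, rfl, fun h => absurd h hL',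
      fun _ => ⟨TanakaIto.digits_right_hi hn2 ha m₁ f₁, TanakaIto.digits_right_lo hn2 ha m₂ f₂⟩⟩,
      hMN, fun h => absurd h hL', fun _ => ⟨p, ?_, hpJ, hpq⟩⟩
    rw [hp, ← TanakaIto.phi_center_true hK, ← TanakaIto.phi_append, ← hb, List.cons_append,
      ← List.append_assoc, ← List.append_assoc]
    rfl
end

section
/- For every integer n ≥ 3, the rational number (n−1)/n belongs to 𝓔̃, i.e., T_α^k(α−1) ≤ 1/(α+1) and T_α^k(1/α − 1) ≤ 1/(α+1) for all k ≥ 1, where α = (n−1)/n. -/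
open Set Filter MeasureTheory

/-- The set `𝓔̃` of parameters in `[g,1]` whose orbits stay below `1/(α+1)`. -/
noncomputable def Etilde : Set ℝ :=
  {α ∈ Set.Icc g 1 | ∀ n ≥ 1,
    (T α)^[n] (α - 1) ≤ 1 / (α + 1) ∧ (T α)^[n] (1 / α - 1) ≤ 1 / (α + 1)}

theorem T_zero (α : ℝ) : T α 0 = 0 := by simp [T]

/-- A reciprocal of an integer is sent to `0` as long as `0 < α ≤ 1`. -/
theorem T_eq_zero_of_one_div_eq_intCast {α x : ℝ} (h0 : 0 < α) (h1 : α ≤ 1) {m : ℤ}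
    (hx : 1 / x = m) : T α x = 0 := by
  have hfloor : ⌊(m : ℝ) + 1 - α⌋ = m := by
    rw [Int.floor_eq_iff]
    constructor <;> linarith
  simp [T, hx, hfloor]

theorem iterate_T_eq_zero {α x : ℝ} (hx : T α x = 0) {k : ℕ} (hk : 1 ≤ k) :
    (T α)^[k] x = 0 := by
  obtain ⟨j, rfl⟩ := Nat.exists_eq_add_of_le' hk
  rw [Function.iterate_succ_apply, hx]
  exact Function.iterate_fixed (T_zero α) j

theorem stmt17 (n : ℕ) (hn : 3 ≤ n) :
    ((n : ℝ) - 1) / n ∈ Etilde ∧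
    (∀ k ≥ 1,
      (T (((n : ℝ) - 1) / n))^[k] (((n : ℝ) - 1) / n - 1) ≤ 1 / (((n : ℝ) - 1) / n + 1) ∧
      (T (((n : ℝ) - 1) / n))^[k] (1 / (((n : ℝ) - 1) / n) - 1) ≤ 1 / (((n : ℝ) - 1) / n + 1)) := by
  have hn' : (3 : ℝ) ≤ n := by exact_mod_cast hn
  have hn0 : (n : ℝ) ≠ 0 := by linarith
  have hn1 : (n : ℝ) - 1 ≠ 0 := by linarith
  have hlow : (2 / 3 : ℝ) ≤ ((n : ℝ) - 1) / n := by
    rw [le_div_iff₀ (by linarith)]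
    linarith
  have hhigh : ((n : ℝ) - 1) / n ≤ 1 := by
    rw [div_le_one (by linarith)]
    linarith
  have hpos : 0 < ((n : ℝ) - 1) / n := by linarith
  have hleft : 1 / (((n : ℝ) - 1) / n - 1) = ((-n : ℤ) : ℝ) := by
    have h : ((n : ℝ) - 1) / n - 1 = -(1 / n) := by
      field_simp
      ring
    rw [h]
    push_cast
    field_simp
  have hright : 1 / (1 / (((n : ℝ) - 1) / n) - 1) = ((n - 1 : ℤ) : ℝ) := by
    have h : 1 / (((n : ℝ) - 1) / n) - 1 = 1 / (n - 1) := by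
      field_simp
      ring
    rw [h, one_div_one_div]
    push_cast
    rfl
  have hbound : 0 ≤ 1 / (((n : ℝ) - 1) / n + 1) := by positivity
  have horbit : ∀ k ≥ 1,
      (T (((n : ℝ) - 1) / n))^[k] (((n : ℝ) - 1) / n - 1) ≤ 1 / (((n : ℝ) - 1) / n + 1) ∧
      (T (((n : ℝ) - 1) / n))^[k] (1 / (((n : ℝ) - 1) / n) - 1) ≤
        1 / (((n : ℝ) - 1) / n + 1) := by
    intro k hk
    rw [iterate_T_eq_zero (T_eq_zero_of_one_div_eq_intCast hpos hhigh hleft) hk,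
      iterate_T_eq_zero (T_eq_zero_of_one_div_eq_intCast hpos hhigh hright) hk]
    exact ⟨hbound, hbound⟩
  have hg : g ≤ 2 / 3 := by
    have h : Real.sqrt 5 ≤ 7 / 3 := Real.sqrt_le_iff.mpr (by norm_num)
    unfold g
    linarith
  exact ⟨⟨⟨hg.trans hlow, hhigh⟩, horbit⟩, horbit⟩
end

section
/- For a ∈ ℕ let f_a : [0,1] → [0,1] be defined by f_a(x) = 1/(a+x). For every n ≥ 1, the set Ĉ_n := f_1^{2n+3}(f_2(C_{2n+1})) (the image of C_{2n+1} under f_2 followed by 2n+3 applications of f_1) is contained in 𝓔̃; equivalently, every α ∈ (g,1) whose regular continued fraction expansion starts with exactly 2n+3 ones followed by the digit 2 and contains no other occurrence of 2n+1 consecutive ones satisfies T_α^k(α−1) ≤ 1/(α+1) and T_α^k(1/α − 1) ≤ 1/(α+1) for all k ≥ 1. -/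
open Set Filter MeasureTheory

/-- `C n`: numbers whose regular continued fraction expansion contains no `n`
consecutive digits all equal to `1`. -/
noncomputable def Cset (n : ℕ) : Set ℝ :=
  {x ∈ Set.Icc 0 1 | ∀ k, ∃ j < n, rcfDigit x (k + j) ≠ 1}

/-- `f a x = 1/(a + x)`. -/
noncomputable def f (a : ℕ) (x : ℝ) : ℝ := 1 / (a + x)

/-- Computation of `T α x` from a decomposition of `1 / x` into an integer and an element of the
fundamental interval `[α - 1, α)`. -/
theorem T_eq_of_one_div_eq {α x c : ℝ} (k : ℤ) (hx : x ≠ 0) (h : 1 / x = k + c)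
    (h1 : α - 1 ≤ c) (h2 : c < α) : T α x = c := by
  have : ⌊1 / x + 1 - α⌋ = k := by
    rw [Int.floor_eq_iff]
    constructor <;> linarith
  rw [T, if_neg hx, this]
  linarith

theorem one_div_eq_floor_add_gauss {t : ℝ} (ht : t ≠ 0) : 1 / t = (⌊1 / t⌋ : ℤ) + T 1 t := by
  simp [T, ht]

/-- The set of points `y` which are obtained from the points of `D` by the elementary changes
occurring along `α`-continued fraction orbits. -/
def OrbitStates (α : ℝ) (D : Set ℝ) : Set ℝ :=
  {y | (y ∈ D ∧ y ≤ 1 / (α + 1)) ∨ (∃ r ∈ D, r ≤ 1 / α - 1 ∧ y = -r / (1 + r)) ∨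
    (∃ s ∈ D, s ≤ 1 - α ∧ y = -s) ∨ (∃ s ∈ D, 1 - α < s ∧ y = 1 - s)}

section OrbitStates

variable {α : ℝ} {D : Set ℝ}

theorem gauss_eq_of_half_lt {t : ℝ} (h1 : 1 / 2 < t) (h2 : t ≤ 1) : T 1 t = 1 / t - 1 := by
  have h0 : 0 < t := by linarith
  refine T_eq_of_one_div_eq 1 h0.ne' (by push_cast; ring) ?_ ?_
  · have : 1 ≤ 1 / t := by rw [le_div_iff₀ h0]; linarith
    linarith
  · have : 1 / t < 2 := by rw [div_lt_iff₀ h0]; linarith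
    linarith

theorem gauss_eq_of_third_lt {t : ℝ} (h1 : 1 / 3 < t) (h2 : t ≤ 1 / 2) : T 1 t = 1 / t - 2 := by
  have h0 : 0 < t := by linarith
  refine T_eq_of_one_div_eq 2 h0.ne' (by push_cast; ring) ?_ ?_
  · have : 2 ≤ 1 / t := by rw [le_div_iff₀ h0]; linarith
    linarith
  · have : 1 / t < 3 := by rw [div_lt_iff₀ h0]; linarith
    linarith

theorem T_mem_orbitStates_of_add (hα : 1 / 2 < α) (hg : 1 ≤ α ^ 2 + α) (hα1 : α < 1)
    (hD : D ⊆ Icc 0 1) (hT : MapsTo (T 1) D D)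
    (hgap : ∀ t ∈ D, t ≤ 1 / α - 1 ∨ 1 / (1 - α) - 2 ≤ t)
    {x t : ℝ} (k : ℤ) (hx : x ≠ 0) (ht : t ∈ D) (h : 1 / x = k + t) :
    T α x ∈ OrbitStates α D := by
  obtain ⟨t0, t1⟩ := hD ht
  rcases lt_or_ge t α with hlt | hge
  · rw [T_eq_of_one_div_eq k hx h (by linarith) hlt]
    refine Or.inl ⟨ht, ?_⟩
    rcases hgap t ht with h' | h'
    · refine h'.trans ?_
      rw [sub_le_iff_le_add, div_add_one (by linarith), div_le_div_iff₀ (by linarith) (by linarith)]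
      nlinarith
    · have : α ≤ 1 / (1 - α) - 2 := by
        rw [le_sub_iff_add_le, le_div_iff₀ (by linarith)]
        nlinarith
      linarith
  · have e : T α x = t - 1 :=
      T_eq_of_one_div_eq (k + 1) hx (by push_cast; linarith) (by linarith) (by linarith)
    have hG := gauss_eq_of_half_lt (hα.trans_le hge) t1
    have h0 : 0 < t := by linarith
    rw [e]
    refine Or.inr (Or.inl ⟨T 1 t, hT ht, ?_, ?_⟩)
    · rw [hG]
      have := one_div_le_one_div_of_le (by linarith) hge
      linarith
    · rw [hG]
      field_simp
      ring

theorem T_mem_orbitStates_of_sub (hα : 1 / 2 < α) (hα1 : α < 1) (hD : D ⊆ Icc 0 1)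
    {x t : ℝ} (k : ℤ) (hx : x ≠ 0) (ht : t ∈ D) (h : 1 / x = k - t) :
    T α x ∈ OrbitStates α D := by
  obtain ⟨t0, t1⟩ := hD ht
  rcases le_or_gt t (1 - α) with hle | hgt
  · rw [T_eq_of_one_div_eq (c := -t) k hx (by linarith) (by linarith) (by linarith)]
    exact Or.inr (Or.inr (Or.inl ⟨t, ht, hle, rfl⟩))
  · rw [T_eq_of_one_div_eq (c := 1 - t) (k - 1) hx (by push_cast; linarith) (by linarith)
      (by linarith)]
    exact Or.inr (Or.inr (Or.inr ⟨t, ht, hgt, rfl⟩))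

theorem gauss_le_of_lt_of_le_half (hα : α < 2 / 3) (hT : MapsTo (T 1) D D)
    (hgap : ∀ t ∈ D, t ≤ 1 / α - 1 ∨ 1 / (1 - α) - 2 ≤ t)
    {s : ℝ} (hs : s ∈ D) (h1 : 1 - α < s) (h2 : s ≤ 1 / 2) :
    1 / s - 2 ∈ D ∧ 1 / s - 2 ≤ 1 / α - 1 := by
  have hmem := hT hs
  rw [gauss_eq_of_third_lt (by linarith) h2] at hmem
  refine ⟨hmem, (hgap _ hmem).resolve_right fun h => ?_⟩
  have := one_div_lt_one_div_of_lt (by linarith) h1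
  linarith

theorem le_of_mem_orbitStates (h1 : 1 / 2 < α) (h2 : α < 2 / 3) (hD : D ⊆ Icc 0 1)
    (hT : MapsTo (T 1) D D) (hgap : ∀ t ∈ D, t ≤ 1 / α - 1 ∨ 1 / (1 - α) - 2 ≤ t)
    {y : ℝ} (hy : y ∈ OrbitStates α D) : y ≤ 1 / (α + 1) := by
  have hpos : 0 < 1 / (α + 1) := by positivity
  rcases hy with ⟨-, h⟩ | ⟨r, hr, -, rfl⟩ | ⟨s, hs, -, rfl⟩ | ⟨s, hs, hlt, rfl⟩
  · exact h
  · have := (hD hr).1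
    have : 0 ≤ r / (1 + r) := by positivity
    rw [neg_div]
    linarith
  · linarith [(hD hs).1]
  · have hs0 : 0 < s := by linarith
    rw [le_div_iff₀ (by linarith)]
    rcases lt_or_ge (1 / 2) s with h | h
    · nlinarith
    · have hle := (gauss_le_of_lt_of_le_half h2 hT hgap hs hlt h).2
      have h3 : 1 / s ≤ (1 + α) / α := by
        have : (1 + α) / α = 1 / α + 1 := by field_simp
        linarith
      rw [div_le_div_iff₀ hs0 (by linarith)] at h3
      nlinarith

theorem mapsTo_orbitStates (h1 : 1 / 2 < α) (h2 : α < 2 / 3) (hg : 1 ≤ α ^ 2 + α)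
    (hD : D ⊆ Icc 0 1) (hT : MapsTo (T 1) D D)
    (hgap : ∀ t ∈ D, t ≤ 1 / α - 1 ∨ 1 / (1 - α) - 2 ≤ t) :
    MapsTo (T α) (OrbitStates α D) (OrbitStates α D) := by
  intro y hy
  have hα1 : α < 1 := by linarith
  rcases eq_or_ne y 0 with rfl | hne
  · rwa [T_zero]
  have key : ∀ r ∈ D, r ≠ 0 → y = -r / (1 + r) → T α y ∈ OrbitStates α D := by
    intro r hr hr0 e
    have hr1 := (hD hr).1
    refine T_mem_orbitStates_of_sub h1 hα1 hD (-(1 + ⌊1 / r⌋)) hne (hT hr) ?_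
    have e2 : 1 / y = -(1 + 1 / r) := by
      rw [e]
      field_simp
      ring
    have := one_div_eq_floor_add_gauss hr0
    push_cast
    linarith
  rcases hy with ⟨hy, -⟩ | ⟨r, hr, -, rfl⟩ | ⟨s, hs, -, rfl⟩ | ⟨s, hs, hlt, rfl⟩
  · exact T_mem_orbitStates_of_add h1 hg hα1 hD hT hgap _ hne (hT hy)
      (one_div_eq_floor_add_gauss hne)
  · refine key r hr ?_ rfl
    rintro rfl
    simp at hne
  · have hs0 : s ≠ 0 := by simpa using hne
    refine T_mem_orbitStates_of_sub h1 hα1 hD (-⌊1 / s⌋) hne (hT hs) ?_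
    have e2 : 1 / -s = -(1 / s) := by field_simp
    have := one_div_eq_floor_add_gauss hs0
    push_cast
    linarith
  · have hs0 : 0 < s := by linarith
    have hs1 := (hD hs).2
    rcases lt_or_ge (1 / 2) s with h | h
    · have hr := hT hs
      rw [gauss_eq_of_half_lt h hs1] at hr
      have hr0 : 1 / s - 1 ≠ 0 := by
        intro h'
        apply hne
        field_simp at h'
        linarith
      refine T_mem_orbitStates_of_add h1 hg hα1 hD hT hgap (1 + ⌊1 / (1 / s - 1)⌋) hne
        (hT hr) ?_
      have e2 : 1 / (1 - s) = 1 + 1 / (1 / s - 1) := by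
        have : 1 / s - 1 = (1 - s) / s := by field_simp
        rw [this]
        field_simp
        ring
      have := one_div_eq_floor_add_gauss hr0
      push_cast
      linarith
    · obtain ⟨hr, hle⟩ := gauss_le_of_lt_of_le_half h2 hT hgap hs hlt h
      have hr0 := (hD hr).1
      set r := 1 / s - 2 with hrdef
      have hs' : s = 1 / (2 + r) := by
        rw [hrdef]
        field_simp
        ring
      have hge : α ≤ 1 / (1 + r) := by
        have h3 : 1 + r ≤ 1 / α := by linarith
        rw [le_div_iff₀ (by linarith)] at h3 ⊢
        linarith
      have hle1 : 1 / (1 + r) ≤ 1 := by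
        rw [div_le_one (by linarith)]
        linarith
      have e : -r / (1 + r) = 1 / (1 + r) - 1 := by
        field_simp
        ring
      refine Or.inr (Or.inl ⟨r, hr, hle, ?_⟩)
      refine T_eq_of_one_div_eq 2 hne ?_ (by linarith) (by linarith)
      have e3 : 1 - s = (1 + r) / (2 + r) := by
        rw [hs']
        field_simp
        ring
      rw [e3]
      push_cast
      field_simp
      ring

theorem iterate_le_of_mem_orbitStates (h1 : 1 / 2 < α) (h2 : α < 2 / 3) (hg : 1 ≤ α ^ 2 + α)
    (hD : D ⊆ Icc 0 1) (hT : MapsTo (T 1) D D)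
    (hgap : ∀ t ∈ D, t ≤ 1 / α - 1 ∨ 1 / (1 - α) - 2 ≤ t)
    {x : ℝ} (hx1 : T α x ≤ 1 / (α + 1)) (hx2 : T α (T α x) ∈ OrbitStates α D)
    {k : ℕ} (hk : 1 ≤ k) : (T α)^[k] x ≤ 1 / (α + 1) := by
  rcases k with _ | _ | k
  · omega
  · exact hx1
  · exact le_of_mem_orbitStates h1 h2 hD hT hgap
      ((mapsTo_orbitStates h1 h2 hg hD hT hgap).iterate k hx2)

end OrbitStates

section RegularContinuedFraction

theorem rcfDigit_add (x : ℝ) (m k : ℕ) : rcfDigit x (m + k) = rcfDigit ((T 1)^[m] x) k := by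
  rw [rcfDigit, rcfDigit, ← Function.iterate_add_apply, Nat.add_comm]

theorem gauss_mem_Icc {x : ℝ} : T 1 x ∈ Icc (0 : ℝ) 1 := by
  rw [T]
  split_ifs
  · simp
  · rw [add_sub_cancel_right]
    exact ⟨Int.fract_nonneg _, (Int.fract_lt_one _).le⟩

theorem mapsTo_gauss_Cset (n : ℕ) : MapsTo (T 1) (Cset n) (Cset n) := by
  refine fun x hx => ⟨gauss_mem_Icc, fun k => ?_⟩
  obtain ⟨j, hj, h⟩ := hx.2 (1 + k)
  refine ⟨j, hj, ?_⟩
  rwa [add_assoc, rcfDigit_add] at h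

theorem zero_mem_Cset {n : ℕ} (hn : 0 < n) : (0 : ℝ) ∈ Cset n := by
  refine ⟨by simp, fun k => ⟨0, hn, ?_⟩⟩
  simp [rcfDigit, Function.iterate_fixed (T_zero 1)]

theorem f_one_mem_Ico {y : ℝ} (h0 : 0 < y) (h1 : y ≤ 1) : f 1 y ∈ Ico (1 / 2 : ℝ) 1 := by
  simp only [f, Nat.cast_one]
  constructor
  · rw [div_le_div_iff₀ (by norm_num) (by linarith)]
    linarith
  · rw [div_lt_one (by linarith)]
    linarith

theorem iterate_f_one_mem_Ioo {z : ℝ} (hz : z ∈ Ioo (0 : ℝ) 1) (k : ℕ) :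
    (f 1)^[k] z ∈ Ioo (0 : ℝ) 1 := by
  induction k with
  | zero => exact hz
  | succ k ih =>
    rw [Function.iterate_succ_apply']
    have := f_one_mem_Ico ih.1 ih.2.le
    exact ⟨by linarith [this.1], this.2⟩

theorem gauss_f_one {y : ℝ} (hy : y ∈ Ioo (0 : ℝ) 1) : T 1 (f 1 y) = y := by
  have := hy.1
  refine T_eq_of_one_div_eq 1 ?_ ?_ (by linarith) hy.2
  · rw [f]
    positivity
  · simp [f]

theorem iterate_gauss_iterate_f_one {z : ℝ} (hz : z ∈ Ioo (0 : ℝ) 1) (k : ℕ) :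
    (T 1)^[k] ((f 1)^[k] z) = z := by
  induction k with
  | zero => rfl
  | succ k ih =>
    rw [Function.iterate_succ_apply, Function.iterate_succ_apply' (f 1),
      gauss_f_one (iterate_f_one_mem_Ioo hz k), ih]

theorem f_two_mem_Icc {x : ℝ} (hx : x ∈ Icc (0 : ℝ) 1) : f 2 x ∈ Icc (1 / 3 : ℝ) (1 / 2) := by
  obtain ⟨h0, h1⟩ := hx
  simp only [f, Nat.cast_ofNat]
  constructor <;> rw [div_le_div_iff₀ (by linarith) (by linarith)] <;> linarith

theorem gauss_f_two_mem_Cset {n : ℕ} (hn : 0 < n) {x : ℝ} (hx : x ∈ Cset n) :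
    T 1 (f 2 x) ∈ Cset n := by
  obtain ⟨h0, h1⟩ := hx.1
  have hne : f 2 x ≠ 0 := by linarith [(f_two_mem_Icc hx.1).1]
  rcases h1.lt_or_eq with h | rfl
  · rwa [T_eq_of_one_div_eq 2 hne (by simp [f]) (by linarith) h]
  · rw [T_eq_of_one_div_eq (c := 0) 3 hne (by norm_num [f]) (by linarith) one_pos]
    exact zero_mem_Cset hn

theorem iterate_f_one_mem_Cset {n m : ℕ} (hm : m < n) {z : ℝ} (hz : z ∈ Icc (1 / 3 : ℝ) (1 / 2))
    (hG : T 1 z ∈ Cset n) : (f 1)^[m] z ∈ Cset n := by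
  have hz' : z ∈ Ioo (0 : ℝ) 1 := ⟨by linarith [hz.1], by linarith [hz.2]⟩
  have hit := iterate_gauss_iterate_f_one hz' m
  refine ⟨Ioo_subset_Icc_self (iterate_f_one_mem_Ioo hz' m), fun k => ?_⟩
  rcases le_or_gt k m with hk | hk
  · refine ⟨m - k, by omega, ?_⟩
    rw [Nat.add_sub_cancel' hk, rcfDigit, hit]
    have h2 : (2 : ℤ) ≤ ⌊1 / z⌋ := by
      rw [Int.le_floor, le_div_iff₀ hz'.1]
      push_cast
      linarith [hz.2]
    omega
  · obtain ⟨l, rfl⟩ := Nat.exists_eq_add_of_lt hk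
    obtain ⟨j, hj, h⟩ := hG.2 l
    refine ⟨j, hj, ?_⟩
    rwa [show m + l + 1 + j = (m + 1) + (l + j) by ring, rcfDigit_add,
      Function.iterate_succ_apply', hit]

/-- Points strictly between consecutive images of `z` start with as many digits `1`. -/
theorem rcfDigit_eq_one_of_between {z : ℝ} (hz : z ∈ Ioo (0 : ℝ) 1) (m : ℕ) {r : ℝ}
    (hr : ((f 1)^[m + 1] z < r ∧ r < (f 1)^[m] z) ∨ ((f 1)^[m] z < r ∧ r < (f 1)^[m + 1] z))
    {j : ℕ} (hj : j < m) : rcfDigit r j = 1 := by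
  induction m generalizing r j with
  | zero => omega
  | succ m ih =>
    rw [Function.iterate_succ_apply' _ (m + 1), Function.iterate_succ_apply' _ m] at hr
    have hA := iterate_f_one_mem_Ioo hz (m + 1)
    have hB := iterate_f_one_mem_Ioo hz m
    rw [Function.iterate_succ_apply'] at hA
    set b := (f 1)^[m] z with hb
    set a := f 1 b with ha
    have hA' := f_one_mem_Ico hA.1 hA.2.le
    have hB' := f_one_mem_Ico hB.1 hB.2.le
    have hr1 : 1 / 2 < r ∧ r < 1 := by
      rcases hr with h | h
      · exact ⟨hA'.1.trans_lt h.1, h.2.trans hB'.2⟩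
      · exact ⟨hB'.1.trans_lt h.1, h.2.trans hA'.2⟩
    have hr0 : 0 < r := by linarith
    rcases j with _ | j
    · rw [rcfDigit, Function.iterate_zero_apply, Int.floor_eq_iff]
      constructor
      · rw [le_div_iff₀ hr0]; push_cast; linarith
      · rw [div_lt_iff₀ hr0]; push_cast; linarith
    · rw [add_comm, rcfDigit_add, Function.iterate_one, gauss_eq_of_half_lt hr1.1 hr1.2.le]
      refine ih ?_ (by omega)
      rw [Function.iterate_succ_apply', ← hb, ← ha]
      have up : ∀ y, 0 < y → f 1 y < r → 1 / r - 1 < y := by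
        intro y hy h
        simp only [f, Nat.cast_one] at h
        rw [div_lt_iff₀ (by linarith)] at h
        rw [sub_lt_iff_lt_add, div_lt_iff₀ hr0]
        linarith
      have down : ∀ y, 0 < y → r < f 1 y → y < 1 / r - 1 := by
        intro y hy h
        simp only [f, Nat.cast_one] at h
        rw [lt_div_iff₀ (by linarith)] at h
        rw [lt_sub_iff_add_lt, lt_div_iff₀ hr0]
        linarith
      rcases hr with h | h
      · exact Or.inr ⟨down _ hB.1 h.2, up _ hA.1 h.1⟩
      · exact Or.inl ⟨down _ hA.1 h.2, up _ hB.1 h.1⟩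

theorem f_one_f_one {y : ℝ} (hy : 0 < y) : f 1 (f 1 y) = (1 + y) / (2 + y) := by
  simp only [f, Nat.cast_one]
  field_simp
  ring

/-- The even iterates of `f 1` increase towards the golden mean. -/
theorem sq_add_le_one_and_le_f_one_f_one {y : ℝ} (hy : 0 < y) (h : y ^ 2 + y ≤ 1) :
    f 1 (f 1 y) ^ 2 + f 1 (f 1 y) ≤ 1 ∧ y ≤ f 1 (f 1 y) := by
  rw [f_one_f_one hy]
  constructor
  · rw [div_pow, div_add_div _ _ (by positivity) (by positivity), div_le_one (by positivity)]
    nlinarith [mul_nonneg (by linarith : 0 ≤ 2 + y) (sub_nonneg.2 h)]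
  · rw [le_div_iff₀ (by linarith)]
    nlinarith

theorem even_iterate_f_one_bounds {z : ℝ} (hz : z ∈ Icc (1 / 3 : ℝ) (1 / 2)) (m : ℕ) :
    1 / 2 < (f 1)^[2 * m + 2] z ∧ ((f 1)^[2 * m + 2] z) ^ 2 + (f 1)^[2 * m + 2] z ≤ 1 := by
  have hz0 : 0 < z := by linarith [hz.1]
  induction m with
  | zero =>
    change 1 / 2 < f 1 (f 1 z) ∧ f 1 (f 1 z) ^ 2 + f 1 (f 1 z) ≤ 1
    refine ⟨?_, (sq_add_le_one_and_le_f_one_f_one hz0 (by nlinarith [hz.2])).1⟩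
    rw [f_one_f_one hz0, div_lt_div_iff₀ (by norm_num) (by linarith)]
    linarith
  | succ m ih =>
    have e : (f 1)^[2 * (m + 1) + 2] z = f 1 (f 1 ((f 1)^[2 * m + 2] z)) := by
      simp only [← Function.iterate_succ_apply' (f 1)]
      rfl
    have := sq_add_le_one_and_le_f_one_f_one (by linarith [ih.1]) ih.2
    rw [e]
    exact ⟨ih.1.trans_le this.2, this.1⟩

end RegularContinuedFraction

theorem g_le_of_one_le {a : ℝ} (h0 : 0 < a) (h : 1 ≤ a ^ 2 + a) : g ≤ a := by
  have : Real.sqrt 5 ≤ 2 * a + 1 := Real.sqrt_le_iff.2 ⟨by linarith, by nlinarith⟩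
  rw [g]
  linarith

theorem stmt18 (n : ℕ) (hn : 1 ≤ n) :
    ((f 1)^[2 * n + 3] ∘ f 2) '' Cset (2 * n + 1) ⊆ Etilde := by
  rintro _ ⟨x, hx, rfl⟩
  obtain ⟨m, rfl⟩ := Nat.exists_eq_add_of_le' hn
  set D := Cset (2 * (m + 1) + 1)
  have hD : D ⊆ Icc 0 1 := fun y hy => hy.1
  have hT : MapsTo (T 1) D D := mapsTo_gauss_Cset _
  have hz := f_two_mem_Icc hx.1
  have hw : (f 1)^[2 * m + 1] (f 2 x) ∈ D :=
    iterate_f_one_mem_Cset (by omega) hz (gauss_f_two_mem_Cset (by omega) hx)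
  rw [Function.comp_apply]
  set z := f 2 x
  have hz' : z ∈ Ioo (0 : ℝ) 1 := ⟨by linarith [hz.1], by linarith [hz.2]⟩
  obtain ⟨hu1, hu2⟩ := even_iterate_f_one_bounds hz (m + 1)
  set w := (f 1)^[2 * m + 1] z with hwdef
  set v := (f 1)^[2 * (m + 1) + 1] z with hvdef
  set u := (f 1)^[2 * (m + 1) + 2] z with hudef
  set α := (f 1)^[2 * (m + 1) + 3] z with hαdef
  have hw0 : 0 < w := (iterate_f_one_mem_Ioo hz' _).1
  have hv0 : 0 < v := (iterate_f_one_mem_Ioo hz' _).1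
  have hv1 : v < 1 := (iterate_f_one_mem_Ioo hz' _).2
  have hvw : v = (1 + w) / (2 + w) := by
    rw [← f_one_f_one hw0, hvdef, hwdef]
    simp only [← Function.iterate_succ_apply' (f 1)]
    rfl
  have huv : u = 1 / (1 + v) := by
    rw [hudef, Function.iterate_succ_apply', ← hvdef]
    simp [f]
  have hαu : α = 1 / (1 + u) := by
    rw [hαdef, Function.iterate_succ_apply', ← hudef]
    simp [f]
  have hu0 : 0 < u := by linarith
  have hα1 : 1 / 2 < α := by
    rw [hαu, div_lt_div_iff₀ (by norm_num) (by linarith)]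
    nlinarith
  have hα2 : α < 2 / 3 := by
    rw [hαu, div_lt_div_iff₀ (by linarith) (by norm_num)]
    linarith
  have hg : 1 ≤ α ^ 2 + α := by
    rw [hαu, div_pow, div_add_div _ _ (by positivity) (by positivity), le_div_iff₀ (by positivity)]
    nlinarith [mul_nonneg (by linarith : 0 ≤ 1 + u) (sub_nonneg.2 hu2)]
  have hα0 : 0 < α := by linarith
  have huα : u = 1 / α - 1 := by
    rw [hαu]
    field_simp
    ring
  have hvα : v = 1 / (1 - α) - 2 := by
    have e : 1 - α = u / (1 + u) := by
      rw [hαu]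
      field_simp
      ring
    rw [e, huv]
    field_simp
    ring
  have hαv : α ≤ v := by
    rw [hvα, le_sub_iff_add_le, le_div_iff₀ (by linarith)]
    nlinarith
  have hgap : ∀ t ∈ D, t ≤ 1 / α - 1 ∨ 1 / (1 - α) - 2 ≤ t := by
    intro t ht
    rw [← huα, ← hvα]
    by_contra! h
    obtain ⟨j, hj, hne⟩ := ht.2 0
    rw [zero_add] at hne
    exact hne (rcfDigit_eq_one_of_between hz' _ (Or.inl h) hj)
  have hvw1 : 1 - v = 1 / (2 + w) := by
    rw [hvw]
    field_simp
    ring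
  have hv1' : 1 - v ≠ 0 := by linarith
  have hT1 : T α (α - 1) = 1 - v := by
    refine T_eq_of_one_div_eq (-3) (by linarith) ?_ (by linarith) (by linarith)
    have : 1 / (α - 1) = -(1 / (1 - α)) := by
      rw [← neg_sub, div_neg]
    rw [this]
    push_cast
    linarith
  have hT2 : T α (1 / α - 1) = v - 1 := by
    refine T_eq_of_one_div_eq 2 (by linarith) ?_ (by linarith) (by linarith)
    rw [← huα, huv]
    push_cast
    field_simp
    ring
  have hpos : 1 / 2 ≤ 1 / (α + 1) := one_div_le_one_div_of_le (by linarith) (by linarith)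
  refine ⟨⟨g_le_of_one_le hα0 hg, by linarith⟩, fun k hk => ⟨?_, ?_⟩⟩
  · refine iterate_le_of_mem_orbitStates hα1 hα2 hg hD hT hgap (by rw [hT1]; linarith) ?_ hk
    rw [hT1]
    refine T_mem_orbitStates_of_add hα1 hg (by linarith) hD hT hgap 2 hv1' hw ?_
    rw [hvw1]
    simp
  · refine iterate_le_of_mem_orbitStates hα1 hα2 hg hD hT hgap (by rw [hT2]; linarith) ?_ hk
    rw [hT2]
    refine T_mem_orbitStates_of_sub hα1 (by linarith) hD (-2) (by linarith) hw ?_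
    rw [← neg_sub, hvw1, div_neg, one_div_one_div]
    push_cast
    ring
end

section
/- Let α ∈ (g,1], x, y ∈ [α−1, α), z ∈ [0,1), and set x' = T_α(x), x'' = T_α^2(x), y' = T_α(y), y'' = T_α^2(y), z' = T_1(z), z'' = T_1^2(z). Then: (i) if z = x and (x + y = 0 or (x+1)(y+1) = 1), then either (z' = x' and x' + y' ∈ {0,1}) or (z' = 1 + x' and x' + y' = 0); (ii) if z = 1 + x and x + y = 0, then either (z'' = y' and x' + y' ∈ {0,1}) or (z'' = 1 + y' and x' + y' = 0); (iii) if z = x and x + y = 1, then: x' = y'' if z < α/(α+1); z' = x' and (x'+1)(y'+1) = 1 if α/(α+1) ≤ z ≤ 1/2; z'' = y' and (x'+1)(y'+1) = 1 if 1/2 < z ≤ 1/(α+1); and x'' = y' if z > 1/(α+1). -/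
open Set Filter MeasureTheory

/-- The value of `T α x` is the representative of `1 / x` modulo `1` in `[α - 1, α)`. -/
theorem T_eq_of_mem_Ico {α x v : ℝ} (hx : x ≠ 0) (n : ℤ) (hv : v = 1 / x - n)
    (hl : α - 1 ≤ v) (hu : v < α) : T α x = v := by
  have hn : ⌊1 / x + 1 - α⌋ = n := by
    rw [Int.floor_eq_iff]
    constructor <;> linarith
  rw [T, if_neg hx, hn, hv]

theorem T_one_eq_fract {x : ℝ} (hx : x ≠ 0) : T 1 x = Int.fract (1 / x) := by
  rw [T, if_neg hx, Int.fract, add_sub_cancel_right]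

/-- `T α` depends only on `1 / x` modulo `1`. -/
theorem T_congr {α x y : ℝ} (hx : x ≠ 0) (hy : y ≠ 0) (k : ℤ) (h : 1 / y = 1 / x + k) :
    T α y = T α x := by
  have h' : 1 / x + k + 1 - α = 1 / x + 1 - α + k := by ring
  rw [T, T, if_neg hx, if_neg hy, h, h', Int.floor_add_intCast]
  push_cast
  ring

theorem g_mul_g_add_one : g * (g + 1) = 1 := by
  have h : Real.sqrt 5 ^ 2 = 5 := Real.sq_sqrt (by norm_num)
  unfold g
  linarith

theorem half_lt_g : 1 / 2 < g := by
  have h : (2 : ℝ) < Real.sqrt 5 := Real.lt_sqrt_of_sq_lt (by norm_num)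
  unfold g
  linarith

/-- Comparison of the `T α`-images of `x` and `-x` with the Gauss image of `x`. -/
theorem T_neg_compare {α x : ℝ} (h : 1 / 2 < α) (h1 : α ≤ 1) (hx : x ≠ 0) :
    (T 1 x = T α x ∧ (T α x + T α (-x) = 0 ∨ T α x + T α (-x) = 1)) ∨
      (T 1 x = 1 + T α x ∧ T α x + T α (-x) = 0) := by
  have hnx : -x ≠ 0 := neg_ne_zero.mpr hx
  have hinv : 1 / (-x) = -(1 / x) := one_div_neg_eq_neg_one_div x
  have hf : Int.fract (1 / x) = 1 / x - ⌊1 / x⌋ := rfl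
  have h0 := Int.fract_nonneg (1 / x)
  have hlt := Int.fract_lt_one (1 / x)
  rw [T_one_eq_fract hx]
  set f := Int.fract (1 / x)
  set n := ⌊1 / x⌋
  rcases lt_or_ge f α with hfα | hfα
  · left
    have hTx : T α x = f := T_eq_of_mem_Ico hx n hf (by linarith) hfα
    refine ⟨hTx.symm, ?_⟩
    rcases le_or_gt f (1 - α) with hle | hgt
    · left
      rw [hTx, T_eq_of_mem_Ico (v := -f) hnx (-n) (by push_cast; linarith)
        (by linarith) (by linarith)]
      ring
    · right
      rw [hTx, T_eq_of_mem_Ico (v := 1 - f) hnx (-n - 1) (by push_cast; linarith)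
        (by linarith) (by linarith)]
      ring
  · right
    have hTx : T α x = f - 1 :=
      T_eq_of_mem_Ico hx (n + 1) (by push_cast; linarith) (by linarith) (by linarith)
    have hTy : T α (-x) = 1 - f :=
      T_eq_of_mem_Ico hnx (-n - 1) (by push_cast; linarith) (by linarith) (by linarith)
    rw [hTx, hTy]
    constructor <;> ring

theorem T_one_sub_eq {α x : ℝ} (h0 : 0 < α) (h1 : α ≤ 1) (hx : 1 - α < x)
    (hx' : x < α / (α + 1)) : T α (1 - x) = x / (1 - x) := by
  have hy : 0 < 1 - x := by
    have : α / (α + 1) < 1 := by rw [div_lt_one (by linarith)]; linarith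
    linarith
  refine T_eq_of_mem_Ico hy.ne' 1 ?_ ?_ ?_
  · field_simp
    push_cast
    ring
  · have : 0 ≤ x / (1 - x) := div_nonneg (by linarith) hy.le
    linarith
  · rw [lt_div_iff₀ (by linarith)] at hx'
    rw [div_lt_iff₀ hy]
    linarith

theorem T_T_one_sub {α x : ℝ} (h0 : 0 < α) (h1 : α ≤ 1) (hx : 1 - α < x)
    (hx' : x < α / (α + 1)) : T α (T α (1 - x)) = T α x := by
  have hx0 : 0 < x := by linarith
  have hy : 0 < 1 - x := by
    have : α / (α + 1) < 1 := by rw [div_lt_one (by linarith)]; linarith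
    linarith
  rw [T_one_sub_eq h0 h1 hx hx']
  refine T_congr hx0.ne' (div_pos hx0 hy).ne' (-1) ?_
  field_simp
  push_cast
  ring

theorem T_eq_sub_two {α x : ℝ} (hα : 1 / 2 < α) (hg : 1 < α * (α + 1))
    (hl : α / (α + 1) ≤ x) (hu : x ≤ 1 / (α + 1)) : T α x = 1 / x - 2 := by
  have hx : 0 < x := lt_of_lt_of_le (by positivity) hl
  rw [div_le_iff₀ (by linarith)] at hl
  rw [le_div_iff₀ (by linarith)] at hu
  refine T_eq_of_mem_Ico hx.ne' 2 (by norm_num) ?_ ?_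
  · have : α + 1 ≤ 1 / x := by rw [le_div_iff₀ hx]; linarith
    linarith
  · have : 1 / x < α + 2 := by
      rw [div_lt_iff₀ hx]
      nlinarith
    linarith

theorem T_one_eq_sub_one {x : ℝ} (hl : 1 / 2 < x) (hu : x ≤ 1) : T 1 x = (1 - x) / x := by
  have hx : 0 < x := by linarith
  refine T_eq_of_mem_Ico hx.ne' 1 (by push_cast; field_simp) ?_ ?_
  · rw [sub_self]
    exact div_nonneg (by linarith) hx.le
  · rw [div_lt_one hx]
    linarith

theorem T_one_T_one_sub {x : ℝ} (h0 : 0 < x) (h1 : x < 1 / 2) : T 1 (T 1 (1 - x)) = T 1 x := by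
  have hy : 0 < 1 - x := by linarith
  rw [T_one_eq_sub_one (x := 1 - x) (by linarith) (by linarith), sub_sub_cancel]
  refine T_congr h0.ne' (div_pos h0 hy).ne' (-1) ?_
  field_simp
  push_cast
  ring

theorem stmt19 (α : ℝ) (hα : α ∈ Set.Ioc g 1) (x y z : ℝ)
    (hx : x ∈ Set.Ico (α - 1) α) (hy : y ∈ Set.Ico (α - 1) α)
    (hz : z ∈ Set.Ico (0 : ℝ) 1) :
    (z = x → (x + y = 0 ∨ (x + 1) * (y + 1) = 1) →
      (T 1 z = T α x ∧ (T α x + T α y = 0 ∨ T α x + T α y = 1)) ∨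
      (T 1 z = 1 + T α x ∧ T α x + T α y = 0)) ∧
    (z = 1 + x → x + y = 0 →
      ((T 1)^[2] z = T α y ∧ (T α x + T α y = 0 ∨ T α x + T α y = 1)) ∨
      ((T 1)^[2] z = 1 + T α y ∧ T α x + T α y = 0)) ∧
    (z = x → x + y = 1 →
      (z < α / (α + 1) → T α x = (T α)^[2] y) ∧
      (α / (α + 1) ≤ z → z ≤ 1 / 2 →
        T 1 z = T α x ∧ (T α x + 1) * (T α y + 1) = 1) ∧
      (1 / 2 < z → z ≤ 1 / (α + 1) →
        (T 1)^[2] z = T α y ∧ (T α x + 1) * (T α y + 1) = 1) ∧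
      (1 / (α + 1) < z → (T α)^[2] x = T α y)) := by
  obtain ⟨hgα, h1⟩ := hα
  have hα : 1 / 2 < α := half_lt_g.trans hgα
  have hg : 1 < α * (α + 1) := by nlinarith [g_mul_g_add_one, half_lt_g]
  have hT1 : ∀ w, α / (α + 1) ≤ w → w ≤ 1 / 2 → T 1 w = 1 / w - 2 := fun w hl hu => by
    have hw : 0 < w := lt_of_lt_of_le (by positivity) hl
    rw [div_le_iff₀ (by linarith)] at hl
    refine T_eq_of_mem_Ico hw.ne' 2 (by norm_num) ?_ ?_
    · have : 2 ≤ 1 / w := by rw [le_div_iff₀ hw]; linarith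
      linarith
    · have : 1 / w < 3 := by rw [div_lt_iff₀ hw]; nlinarith
      linarith
  have hsub : 1 - α / (α + 1) = 1 / (α + 1) := by field_simp; ring
  have hhalf : 1 / 2 ≤ 1 / (α + 1) := one_div_le_one_div_of_le (by linarith) (by linarith)
  have hprod : ∀ w : ℝ, 0 < w → w < 1 → (1 / w - 2 + 1) * (1 / (1 - w) - 2 + 1) = 1 := by
    intro w hw hw1
    have : 0 < 1 - w := by linarith
    field_simp
    ring
  refine ⟨?_, ?_, ?_⟩
  · rintro rfl hxy
    rcases hz.1.eq_or_lt with rfl | hpos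
    · obtain rfl : y = 0 := by rcases hxy with h | h <;> linarith
      simp [T_zero]
    · have hTy : T α y = T α (-z) := by
        rcases hxy with h | h
        · rw [eq_neg_of_add_eq_zero_right h]
        · have hy' : y = -z / (z + 1) := by
            rw [eq_div_iff (by linarith)]
            linarith
          rw [hy']
          refine T_congr (by linarith) (div_neg_of_neg_of_pos (by linarith) (by linarith)).ne
            (-1) ?_
          field_simp
          push_cast
          ring
      rw [hTy]
      exact T_neg_compare hα h1 hpos.ne'
  · rintro rfl hxy
    obtain rfl : x = -y := eq_neg_of_add_eq_zero_left hxy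
    have hy0 : 0 < y := by linarith [hz.2]
    have hT2 : T 1 (T 1 (1 + -y)) = T 1 y := T_one_T_one_sub hy0 (by linarith [hx.1])
    rw [Function.iterate_succ, Function.iterate_one, Function.comp_apply, hT2,
      add_comm (T α (-y))]
    exact T_neg_compare hα h1 hy0.ne'
  · rintro rfl hxy
    obtain rfl : y = 1 - z := by linarith
    simp only [Function.iterate_succ, Function.iterate_zero, Function.comp_apply, id_eq]
    have hz0 : 0 < z := by linarith [hy.2]
    refine ⟨fun h => ?_, fun hl hu => ?_, fun hl hu => ?_, fun h => ?_⟩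
    · exact (T_T_one_sub (by linarith) h1 (by linarith [hy.2]) h).symm
    · rw [T_eq_sub_two hα hg hl (by linarith),
        T_eq_sub_two (x := 1 - z) hα hg (by linarith) (by linarith)]
      exact ⟨hT1 z hl hu, hprod z hz0 hz.2⟩
    · have hT2 : T 1 (T 1 z) = T 1 (1 - z) := by
        simpa using T_one_T_one_sub (x := 1 - z) (by linarith [hz.2]) (by linarith)
      rw [hT2, T_eq_sub_two (x := z) hα hg (by linarith) hu,
        T_eq_sub_two (x := 1 - z) hα hg (by linarith) (by linarith)]
      exact ⟨hT1 _ (by linarith) (by linarith), hprod z hz0 hz.2⟩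
    · simpa using T_T_one_sub (x := 1 - z) (by linarith) h1 (by linarith [hx.2]) (by linarith)
end
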